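/- Let 1 ≤ p < ∞ and 0 < q, r < ∞ with r < p and q < p, and let u, v, w be weights on (a,b). Then there exists a finite constant C > 0 such that the inequality (∫_a^b (∫_a^x (∫_a^t f(s) ds)^q u(t) dt)^{r/q} w(x) dx)^{1/r} ≤ C (∫_a^b f(x)^p v(x) dx)^{1/p} holds for all f ∈ 𝔐⁺(a,b) if and only if both C₃ := (∫_a^b (∫_x^b w(s) (∫_x^s u)^{r/q} ds)^{r/(p-r)} w(x) · ess sup_{t∈(a,x)} (∫_t^x u)^{r/q} V_p(a,t)^{pr/(p-r)} dx)^{(p-r)/(pr)} < ∞ and C₅ := (∫_a^b (∫_x^b w)^{r/(p-r)} w(x) (∫_a^x (∫_t^x u)^{q/(p-q)} u(t) V_p(a,t)^{pq/(p-q)} dt)^{r(p-q)/(q(p-r))} dx)^{(p-r)/(pr)} < ∞. Moreover, the best constant C in the inequality satisfies C ≈ C₃ + C₅. -/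

import Mathlib

open MeasureTheory Set ENNReal

noncomputable section

/-- The open interval `(a, b)` with extended-real endpoints, viewed as a set of reals. -/
def io (a b : EReal) : Set ℝ := {x : ℝ | a < (x : EReal) ∧ (x : EReal) < b}

/-- A weight on `(a, b)`: a measurable function which is positive and finite on `(a, b)`. -/
def IsWeight (a b : EReal) (u : ℝ → ℝ≥0∞) : Prop :=
  Measurable u ∧ ∀ x ∈ io a b, 0 < u x ∧ u x < ⊤

/-- `V_p(x, y)` from the paper. -/
def Vp (p : ℝ) (v : ℝ → ℝ≥0∞) (x y : EReal) : ℝ≥0∞ :=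
  if p = 1 then essSup (fun s => (v s)⁻¹) (volume.restrict (io x y))
  else (∫⁻ s in io x y, v s ^ (-(1 / (p - 1)))) ^ ((p - 1) / p)

/-- The left-hand side of the iterated Hardy inequality. -/
def lhsIter (a b : EReal) (q r : ℝ) (u w f : ℝ → ℝ≥0∞) : ℝ≥0∞ :=
  (∫⁻ x in io a b,
    (∫⁻ t in io a x, (∫⁻ s in io a t, f s) ^ q * u t) ^ (r / q) * w x) ^ (1 / r)

/-- The right-hand side (without the constant) of the iterated Hardy inequality. -/
def rhsNorm (a b : EReal) (p : ℝ) (v f : ℝ → ℝ≥0∞) : ℝ≥0∞ :=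
  (∫⁻ x in io a b, f x ^ p * v x) ^ (1 / p)

/-- The best constant in the iterated Hardy inequality. -/
def bestIter (a b : EReal) (p q r : ℝ) (u v w : ℝ → ℝ≥0∞) : ℝ≥0∞ :=
  sInf {C : ℝ≥0∞ | ∀ f : ℝ → ℝ≥0∞, Measurable f →
    lhsIter a b q r u w f ≤ C * rhsNorm a b p v f}

/-- The constant `C₃`. -/
def C3 (a b : EReal) (p q r : ℝ) (u v w : ℝ → ℝ≥0∞) : ℝ≥0∞ :=
  (∫⁻ x in io a b,
      (∫⁻ s in io x b, w s * (∫⁻ σ in io x s, u σ) ^ (r / q)) ^ (r / (p - r)) * w x *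
      essSup (fun t : ℝ =>
          (∫⁻ s in io t x, u s) ^ (r / q) * Vp p v a t ^ (p * r / (p - r)))
        (volume.restrict (io a x))) ^ ((p - r) / (p * r))

/-- The constant `C₅`. -/
def C5 (a b : EReal) (p q r : ℝ) (u v w : ℝ → ℝ≥0∞) : ℝ≥0∞ :=
  (∫⁻ x in io a b, (∫⁻ t in io x b, w t) ^ (r / (p - r)) * w x *
      (∫⁻ t in io a x,
        (∫⁻ s in io t x, u s) ^ (q / (p - q)) * u t * Vp p v a t ^ (p * q / (p - q))) ^
        (r * (p - q) / (q * (p - r)))) ^ ((p - r) / (p * r))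

/-- The real power `2 ^ x` as an extended non-negative real. -/
def p2 (x : ℝ) : ℝ≥0∞ := 2 ^ x

lemma p2_pos (x : ℝ) : 0 < p2 x := ENNReal.rpow_pos (by simp) (by simp)
lemma p2_ne_zero (x : ℝ) : p2 x ≠ 0 := (p2_pos x).ne'
lemma p2_ne_top (x : ℝ) : p2 x ≠ ⊤ := by
  unfold p2
  exact ENNReal.rpow_ne_top_of_ne_zero (by simp) (by simp)
lemma p2_zero : p2 0 = 1 := by simp [p2]
lemma p2_one : p2 1 = 2 := by simp [p2]
lemma p2_add (x y : ℝ) : p2 (x + y) = p2 x * p2 y :=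
  ENNReal.rpow_add _ _ (by simp) (by simp)
lemma p2_rpow (x y : ℝ) : p2 x ^ y = p2 (x * y) := (ENNReal.rpow_mul _ _ _).symm
lemma p2_mono {x y : ℝ} (h : x ≤ y) : p2 x ≤ p2 y :=
  ENNReal.rpow_le_rpow_of_exponent_le (by norm_num) h
lemma p2_lt {x y : ℝ} (h : x < y) : p2 x < p2 y :=
  ENNReal.rpow_lt_rpow_of_exponent_lt (by norm_num) (by simp) h
lemma p2_le_iff {x y : ℝ} : p2 x ≤ p2 y ↔ x ≤ y :=
  ⟨fun h => by by_contra! h'; exact absurd h (not_le.2 (p2_lt h')), p2_mono⟩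
lemma p2_lt_iff {x y : ℝ} : p2 x < p2 y ↔ x < y := by
  rw [← not_le, p2_le_iff, not_le]
lemma p2_neg (x : ℝ) : p2 (-x) = (p2 x)⁻¹ := ENNReal.rpow_neg _ _
lemma p2_mul_neg (x : ℝ) : p2 x * p2 (-x) = 1 := by rw [← p2_add]; simp [p2_zero]
lemma p2_neg_mul (x : ℝ) : p2 (-x) * p2 x = 1 := by rw [← p2_add]; simp [p2_zero]

/-- The geometric series with ratio `2 ^ (-a)`. -/
def gs (a : ℝ) : ℝ≥0∞ := ∑' m : ℕ, p2 (-(m * a))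

lemma gs_ne_top {a : ℝ} (ha : 0 < a) : gs a ≠ ⊤ := by
  have h : ∀ m : ℕ, p2 (-(m * a)) = p2 (-a) ^ m := by
    intro m
    rw [← ENNReal.rpow_natCast, p2_rpow]; congr 1; ring
  have h1 : p2 (-a) < 1 := by rw [← p2_zero, p2_lt_iff]; linarith
  unfold gs
  simp_rw [h]
  rw [ENNReal.tsum_geometric]
  exact ENNReal.inv_ne_top.2 (tsub_pos_of_lt h1).ne'

lemma one_le_gs (a : ℝ) : 1 ≤ gs a := by
  have := ENNReal.le_tsum (f := fun m : ℕ => p2 (-(m * a))) 0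
  simpa [gs, p2_zero] using this

lemma gs_pos (a : ℝ) : 0 < gs a := lt_of_lt_of_le one_pos (one_le_gs a)

lemma tsum_le_gs (j : ℤ) (a : ℝ) :
    ∑' i : ℤ, (if i ≤ j then p2 (-(((j : ℝ) - i) * a)) else 0) = gs a := by
  have hinj : Function.Injective (fun m : ℕ => j - (m : ℤ)) := by
    intro m n h; simpa using h
  rw [← hinj.tsum_eq]
  · unfold gs
    congr 1; ext m
    simp
  · intro i hi
    by_cases h : i ≤ j
    · exact ⟨(j - i).toNat, by simp; omega⟩
    · simp [h] at hi

lemma tsum_ge_gs (i : ℤ) (a : ℝ) :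
    ∑' j : ℤ, (if i ≤ j then p2 (-(((j : ℝ) - i) * a)) else 0) = gs a := by
  have hinj : Function.Injective (fun m : ℕ => i + (m : ℤ)) := by
    intro m n h; simpa using h
  rw [← hinj.tsum_eq]
  · unfold gs
    congr 1; ext m
    simp
  · intro j hi
    by_cases h : i ≤ j
    · exact ⟨(j - i).toNat, by simp; omega⟩
    · simp [h] at hi

lemma exists_p2_block {x : ℝ≥0∞} (h0 : x ≠ 0) (h1 : x ≠ ⊤) :
    ∃ k : ℤ, p2 k < x ∧ x ≤ p2 (k + 1) := by
  obtain ⟨k, hk⟩ := ENNReal.exists_mem_Ioc_zpow h0 h1 (y := 2) (by norm_num) (by simp)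
  refine ⟨k, ?_, ?_⟩
  · unfold p2; rw [ENNReal.rpow_intCast]; exact hk.1
  · unfold p2
    have := hk.2
    rw [← ENNReal.rpow_intCast] at this
    simpa using this

/-- The sum of `2 ^ (k a)` over the dyadic levels `2 ^ k` below `x`. -/
lemma tsum_level_le (x : ℝ≥0∞) {a : ℝ} (ha : 0 < a) :
    ∑' k : ℤ, (if p2 k < x then p2 (k * a) else 0) ≤ gs a * x ^ a := by
  by_cases hx0 : x = 0
  · subst hx0; simp
  by_cases hx : x = ⊤
  · subst hx
    rw [ENNReal.top_rpow_of_pos ha, ENNReal.mul_top (gs_pos a).ne']; exact le_top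
  obtain ⟨K, h1, h2⟩ := exists_p2_block hx0 hx
  calc ∑' k : ℤ, (if p2 k < x then p2 (k * a) else 0)
      ≤ ∑' k : ℤ, (if k ≤ K then p2 (-(((K : ℝ) - k) * a)) else 0) * p2 (K * a) := by
        refine ENNReal.tsum_le_tsum fun k => ?_
        split_ifs with h h'
        · rw [← p2_add]; apply p2_mono; linarith
        · exfalso
          have : p2 k < p2 (K + 1) := lt_of_lt_of_le h h2
          rw [p2_lt_iff] at this
          norm_cast at this
          omega
        · simp
        · simp
    _ = gs a * p2 (K * a) := by rw [ENNReal.tsum_mul_right, tsum_le_gs]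
    _ ≤ gs a * x ^ a := by
        gcongr
        rw [← p2_rpow]; gcongr

/-- Lower counterpart: some level `2^k` below `x` is at least `x/2`. -/
lemma le_tsum_level {x : ℝ≥0∞} (hx : x ≠ ⊤) {a : ℝ} (ha : 0 < a) :
    x ^ a ≤ p2 a * ∑' k : ℤ, (if p2 k < x then p2 (k * a) else 0) := by
  by_cases hx0 : x = 0
  · subst hx0; simp [ha]
  obtain ⟨K, h1, h2⟩ := exists_p2_block hx0 hx
  calc x ^ a ≤ p2 (K + 1) ^ a := by gcongr
    _ = p2 a * (if p2 K < x then p2 (K * a) else 0) := by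
        rw [if_pos h1, p2_rpow, ← p2_add]; congr 1; ring
    _ ≤ _ := by
        gcongr
        exact ENNReal.le_tsum (f := fun k : ℤ => (if p2 k < x then p2 (k * a) else 0)) K

lemma add_rpow_le' (x y : ℝ≥0∞) {a : ℝ} (ha : 0 ≤ a) :
    (x + y) ^ a ≤ p2 a * (x ^ a + y ^ a) := by
  rcases le_total x y with h | h
  · calc (x + y) ^ a ≤ (2 * y) ^ a := by rw [two_mul]; gcongr
      _ = p2 a * y ^ a := by rw [ENNReal.mul_rpow_of_nonneg _ _ ha]; rfl
      _ ≤ _ := by gcongr; exact le_add_self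
  · calc (x + y) ^ a ≤ (2 * x) ^ a := by rw [two_mul]; gcongr
      _ = p2 a * x ^ a := by rw [ENNReal.mul_rpow_of_nonneg _ _ ha]; rfl
      _ ≤ _ := by gcongr; exact le_self_add

lemma rpow_cancel (x : ℝ≥0∞) {a b : ℝ} (h : a * b = 1) : (x ^ a) ^ b = x := by
  rw [← ENNReal.rpow_mul, h, ENNReal.rpow_one]

/-- Discrete Hardy-type inequality against a geometric weight. -/
lemma sum_hardy {ρ : ℝ} (hρ : 0 < ρ) (a : ℤ → ℝ≥0∞) :
    ∑' j : ℤ, p2 (-j) * (∑' i : ℤ, if i ≤ j then a i else 0) ^ ρ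
      ≤ gs (1 / (2 * ρ)) ^ ρ * gs (1 / 2) * ∑' j : ℤ, p2 (-j) * a j ^ ρ := by
  set M : ℤ → ℝ≥0∞ := fun j => ∑' i : ℤ, if i ≤ j then p2 (((j : ℝ) - i) / 2) * a i ^ ρ else 0
    with hM
  have h1 : ∀ i j : ℤ, i ≤ j → a i ≤ p2 (-(((j : ℝ) - i) * (1 / (2 * ρ)))) * M j ^ (1 / ρ) := by
    intro i j hij
    have : p2 (((j : ℝ) - i) / 2) * a i ^ ρ ≤ M j := by
      have := ENNReal.le_tsum
        (f := fun i : ℤ => if i ≤ j then p2 (((j : ℝ) - i) / 2) * a i ^ ρ else 0) i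
      simpa [hij] using this
    calc a i = (p2 (-(((j : ℝ) - i) / 2)) * (p2 (((j : ℝ) - i) / 2) * a i ^ ρ)) ^ (1 / ρ) := by
          rw [← mul_assoc, p2_neg_mul, one_mul, rpow_cancel _ (by field_simp)]
      _ ≤ (p2 (-(((j : ℝ) - i) / 2)) * M j) ^ (1 / ρ) := by gcongr
      _ = _ := by
          rw [ENNReal.mul_rpow_of_nonneg _ _ (by positivity), p2_rpow]; congr 2; field_simp
  have h2 : ∀ j : ℤ, (∑' i : ℤ, if i ≤ j then a i else 0) ^ ρ ≤ gs (1 / (2 * ρ)) ^ ρ * M j := by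
    intro j
    calc (∑' i : ℤ, if i ≤ j then a i else 0) ^ ρ
        ≤ (∑' i : ℤ, (if i ≤ j then p2 (-(((j : ℝ) - i) * (1 / (2 * ρ)))) else 0)
            * M j ^ (1 / ρ)) ^ ρ := by
          gcongr with i
          split_ifs with h
          · exact h1 i j h
          · simp
      _ = _ := by
          rw [ENNReal.tsum_mul_right, tsum_le_gs, ENNReal.mul_rpow_of_nonneg _ _ hρ.le,
            rpow_cancel _ (by field_simp)]
  calc ∑' j : ℤ, p2 (-j) * (∑' i : ℤ, if i ≤ j then a i else 0) ^ ρ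
      ≤ ∑' j : ℤ, p2 (-j) * (gs (1 / (2 * ρ)) ^ ρ * M j) := by
        gcongr with j; exact h2 j
    _ = gs (1 / (2 * ρ)) ^ ρ * ∑' j : ℤ, p2 (-j) * M j := by
        rw [← ENNReal.tsum_mul_left]; congr 1; ext j; ring
    _ = gs (1 / (2 * ρ)) ^ ρ * (gs (1 / 2) * ∑' j : ℤ, p2 (-j) * a j ^ ρ) := by
        congr 1
        calc ∑' j : ℤ, p2 (-j) * M j
            = ∑' j : ℤ, ∑' i : ℤ, (if i ≤ j then p2 (-(((j : ℝ) - i) * (1 / 2))) else 0) *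
                (p2 (-i) * a i ^ ρ) := by
              congr 1; ext j
              rw [hM, ← ENNReal.tsum_mul_left]; congr 1; ext i
              split_ifs with h
              · rw [← mul_assoc, ← mul_assoc, ← p2_add, ← p2_add]; congr 2; ring
              · simp
          _ = ∑' i : ℤ, ∑' j : ℤ, (if i ≤ j then p2 (-(((j : ℝ) - i) * (1 / 2))) else 0) *
                (p2 (-i) * a i ^ ρ) := ENNReal.tsum_comm
          _ = _ := by
              simp_rw [ENNReal.tsum_mul_right, tsum_ge_gs]
              rw [ENNReal.tsum_mul_left]
    _ = _ := by ring

lemma sum_hardy' {ρ : ℝ} (hρ : 0 < ρ) : ∃ c : ℝ≥0∞, c ≠ ⊤ ∧ ∀ a : ℤ → ℝ≥0∞,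
    ∑' j : ℤ, p2 (-j) * (∑' i : ℤ, if i ≤ j then a i else 0) ^ ρ
      ≤ c * ∑' j : ℤ, p2 (-j) * a j ^ ρ :=
  ⟨_, ENNReal.mul_ne_top (ENNReal.rpow_ne_top_of_nonneg hρ.le (gs_ne_top (by positivity)))
    (gs_ne_top (by norm_num)), sum_hardy hρ⟩

/-- Every set has a countable coinitial subset. -/
def CountablyCoinitial (α : Type*) [LinearOrder α] : Prop :=
  ∀ S : Set α, ∃ C ⊆ S, C.Countable ∧ ∀ s ∈ S, ∃ c ∈ C, c ≤ s

lemma countablyCoinitial_real : CountablyCoinitial ℝ := by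
  intro S
  classical
  by_cases hmin : ∃ m ∈ S, ∀ s ∈ S, m ≤ s
  · obtain ⟨m, hm, h⟩ := hmin
    exact ⟨{m}, by simpa using hm, countable_singleton m, fun s hs => ⟨m, rfl, h s hs⟩⟩
  · push Not at hmin
    have hq : ∀ x : {x : ℚ // ∃ s ∈ S, s < x}, ∃ s ∈ S, s < (x : ℚ) := fun x => x.2
    choose f hf hf' using hq
    refine ⟨range f, by rintro _ ⟨x, rfl⟩; exact hf x, countable_range f, fun s hs => ?_⟩
    obtain ⟨s', hs', hlt⟩ := hmin s hs
    obtain ⟨x, hx1, hx2⟩ := exists_rat_btwn hlt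
    exact ⟨f ⟨x, s', hs', hx1⟩, mem_range_self _, ((hf' ⟨x, s', hs', hx1⟩).trans hx2).le⟩

lemma countablyCoinitial_int : CountablyCoinitial ℤ :=
  fun S => ⟨S, subset_rfl, S.to_countable, fun s hs => ⟨s, hs, le_rfl⟩⟩

section Tail
variable {α : Type*} [LinearOrder α] [MeasurableSpace α]

lemma measure_le_of_tails (hα : CountablyCoinitial α) (μ : Measure α) {S : Set α} {l : ℝ≥0∞}
    (h : ∀ s ∈ S, μ (Ici s) ≤ l) : μ S ≤ l := by
  obtain ⟨C, hCS, hC, hcov⟩ := hα S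
  calc μ S ≤ μ (⋃ c ∈ C, Ici c) := by
        apply measure_mono
        intro s hs
        obtain ⟨c, hc, hcs⟩ := hcov s hs
        simp only [mem_iUnion]
        exact ⟨c, hc, hcs⟩
    _ = ⨆ c ∈ C, μ (Ici c) := by
        apply measure_biUnion_eq_iSup hC
        intro x hx y hy
        rcases le_total x y with hxy | hxy
        · exact ⟨x, hx, subset_rfl, Ici_subset_Ici.2 hxy⟩
        · exact ⟨y, hy, Ici_subset_Ici.2 hxy, subset_rfl⟩
    _ ≤ l := iSup₂_le fun c hc => h c (hCS hc)

lemma measure_tail_le (hα : CountablyCoinitial α) (μ : Measure α) (l : ℝ≥0∞) :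
    μ {s | μ (Ici s) ≤ l} ≤ l :=
  measure_le_of_tails hα μ fun _ hs => hs

lemma rpow_one_add (x : ℝ≥0∞) {β : ℝ} (hβ : 0 ≤ β) : x ^ (1 + β) = x * x ^ β := by
  rw [ENNReal.rpow_add_of_nonneg _ _ zero_le_one hβ, ENNReal.rpow_one]

lemma tail_lemma (hα : CountablyCoinitial α) (μ : Measure α)
    (hm : Measurable fun s => μ (Ici s)) {β : ℝ} (hβ : 0 < β) :
    μ univ ^ (1 + β) ≤ p2 (1 + β) * ∫⁻ s, μ (Ici s) ^ β ∂μ := by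
  have key : ∀ l : ℝ≥0∞, l ^ β * μ {s | l < μ (Ici s)} ≤ ∫⁻ s, μ (Ici s) ^ β ∂μ := by
    intro l
    calc l ^ β * μ {s | l < μ (Ici s)}
        ≤ l ^ β * μ {s | l ^ β ≤ μ (Ici s) ^ β} := by
          gcongr
          intro h; gcongr
      _ ≤ _ := mul_meas_ge_le_lintegral (hm.pow_const β) _
  have hsplit : ∀ l : ℝ≥0∞, μ univ ≤ l + μ {s | l < μ (Ici s)} := by
    intro l
    calc μ univ = μ ({s | μ (Ici s) ≤ l} ∪ {s | l < μ (Ici s)}) := by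
          congr 1; ext s; simp [le_or_gt]
      _ ≤ _ := (measure_union_le _ _).trans (by gcongr; exact measure_tail_le hα μ l)
  by_cases htop : μ univ = ⊤
  · have h1 : μ {s | 1 < μ (Ici s)} = ⊤ := by
      have := hsplit 1
      rw [htop, top_le_iff, ENNReal.add_eq_top] at this
      simpa using this
    have := key 1
    rw [h1] at this
    simp only [one_rpow, one_mul, top_le_iff] at this
    rw [this, ENNReal.mul_top (p2_ne_zero _)]
    exact le_top
  · have h1 := hsplit (μ univ / 2)
    have h2 : μ univ / 2 ≤ μ {s | μ univ / 2 < μ (Ici s)} := by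
      have h3 : μ univ / 2 ≠ ⊤ := (ENNReal.div_lt_top htop (by simp)).ne
      rw [← ENNReal.add_le_add_iff_left h3, ENNReal.add_halves]
      exact h1
    calc μ univ ^ (1 + β) = (2 * (μ univ / 2)) ^ (1 + β) := by
          rw [ENNReal.mul_div_cancel (by simp) (by simp)]
      _ = p2 (1 + β) * ((μ univ / 2) ^ β * (μ univ / 2)) := by
          rw [ENNReal.mul_rpow_of_nonneg _ _ (by positivity), rpow_one_add (μ univ / 2) hβ.le,
            mul_comm (μ univ / 2)]
          rfl
      _ ≤ p2 (1 + β) * ((μ univ / 2) ^ β * μ {s | μ univ / 2 < μ (Ici s)}) := by gcongr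
      _ ≤ _ := by gcongr; exact key _

lemma exists_half_tail (hα : CountablyCoinitial α) (μ : Measure α) {A : Set α}
    (hA : MeasurableSet A) (hI : ∀ s : α, MeasurableSet (Ici s)) (h0 : μ A ≠ 0) (h1 : μ A ≠ ⊤) :
    ∃ A' ⊆ A, 0 < μ A' ∧ ∀ t ∈ A', μ A ≤ 2 * μ (A ∩ Ici t) := by
  set S := {s | μ (A ∩ Ici s) ≤ μ A / 2}
  have h2 : μ (A ∩ S) ≤ μ A / 2 := by
    have := measure_tail_le hα (μ.restrict A) (μ A / 2)
    rw [Measure.restrict_apply' hA, inter_comm] at this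
    simpa only [Measure.restrict_apply (hI _), inter_comm _ A] using this
  refine ⟨A \ S, sdiff_subset, ?_, ?_⟩
  · rw [pos_iff_ne_zero]
    intro h3
    have := measure_le_inter_add_sdiff μ A S
    rw [h3, add_zero] at this
    exact absurd (this.trans h2) (not_le.2 (ENNReal.half_lt_self h0 h1))
  · rintro t ⟨-, ht⟩
    have : μ A / 2 ≤ μ (A ∩ Ici t) := (not_le.1 ht).le
    calc μ A = 2 * (μ A / 2) := by rw [ENNReal.mul_div_cancel (by simp) (by simp)]
      _ ≤ _ := by gcongr

end Tail

/-- The measure on `ℤ` with masses `m`. -/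
def disc (m : ℤ → ℝ≥0∞) : Measure ℤ := Measure.sum fun j => m j • Measure.dirac j

lemma lintegral_disc (m f : ℤ → ℝ≥0∞) : ∫⁻ j, f j ∂(disc m) = ∑' j, m j * f j := by
  simp [disc, lintegral_sum_measure, lintegral_smul_measure]

lemma disc_apply (m : ℤ → ℝ≥0∞) (A : Set ℤ) [DecidablePred (· ∈ A)] :
    disc m A = ∑' j, if j ∈ A then m j else 0 := by
  rw [disc, Measure.sum_apply _ (MeasurableSet.of_discrete)]
  congr 1; ext j
  simp [Measure.smul_apply, indicator_apply]

lemma tail_disc (m : ℤ → ℝ≥0∞) (P : ℤ → Prop) [DecidablePred P] {β : ℝ} (hβ : 0 < β) :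
    (∑' j, if P j then m j else 0) ^ (1 + β) ≤ p2 (1 + β) *
      ∑' j, if P j then m j * (∑' l, if j ≤ l ∧ P l then m l else 0) ^ β else 0 := by
  have h := tail_lemma countablyCoinitial_int (disc fun j => if P j then m j else 0)
    (Measurable.of_discrete) hβ
  rw [lintegral_disc] at h
  classical
  simp only [disc_apply, mem_univ, mem_Ici, ← ite_and, true_and] at h
  convert h using 4
  split_ifs <;> simp

/-- The tail lemma for a restricted measure on the line. -/
lemma tail_real (μ : Measure ℝ) (A : Set ℝ) {β : ℝ} (hβ : 0 < β) :
    μ A ^ (1 + β) ≤ p2 (1 + β) * ∫⁻ s in A, μ (A ∩ Ici s) ^ β ∂μ := by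
  have h := tail_lemma countablyCoinitial_real (μ.restrict A) (Antitone.measurable
    fun s t hst => measure_mono (Ici_subset_Ici.2 hst)) hβ
  simpa only [Measure.restrict_apply MeasurableSet.univ, univ_inter,
    Measure.restrict_apply measurableSet_Ici, inter_comm _ A, inter_univ] using h

/-- Hölder-type bound for sums of indicator functions with weights. -/
lemma holder_levels {α : Type*} [MeasurableSpace α] (μ : Measure α) (E : ℤ → Set α)
    [∀ k s, Decidable (s ∈ E k)]
    (hE : ∀ k, MeasurableSet (E k)) (h : ℤ → ℝ≥0∞) {q β : ℝ} (hq : 0 < q) (hq1 : q < 1)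
    (hβ : 0 < β) (hβq : β * (1 - q) = q) :
    ∫⁻ s, (∑' k, if s ∈ E k then h k else 0) ^ q ∂μ ≤
      (∑' k : ℤ, p2 (k * β) * μ (E k) ^ (1 + β)) ^ (1 - q) * (∑' k : ℤ, h k * p2 (-k)) ^ q := by
  set T := ∑' k : ℤ, p2 (k * β) * μ (E k) ^ (1 + β) with hT
  by_cases hTtop : T = ⊤
  · by_cases h0 : ∑' k : ℤ, h k * p2 (-k) = 0
    · rw [ENNReal.tsum_eq_zero] at h0
      have h0' : ∀ k, h k = 0 := fun k => by simpa [p2_ne_zero] using h0 k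
      simp [h0', hq]
    · rw [hTtop, ENNReal.top_rpow_of_pos (by linarith), ENNReal.top_mul]
      · exact le_top
      · intro h1
        exact h0 ((ENNReal.rpow_eq_zero_iff_of_pos hq).1 h1)
  set K : α → ℝ≥0∞ := fun s => ⨆ k : ℤ, (E k).indicator (fun _ => p2 k * μ (E k)) s with hK
  set H : α → ℝ≥0∞ := fun s => ∑' k, if s ∈ E k then h k else 0
  have hH : H = fun s => ∑' k, (E k).indicator (fun _ => h k) s := by
    ext s; simp only [H, indicator_apply]
  have hHm : Measurable H := by
    rw [hH]
    exact Measurable.tsum fun k => measurable_const.indicator (hE k)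
  have hKm : Measurable K := Measurable.iSup fun k => measurable_const.indicator (hE k)
  have hKle : ∀ k, ∀ s ∈ E k, p2 k * μ (E k) ≤ K s := by
    intro k s hs
    refine le_trans ?_ (le_iSup _ k)
    simp [hs]
  have hKβ : ∀ s, K s ^ β ≤ ∑' k : ℤ, (E k).indicator (fun _ => p2 (k * β) * μ (E k) ^ β) s := by
    intro s
    rw [← ENNReal.le_rpow_inv_iff hβ]
    refine iSup_le fun k => ?_
    rw [ENNReal.le_rpow_inv_iff hβ]
    refine le_trans ?_ (ENNReal.le_tsum k)
    by_cases hs : s ∈ E k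
    · simp [hs, ENNReal.mul_rpow_of_nonneg _ _ hβ.le, p2_rpow]
    · simp [hs, hβ]
  have hKint : ∫⁻ s, K s ^ β ∂μ ≤ T := by
    refine (lintegral_mono hKβ).trans ?_
    rw [lintegral_tsum fun k => (measurable_const.indicator (hE k)).aemeasurable]
    refine ENNReal.tsum_le_tsum fun k => ?_
    rw [lintegral_indicator_const (hE k), mul_assoc, rpow_one_add _ hβ.le, mul_comm (μ (E k))]
  have hKfin : ∀ᵐ s ∂μ, K s ≠ ⊤ := by
    have := ae_lt_top (hKm.pow_const β) (ne_top_of_le_ne_top hTtop hKint)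
    filter_upwards [this] with s hs hs'
    rw [hs', ENNReal.top_rpow_of_pos hβ] at hs
    exact lt_irrefl _ hs
  have hnull : ∀ᵐ s ∂μ, ∀ k, s ∈ E k → μ (E k) ≠ 0 := by
    rw [ae_all_iff]
    intro k
    by_cases hk : μ (E k) = 0
    · filter_upwards [measure_eq_zero_iff_ae_notMem.1 hk] with s hs hs'
      exact absurd hs' hs
    · exact Filter.Eventually.of_forall fun s _ => hk
  have hpt : ∀ᵐ s ∂μ, H s ^ q ≤ (H s / K s) ^ q * (K s ^ β) ^ (1 - q) := by
    filter_upwards [hKfin, hnull] with s hs1 hs2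
    by_cases hK0 : K s = 0
    · have : H s = 0 := by
        simp only [H, ENNReal.tsum_eq_zero]
        intro k
        split_ifs with hk
        · exfalso
          have := hKle k s hk
          rw [hK0, nonpos_iff_eq_zero, mul_eq_zero] at this
          exact this.elim (p2_ne_zero _) (hs2 k hk)
        · rfl
      rw [this, ENNReal.zero_rpow_of_pos hq]; exact zero_le
    · rw [← ENNReal.rpow_mul, hβq, ← ENNReal.mul_rpow_of_nonneg _ _ hq.le,
        ENNReal.div_mul_cancel hK0 hs1]
  have hHK : ∫⁻ s, H s / K s ∂μ ≤ ∑' k : ℤ, h k * p2 (-k) := by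
    calc ∫⁻ s, H s / K s ∂μ = ∫⁻ s, ∑' k, (E k).indicator (fun _ => h k) s / K s ∂μ := by
          congr 1; ext s
          rw [hH]
          simp only [div_eq_mul_inv, ENNReal.tsum_mul_right]
      _ = ∑' k, ∫⁻ s, (E k).indicator (fun _ => h k) s / K s ∂μ :=
          lintegral_tsum fun k => ((measurable_const.indicator (hE k)).div hKm).aemeasurable
      _ ≤ _ := by
          refine ENNReal.tsum_le_tsum fun k => ?_
          calc ∫⁻ s, (E k).indicator (fun _ => h k) s / K s ∂μ
              ≤ ∫⁻ s, (E k).indicator (fun _ => h k * (p2 k * μ (E k))⁻¹) s ∂μ := by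
                refine lintegral_mono fun s => ?_
                by_cases hs : s ∈ E k
                · simp only [hs, indicator_of_mem, div_eq_mul_inv]
                  gcongr
                  exact hKle k s hs
                · simp [hs]
            _ = h k * p2 (-k) * ((μ (E k))⁻¹ * μ (E k)) := by
                rw [lintegral_indicator_const (hE k), ENNReal.mul_inv (.inl (p2_ne_zero _))
                  (.inl (p2_ne_top _)), p2_neg]
                ring
            _ ≤ h k * p2 (-k) * 1 := by
                gcongr
                exact ENNReal.inv_mul_le_one _
            _ = _ := mul_one _
  calc ∫⁻ s, H s ^ q ∂μ ≤ ∫⁻ s, (H s / K s) ^ q * (K s ^ β) ^ (1 - q) ∂μ := lintegral_mono_ae hpt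
    _ ≤ (∫⁻ s, H s / K s ∂μ) ^ q * (∫⁻ s, K s ^ β ∂μ) ^ (1 - q) :=
        ENNReal.lintegral_mul_norm_pow_le (hHm.div hKm).aemeasurable
          (hKm.pow_const β).aemeasurable hq.le (by linarith) (by ring)
    _ ≤ (∑' k : ℤ, h k * p2 (-k)) ^ q * T ^ (1 - q) := by
        have : 0 ≤ 1 - q := by linarith
        gcongr
    _ = _ := mul_comm _ _

lemma measure_le_of_tails_left (μ : Measure ℝ) {S : Set ℝ} {l : ℝ≥0∞}
    (h : ∀ s ∈ S, μ (Iic s) ≤ l) : μ S ≤ l := by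
  have := measure_le_of_tails countablyCoinitial_real (μ.map (MeasurableEquiv.neg ℝ))
    (S := (fun x => -x) ⁻¹' S) (l := l) (by
      intro s hs
      rw [MeasurableEquiv.map_apply]
      refine le_trans (measure_mono ?_) (h _ hs)
      intro x hx
      simp only [mem_preimage, MeasurableEquiv.neg_apply, mem_Ici] at hx
      simp only [mem_Iic]; linarith)
  rw [MeasurableEquiv.map_apply] at this
  refine le_trans (measure_mono ?_) this
  intro x hx
  simpa using hx

/-- Dyadic blocks of the tail function of `ν`. -/
def blkG (ν : Measure ℝ) (j : ℤ) : Set ℝ := {x | p2 (-(j + 1)) < ν (Ioi x) ∧ ν (Ioi x) ≤ p2 (-j)}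

lemma antitone_tail (ν : Measure ℝ) : Antitone fun x => ν (Ioi x) :=
  fun _ _ h => measure_mono (Ioi_subset_Ioi h)

lemma measurable_tail (ν : Measure ℝ) : Measurable fun x => ν (Ioi x) :=
  (antitone_tail ν).measurable

lemma measurableSet_blkG (ν : Measure ℝ) (j : ℤ) : MeasurableSet (blkG ν j) :=
  (measurableSet_lt measurable_const (measurable_tail ν)).inter
    (measurableSet_le (measurable_tail ν) measurable_const)

lemma blkG_le {ν : Measure ℝ} {i j : ℤ} {x y : ℝ} (hx : x ∈ blkG ν i) (hy : y ∈ blkG ν j)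
    (h : x ≤ y) : i ≤ j := by
  have h1 := (hy.1.trans_le (antitone_tail ν h)).trans_le hx.2
  rw [p2_lt_iff] at h1
  have h2 : (i : ℝ) < j + 1 := by linarith
  norm_cast at h2
  omega

lemma blkG_lt {ν : Measure ℝ} {i j : ℤ} {x y : ℝ} (hx : x ∈ blkG ν i) (hy : y ∈ blkG ν j)
    (h : i < j) : x < y := by
  by_contra! h'
  exact absurd (blkG_le hy hx h') (by omega)

lemma blkG_disjoint (ν : Measure ℝ) : Pairwise (Function.onFun Disjoint (blkG ν)) := by
  intro i j hij
  rw [Function.onFun, Set.disjoint_left]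
  intro x hi hj
  exact hij (le_antisymm (blkG_le hi hj le_rfl) (blkG_le hj hi le_rfl))

lemma mem_iUnion_blkG {ν : Measure ℝ} [IsFiniteMeasure ν] {x : ℝ} (h : ν (Ioi x) ≠ 0) :
    ∃ j, x ∈ blkG ν j := by
  obtain ⟨k, h1, h2⟩ := exists_p2_block h (measure_ne_top ν _)
  refine ⟨-(k + 1), ?_⟩
  simp only [blkG, mem_ofPred_eq]
  push_cast
  refine ⟨by convert h1 using 2; ring, by convert h2 using 2; ring⟩

lemma measure_tail_le_real (ν : Measure ℝ) [NullSingletonClass ν] (l : ℝ≥0∞) : ν {x | ν (Ioi x) ≤ l} ≤ l :=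
  measure_le_of_tails countablyCoinitial_real ν fun s hs => by
    rwa [mem_ofPred_eq, ← measure_congr Ioi_ae_eq_Ici.symm] at *

lemma measure_blkG_le (ν : Measure ℝ) [NullSingletonClass ν] (j : ℤ) : ν (blkG ν j) ≤ p2 (-j) :=
  (measure_mono fun _ hx => hx.2).trans (measure_tail_le_real ν _)

lemma le_measure_tail (ν : Measure ℝ) [IsFiniteMeasure ν] {l : ℝ≥0∞} (hl : l ≤ ν univ) : l ≤ ν {x | ν (Ioi x) ≤ l} := by
  have h1 : ν {x | l < ν (Ioi x)} ≤ ν univ - l := by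
    refine measure_le_of_tails_left ν fun s hs => ?_
    have h2 : Iic s = (Ioi s)ᶜ := by simp
    rw [h2, measure_compl measurableSet_Ioi (measure_ne_top _ _)]
    exact tsub_le_tsub_left (le_of_lt hs) _
  have h3 : ν univ ≤ ν {x | ν (Ioi x) ≤ l} + (ν univ - l) := by
    calc ν univ = ν ({x | ν (Ioi x) ≤ l} ∪ {x | l < ν (Ioi x)}) := by
          congr 1; ext s; simp [le_or_gt]
      _ ≤ _ := (measure_union_le _ _).trans (by gcongr)
  have h4 : l + (ν univ - l) = ν univ := add_tsub_cancel_of_le hl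
  have h5 : ν univ - l ≠ ⊤ := ne_top_of_le_ne_top (measure_ne_top ν univ) tsub_le_self
  rw [← ENNReal.add_le_add_iff_right h5, h4]
  exact h3

lemma le_measure_blkG (ν : Measure ℝ) [NullSingletonClass ν] [IsFiniteMeasure ν] {j : ℤ} (h : (blkG ν j).Nonempty) : p2 (-(j + 2)) ≤ ν (blkG ν (j + 1)) := by
  obtain ⟨x, hx⟩ := h
  have h1 : p2 (-(j + 1)) ≤ ν univ := hx.1.le.trans (measure_mono (subset_univ _))
  have h2 := le_measure_tail ν h1
  have h3 := measure_tail_le_real ν (p2 (-(j + 2)))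
  have h4 : ν {x | ν (Ioi x) ≤ p2 (-(j + 1))} ≤
      ν (blkG ν (j + 1)) + ν {x | ν (Ioi x) ≤ p2 (-(j + 2))} := by
    refine le_trans (measure_mono ?_) (measure_union_le _ _)
    intro y hy
    by_cases h : ν (Ioi y) ≤ p2 (-(j + 2))
    · right; exact h
    · left
      refine ⟨?_, ?_⟩
      · push_cast; rw [not_le] at h; convert h using 2; ring
      · push_cast; exact hy
  have h5 : p2 (-((j : ℝ) + 2)) + p2 (-((j : ℝ) + 2)) = p2 (-((j : ℝ) + 1)) := by
    have : -((j : ℝ) + 1) = 1 + -((j : ℝ) + 2) := by ring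
    rw [this, p2_add, p2_one, two_mul]
  rw [← ENNReal.add_le_add_iff_right (p2_ne_top (-((j : ℝ) + 2))), h5]
  exact (h2.trans h4).trans (by gcongr)

lemma lintegral_le_blkG (ν : Measure ℝ) [NullSingletonClass ν] [IsFiniteMeasure ν] 
    {F : ℝ → ℝ≥0∞} {a : ℤ → ℝ≥0∞} (h : ∀ j, ∀ x ∈ blkG ν j, F x ≤ a j) :
    ∫⁻ x, F x ∂ν ≤ ∑' j : ℤ, p2 (-j) * a j := by
  have h0 : ν {x | ν (Ioi x) ≤ 0} = 0 := le_antisymm (measure_tail_le_real ν 0) zero_le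
  have hU : (univ : Set ℝ) ⊆ {x | ν (Ioi x) ≤ 0} ∪ ⋃ j, blkG ν j := by
    intro x _
    by_cases hx : ν (Ioi x) = 0
    · left; exact hx.le
    · right; simpa using mem_iUnion_blkG hx
  calc ∫⁻ x, F x ∂ν = ∫⁻ x in univ, F x ∂ν := by simp
    _ ≤ ∫⁻ x in {x | ν (Ioi x) ≤ 0} ∪ ⋃ j, blkG ν j, F x ∂ν := lintegral_mono_set hU
    _ ≤ ∫⁻ x in {x | ν (Ioi x) ≤ 0}, F x ∂ν + ∫⁻ x in ⋃ j, blkG ν j, F x ∂ν :=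
        lintegral_union_le _ _ _
    _ ≤ 0 + ∑' j : ℤ, ∫⁻ x in blkG ν j, F x ∂ν := by
        gcongr
        · rw [setLIntegral_measure_zero _ _ h0]
        · exact lintegral_iUnion_le _ _
    _ ≤ _ := by
        rw [zero_add]
        refine ENNReal.tsum_le_tsum fun j => ?_
        calc ∫⁻ x in blkG ν j, F x ∂ν ≤ ∫⁻ x in blkG ν j, a j ∂ν :=
              setLIntegral_mono' (measurableSet_blkG ν j) (h j)
          _ = a j * ν (blkG ν j) := setLIntegral_const _ _
          _ ≤ _ := by rw [mul_comm]; gcongr; exact measure_blkG_le ν j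

lemma blkG_le_lintegral (ν : Measure ℝ) [NullSingletonClass ν] [IsFiniteMeasure ν] 
    {F : ℝ → ℝ≥0∞} {a : ℤ → ℝ≥0∞}
    (h : ∀ j, ∀ x ∈ blkG ν (j + 1), a j ≤ F x) (h' : ∀ j, a j ≠ 0 → (blkG ν j).Nonempty) :
    ∑' j : ℤ, p2 (-j) * a j ≤ 4 * ∫⁻ x, F x ∂ν := by
  have hinj : Function.Injective fun j : ℤ => j + 1 := add_left_injective 1
  calc ∑' j : ℤ, p2 (-j) * a j ≤ ∑' j : ℤ, 4 * ∫⁻ x in blkG ν (j + 1), F x ∂ν := by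
        refine ENNReal.tsum_le_tsum fun j => ?_
        by_cases ha : a j = 0
        · simp [ha]
        · have h1 := le_measure_blkG ν (h' j ha)
          have h4 : p2 (-(j : ℝ)) = 4 * p2 (-((j : ℝ) + 2)) := by
            have : -(j : ℝ) = 1 + (1 + -((j : ℝ) + 2)) := by ring
            rw [this, p2_add, p2_add, p2_one, ← mul_assoc]; norm_num
          calc p2 (-j) * a j = 4 * (a j * p2 (-((j : ℝ) + 2))) := by rw [h4]; ring
            _ ≤ 4 * (a j * ν (blkG ν (j + 1))) := by gcongr
            _ = 4 * ∫⁻ x in blkG ν (j + 1), a j ∂ν := by rw [setLIntegral_const]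
            _ ≤ _ := by
              gcongr 4 * ?_
              exact setLIntegral_mono' (measurableSet_blkG ν _) (h j)
    _ = 4 * ∑' j : ℤ, ∫⁻ x in blkG ν (j + 1), F x ∂ν := ENNReal.tsum_mul_left
    _ = 4 * ∫⁻ x in ⋃ j : ℤ, blkG ν (j + 1), F x ∂ν := by
        rw [lintegral_iUnion (fun j => measurableSet_blkG ν _)]
        intro i j hij
        exact blkG_disjoint ν fun hh => hij (hinj hh)
    _ ≤ _ := mul_le_mul_right (setLIntegral_le_lintegral _ _) 4

lemma Iio_subset_blkG (ν : Measure ℝ) [IsFiniteMeasure ν] {j : ℤ} {x : ℝ} (hx : x ∈ blkG ν j) :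
    Iio x ⊆ ⋃ i : ℤ, {t | t ∈ blkG ν i ∧ i ≤ j} := by
  intro t ht
  have h1 : ν (Ioi t) ≠ 0 := by
    have := hx.1.trans_le (antitone_tail ν (le_of_lt ht))
    exact (lt_of_le_of_lt zero_le this).ne'
  obtain ⟨i, hi⟩ := mem_iUnion_blkG h1
  exact mem_iUnion.2 ⟨i, hi, blkG_le hi hx (le_of_lt ht)⟩

lemma measure_Iio_le_blkG (ν : Measure ℝ) [IsFiniteMeasure ν] 
    (φ : Measure ℝ) {j : ℤ} {x : ℝ} (hx : x ∈ blkG ν j) :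
    φ (Iio x) ≤ ∑' i : ℤ, if i ≤ j then φ (blkG ν i) else 0 := by
  refine (measure_mono (Iio_subset_blkG ν hx)).trans ((measure_iUnion_le _).trans ?_)
  refine ENNReal.tsum_le_tsum fun i => ?_
  split_ifs with h
  · exact measure_mono fun t ht => ht.1
  · simp [h]

lemma blkG_subset_Iio (ν : Measure ℝ) {j : ℤ} {x : ℝ} (hx : x ∈ blkG ν (j + 1)) : blkG ν j ⊆ Iio x :=
  fun _ ht => blkG_lt ht hx (by omega)

lemma disc_le {ρ : ℝ} (hρ : 0 < ρ) : ∃ c : ℝ≥0∞, c ≠ ⊤ ∧ ∀ (ν : Measure ℝ) [NullSingletonClass ν]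
    [IsFiniteMeasure ν] (φ : Measure ℝ),
    ∫⁻ x, φ (Iio x) ^ ρ ∂ν ≤ c * ∑' j : ℤ, p2 (-j) * φ (blkG ν j) ^ ρ := by
  obtain ⟨c, hc, h⟩ := sum_hardy' hρ
  refine ⟨c, hc, fun ν _ _ φ => ?_⟩
  refine le_trans (lintegral_le_blkG ν fun j x hx => ?_) (h fun j => φ (blkG ν j))
  gcongr
  exact measure_Iio_le_blkG ν φ hx

lemma disc_ge {ρ : ℝ} (hρ : 0 < ρ) (ν : Measure ℝ) [NullSingletonClass ν]
    [IsFiniteMeasure ν] (φ : Measure ℝ) :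
    ∑' j : ℤ, p2 (-j) * φ (blkG ν j) ^ ρ ≤ 4 * ∫⁻ x, φ (Iio x) ^ ρ ∂ν := by
  refine blkG_le_lintegral ν (fun j x hx => ?_) fun j hj => ?_
  · gcongr; exact blkG_subset_Iio ν hx
  · by_contra h
    rw [not_nonempty_iff_eq_empty] at h
    simp [h, hρ] at hj

/-- The relations between the exponents. -/
structure Exps (q r α β ρ γ : ℝ) : Prop where
  q0 : 0 < q
  q1 : q < 1
  r0 : 0 < r
  r1 : r < 1
  α0 : 0 < α
  β0 : 0 < β
  ρ0 : 0 < ρ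
  γ0 : 0 < γ
  hα : α * (1 - r) = r
  hβ : β * (1 - q) = q
  hρ : ρ * q = r
  hγ : γ * β = α

namespace Exps
variable {q r α β ρ γ : ℝ} (e : Exps q r α β ρ γ)
include e

lemma gamma_mul : γ * (1 - r) = ρ * (1 - q) := by
  have hq := e.q0
  have : (γ * (1 - r)) * q = (ρ * (1 - q)) * q := by
    have h := e.hα; rw [← e.hγ] at h
    calc (γ * (1 - r)) * q = (γ * (1 - r)) * (β * (1 - q)) := by rw [e.hβ]
      _ = (γ * β * (1 - r)) * (1 - q) := by ring
      _ = (ρ * q) * (1 - q) := by rw [h, e.hρ]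
      _ = _ := by ring
  exact mul_right_cancel₀ hq.ne' this

lemma one_add_alpha_mul : (1 + α) * (1 - r) = 1 := by have := e.hα; linarith
lemma one_add_beta_mul : (1 + β) * (1 - q) = 1 := by have := e.hβ; linarith

lemma rho_mul : ρ * (1 + α) = γ * (1 + β) := by
  have hr : 1 - r ≠ 0 := by have := e.r1; intro h; linarith
  have hq : 1 - q ≠ 0 := by have := e.q1; intro h; linarith
  apply mul_right_cancel₀ hr
  apply mul_right_cancel₀ hq
  calc ρ * (1 + α) * (1 - r) * (1 - q) = ρ * (1 - q) * ((1 + α) * (1 - r)) := by ring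
    _ = γ * (1 - r) * ((1 + β) * (1 - q)) := by rw [e.one_add_alpha_mul, e.one_add_beta_mul, e.gamma_mul]
    _ = _ := by ring

end Exps

/-- The step function taking the value `∑ h k` over the levels `2 ^ k` below `V t`. -/
def Hf (V : ℝ → ℝ≥0∞) (h : ℤ → ℝ≥0∞) (t : ℝ) : ℝ≥0∞ := ∑' k : ℤ, if p2 k < V t then h k else 0

/-- The iterated integral of a step function. -/
def Jf (μ ν : Measure ℝ) (V : ℝ → ℝ≥0∞) (q ρ : ℝ) (h : ℤ → ℝ≥0∞) : ℝ≥0∞ :=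
  ∫⁻ x, (∫⁻ t in Iio x, Hf V h t ^ q ∂μ) ^ ρ ∂ν

/-- The inner integral of `C₅`. -/
def Bf (μ : Measure ℝ) (V : ℝ → ℝ≥0∞) (β : ℝ) (x : ℝ) : ℝ≥0∞ :=
  ∫⁻ t in Iio x, μ (Ioo t x) ^ β * V t ^ β ∂μ

/-- The integral defining `C₅`. -/
def E5f (μ ν : Measure ℝ) (V : ℝ → ℝ≥0∞) (α β γ : ℝ) : ℝ≥0∞ :=
  ∫⁻ x, ν (Ioi x) ^ α * Bf μ V β x ^ γ ∂ν

/-- The inner integral of `C₃`. -/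
def Thf (μ ν : Measure ℝ) (ρ : ℝ) (x : ℝ) : ℝ≥0∞ := ∫⁻ s in Ioi x, μ (Ioo x s) ^ ρ ∂ν

/-- The integral defining `C₃`. -/
def E3f (μ ν : Measure ℝ) (V : ℝ → ℝ≥0∞) (α ρ : ℝ) : ℝ≥0∞ :=
  ∫⁻ x, Thf μ ν ρ x ^ α * essSup (fun t => μ (Ioo t x) ^ ρ * V t ^ α) (μ.restrict (Iio x)) ∂ν

lemma measurableSet_level {V : ℝ → ℝ≥0∞} (hV : Monotone V) (k : ℤ) :
    MeasurableSet {t | p2 k < V t} := measurableSet_lt measurable_const hV.measurable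

lemma measurable_Hf {V : ℝ → ℝ≥0∞} (hV : Monotone V) (h : ℤ → ℝ≥0∞) : Measurable (Hf V h) :=
  Measurable.tsum fun k => Measurable.ite (measurableSet_level hV k) measurable_const
    measurable_const

lemma holder_tsum {r : ℝ} (h0 : 0 < r) (h1 : r < 1) (f g : ℤ → ℝ≥0∞) :
    ∑' j, f j ^ (1 - r) * g j ^ r ≤ (∑' j, f j) ^ (1 - r) * (∑' j, g j) ^ r := by
  have := ENNReal.lintegral_mul_norm_pow_le (μ := Measure.count) (f := f) (g := g) (p := 1 - r)
    (q := r) Measurable.of_discrete.aemeasurable Measurable.of_discrete.aemeasurable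
    (by linarith) h0.le (by ring)
  simpa only [lintegral_count] using this

lemma tsum_shift (f : ℤ → ℝ≥0∞) : ∑' j, f (j + 1) = ∑' j, f j := (Equiv.addRight (1 : ℤ)).tsum_eq f

lemma exists_mem_le_essSup {μ : Measure ℝ} {A : Set ℝ} (F : ℝ → ℝ≥0∞) {x : ℝ} (hA : A ⊆ Iio x)
    (h0 : 0 < μ A) : ∃ t ∈ A, F t ≤ essSup F (μ.restrict (Iio x)) := by
  by_contra! hcon
  have h1 : ∀ᵐ t ∂(μ.restrict (Iio x)), F t ≤ essSup F (μ.restrict (Iio x)) :=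
    ENNReal.ae_le_essSup F
  rw [ae_iff] at h1
  have h2 : (μ.restrict (Iio x)) A ≤ 0 := by
    rw [← h1]; exact measure_mono fun t ht => not_le.2 (hcon t ht)
  rw [Measure.restrict_eq_self _ hA] at h2
  exact absurd h2 (not_le.2 h0)

/-- The contribution of one block to `Bf`. -/
def Bj (μ ν : Measure ℝ) (V : ℝ → ℝ≥0∞) (β : ℝ) (j : ℤ) : ℝ≥0∞ :=
  ∫⁻ s in blkG ν j, μ (blkG ν j ∩ Ici s) ^ β * V s ^ β ∂μ

lemma inter_Ici_le (μ ν : Measure ℝ) [NullSingletonClass μ] {j : ℤ} {x s : ℝ} (hx : x ∈ blkG ν (j + 1)) :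
    μ (blkG ν j ∩ Ici s) ≤ μ (Ioo s x) := by
  rw [measure_congr Ioo_ae_eq_Ico]
  exact measure_mono fun t ht => ⟨ht.2, blkG_subset_Iio ν hx ht.1⟩

lemma sum_Bj_le (μ ν : Measure ℝ) [NullSingletonClass μ] [NullSingletonClass ν]
    [IsFiniteMeasure ν] {V : ℝ → ℝ≥0∞} {q r α β ρ γ : ℝ} (e : Exps q r α β ρ γ) :
    ∑' j : ℤ, p2 (-(j * (1 + α))) * Bj μ ν V β j ^ γ ≤ 4 * p2 (2 * α) * E5f μ ν V α β γ := by
  have := blkG_le_lintegral ν (F := fun x => p2 (2 * α) * (ν (Ioi x) ^ α * Bf μ V β x ^ γ))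
    (a := fun j => p2 (-(j * α)) * Bj μ ν V β j ^ γ) ?_ ?_
  · rw [lintegral_const_mul' _ _ (p2_ne_top _), ← mul_assoc] at this
    refine le_trans (le_of_eq ?_) this
    congr 1; ext j
    rw [← mul_assoc, ← p2_add]; congr 2; ring
  · intro j x hx
    have h1 : p2 (-(j * α)) ≤ p2 (2 * α) * ν (Ioi x) ^ α := by
      have := hx.1.le
      push_cast at this
      calc p2 (-(j * α)) = p2 (2 * α) * p2 (-(j + 1 + 1)) ^ α := by
            rw [p2_rpow, ← p2_add]; congr 1; ring
        _ ≤ _ := by have := e.α0.le; gcongr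
    have h2 : Bj μ ν V β j ≤ Bf μ V β x := by
      refine (lintegral_mono_set (blkG_subset_Iio ν hx)).trans ?_
      refine lintegral_mono fun s => ?_
      exact mul_le_mul_left (ENNReal.rpow_le_rpow (inter_Ici_le μ ν hx) e.β0.le) _
    rw [← mul_assoc]
    have := e.γ0.le
    gcongr
  · intro j hj
    by_contra h
    rw [not_nonempty_iff_eq_empty] at h
    simp [Bj, h, e.γ0] at hj

lemma sum_level_tail {β : ℝ} (hβ : 0 < β) (μ : Measure ℝ) {V : ℝ → ℝ≥0∞} (hV : Monotone V)
    {A : Set ℝ} (hA : MeasurableSet A) :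
    ∑' k : ℤ, p2 (k * β) * μ (A ∩ {t | p2 k < V t}) ^ (1 + β)
      ≤ p2 (1 + β) * gs β * ∫⁻ s in A, μ (A ∩ Ici s) ^ β * V s ^ β ∂μ := by
  calc ∑' k : ℤ, p2 (k * β) * μ (A ∩ {t | p2 k < V t}) ^ (1 + β)
      ≤ ∑' k : ℤ, p2 (1 + β) * ∫⁻ s in A,
          (if p2 k < V s then p2 (k * β) else 0) * μ (A ∩ Ici s) ^ β ∂μ := by
        refine ENNReal.tsum_le_tsum fun k => ?_
        have h1 := tail_real μ (A ∩ {t | p2 k < V t}) hβ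
        calc _ ≤ p2 (k * β) * (p2 (1 + β) * ∫⁻ s in A ∩ {t | p2 k < V t},
                μ (A ∩ {t | p2 k < V t} ∩ Ici s) ^ β ∂μ) := by gcongr
          _ ≤ p2 (k * β) * (p2 (1 + β) * ∫⁻ s in A,
                (if p2 k < V s then 1 else 0) * μ (A ∩ Ici s) ^ β ∂μ) := by
              refine mul_le_mul_right (mul_le_mul_right ?_ _) _
              rw [← lintegral_indicator (hA.inter (measurableSet_level hV k)),
                ← lintegral_indicator hA]
              refine lintegral_mono fun s => ?_
              by_cases hs : s ∈ A
              · by_cases hs' : p2 k < V s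
                · have := hβ.le
                  simp only [indicator, mem_inter_iff, hs, mem_ofPred_eq, hs', and_self, if_true,
                    one_mul]
                  gcongr
                  exact inter_subset_left
                · simp [indicator, hs']
              · simp [indicator, hs]
          _ = _ := by
              rw [mul_left_comm, ← lintegral_const_mul' _ _ (p2_ne_top _)]
              congr 2; ext s
              rw [← mul_assoc]; congr 1
              split_ifs <;> simp
    _ = p2 (1 + β) * ∫⁻ s in A, (∑' k : ℤ, if p2 k < V s then p2 (k * β) else 0)
          * μ (A ∩ Ici s) ^ β ∂μ := by
        rw [ENNReal.tsum_mul_left, ← lintegral_tsum]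
        · simp_rw [ENNReal.tsum_mul_right]
        · intro k
          refine (Measurable.mul (Measurable.ite (measurableSet_level hV k) measurable_const
            measurable_const) (Measurable.pow_const (Antitone.measurable ?_) _)).aemeasurable
          intro s t hst
          exact measure_mono (inter_subset_inter_right _ (Ici_subset_Ici.2 hst))
    _ ≤ p2 (1 + β) * ∫⁻ s in A, gs β * (μ (A ∩ Ici s) ^ β * V s ^ β) ∂μ := by
        refine mul_le_mul_right ?_ _
        refine lintegral_mono fun s => ?_
        calc _ ≤ (gs β * V s ^ β) * μ (A ∩ Ici s) ^ β := by
              gcongr; exact tsum_level_le _ hβ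
          _ = _ := by ring
    _ = _ := by
        rw [lintegral_const_mul' _ _ (gs_ne_top hβ), ← mul_assoc]

lemma part_cut {q r α β ρ γ : ℝ} (e : Exps q r α β ρ γ) : ∃ c : ℝ≥0∞, c ≠ ⊤ ∧
    ∀ (μ ν : Measure ℝ) [NullSingletonClass μ] [NullSingletonClass ν] [IsFiniteMeasure ν]
      (V : ℝ → ℝ≥0∞), Monotone V → ∀ h : ℤ → ℝ≥0∞,
    ∑' j : ℤ, p2 (-j) * (∫⁻ t in blkG ν j,
        (∑' k : ℤ, if p2 k < V t then
          (open Classical in if blkG ν j ⊆ {t | p2 k < V t} then 0 else h k) else 0) ^ q ∂μ) ^ ρ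
      ≤ c * E5f μ ν V α β γ ^ (1 - r) * (∑' k : ℤ, h k * p2 (-k)) ^ r := by
  classical
  set c1 := p2 (1 + β) * gs β
  have hc1 : c1 ≠ ⊤ := ENNReal.mul_ne_top (p2_ne_top _) (gs_ne_top e.β0)
  have hr1 : 0 ≤ 1 - r := by have := e.r1; linarith
  have hq1 : 0 ≤ 1 - q := by have := e.q1; linarith
  refine ⟨(c1 ^ γ * (4 * p2 (2 * α))) ^ (1 - r), ?_, ?_⟩
  · have := e.γ0.le
    exact ENNReal.rpow_ne_top_of_nonneg hr1 (ENNReal.mul_ne_top (ENNReal.rpow_ne_top_of_nonneg this hc1)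
      (ENNReal.mul_ne_top (by simp) (p2_ne_top _)))
  intro μ ν _ _ _ V hV h
  set cut : ℤ → ℤ → Prop := fun j k =>
    (∃ t ∈ blkG ν j, p2 k < V t) ∧ ¬ blkG ν j ⊆ {t | p2 k < V t} with hcut
  set κ : ℤ → ℝ≥0∞ := fun j => ∑' k : ℤ, (if cut j k then h k else 0) * p2 (-k) with hκ
  have hT : ∀ j : ℤ, ∑' k : ℤ, p2 (k * β) * (μ.restrict (blkG ν j)) {t | p2 k < V t} ^ (1 + β)
      ≤ c1 * Bj μ ν V β j := by
    intro j
    have := sum_level_tail e.β0 μ hV (measurableSet_blkG ν j)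
    simp only [Measure.restrict_apply (measurableSet_level hV _), inter_comm _ (blkG ν j)]
    exact this
  have hblock : ∀ j : ℤ, ∫⁻ t in blkG ν j,
        (∑' k : ℤ, if p2 k < V t then (if blkG ν j ⊆ {t | p2 k < V t} then 0 else h k) else 0) ^ q ∂μ
      ≤ (c1 * Bj μ ν V β j) ^ (1 - q) * κ j ^ q := by
    intro j
    calc _ ≤ ∫⁻ t in blkG ν j, (∑' k : ℤ, if t ∈ {t | p2 k < V t} then
            (if cut j k then h k else 0) else 0) ^ q ∂μ := by
          refine setLIntegral_mono' (measurableSet_blkG ν j) fun t ht => ?_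
          have := e.q0.le
          gcongr with k
          simp only [mem_ofPred_eq]
          by_cases h1 : p2 k < V t
          · by_cases h2 : blkG ν j ⊆ {t | p2 k < V t}
            · simp [h1, h2]
            · have : cut j k := ⟨⟨t, ht, h1⟩, h2⟩
              simp [h1, h2, this]
          · simp [h1]
      _ ≤ _ := holder_levels _ _ (measurableSet_level hV) _ e.q0 e.q1 e.β0 e.hβ
      _ ≤ _ := by gcongr; exact hT j
  have hκsum : ∑' j, κ j ≤ ∑' k : ℤ, h k * p2 (-k) := by
    rw [ENNReal.tsum_comm]
    refine ENNReal.tsum_le_tsum fun k => ?_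
    by_cases hk : ∃ i, cut i k
    · obtain ⟨i, hi⟩ := hk
      rw [tsum_eq_single i]
      · simp [hi]
      · intro j hj
        have : ¬ cut j k := by
          intro hjk
          rcases lt_or_gt_of_ne hj with hlt | hlt
          · obtain ⟨t, ht, htk⟩ := hjk.1
            exact hi.2 fun y hy => htk.trans_le (hV (blkG_lt ht hy hlt).le)
          · obtain ⟨t, ht, htk⟩ := hi.1
            exact hjk.2 fun y hy => htk.trans_le (hV (blkG_lt ht hy hlt).le)
        simp [this]
    · push Not at hk
      simp [hk]
  calc _ ≤ ∑' j : ℤ, p2 (-j) * ((c1 * Bj μ ν V β j) ^ (1 - q) * κ j ^ q) ^ ρ := by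
        have := e.ρ0.le
        gcongr with j; exact hblock j
    _ = ∑' j : ℤ, (p2 (-(j * (1 + α))) * (c1 * Bj μ ν V β j) ^ γ) ^ (1 - r) * κ j ^ r := by
        congr 1; ext j
        rw [ENNReal.mul_rpow_of_nonneg _ _ e.ρ0.le, ENNReal.mul_rpow_of_nonneg _ _ hr1, p2_rpow,
          ← ENNReal.rpow_mul, ← ENNReal.rpow_mul, ← ENNReal.rpow_mul, e.gamma_mul, mul_comm q, e.hρ,
          mul_comm ρ (1 - q), ← mul_assoc]
        congr 3
        have := e.one_add_alpha_mul
        linear_combination (j : ℝ) * this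
    _ ≤ (∑' j : ℤ, p2 (-(j * (1 + α))) * (c1 * Bj μ ν V β j) ^ γ) ^ (1 - r) * (∑' j, κ j) ^ r :=
        holder_tsum e.r0 e.r1 _ _
    _ ≤ (c1 ^ γ * (4 * p2 (2 * α) * E5f μ ν V α β γ)) ^ (1 - r) * (∑' k : ℤ, h k * p2 (-k)) ^ r := by
        have := e.r0.le
        gcongr
        refine le_trans (le_of_eq ?_) (mul_le_mul_right (sum_Bj_le μ ν e (V := V)) (c1 ^ γ))
        rw [← ENNReal.tsum_mul_left]
        congr 1; ext j
        rw [ENNReal.mul_rpow_of_nonneg _ _ e.γ0.le]; ring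
    _ = _ := by
        rw [← ENNReal.mul_rpow_of_nonneg _ _ hr1]; congr 2; ring

/-- The discrete mass of a block. -/
def mj (μ ν : Measure ℝ) (ρ : ℝ) (j : ℤ) : ℝ≥0∞ := p2 (-j) * μ (blkG ν j) ^ ρ

/-- Tails of the discrete masses. -/
def Mj (μ ν : Measure ℝ) (ρ : ℝ) (j : ℤ) : ℝ≥0∞ := ∑' l : ℤ, if j ≤ l then mj μ ν ρ l else 0

open Classical in
/-- The dyadic size of `V ^ α` on a block. -/
def vj (ν : Measure ℝ) (V : ℝ → ℝ≥0∞) (α : ℝ) (j : ℤ) : ℝ≥0∞ :=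
  ∑' k : ℤ, if blkG ν j ⊆ {t | p2 k < V t} then p2 (k * α) else 0

lemma vj_le {ν : Measure ℝ} {V : ℝ → ℝ≥0∞} {α : ℝ} (hα : 0 < α) {j : ℤ} {t : ℝ}
    (ht : t ∈ blkG ν j) : vj ν V α j ≤ gs α * V t ^ α := by
  classical
  refine le_trans ?_ (tsum_level_le (V t) hα)
  refine ENNReal.tsum_le_tsum fun k => ?_
  by_cases h : blkG ν j ⊆ {t | p2 k < V t}
  · have : p2 k < V t := h ht
    simp [h, this]
  · simp [h]

lemma vj_mono {ν : Measure ℝ} {V : ℝ → ℝ≥0∞} (hV : Monotone V) (α : ℝ) {j : ℤ}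
    (hne : (blkG ν j).Nonempty) : vj ν V α j ≤ vj ν V α (j + 1) := by
  classical
  obtain ⟨t, ht⟩ := hne
  refine ENNReal.tsum_le_tsum fun k => ?_
  by_cases h : blkG ν j ⊆ {t | p2 k < V t}
  · have h2 : blkG ν (j + 1) ⊆ {t | p2 k < V t} :=
      fun y hy => (h ht).trans_le (hV (blkG_lt ht hy (by omega)).le)
    simp [h, h2]
  · simp [h]

lemma Thf_eq (μ ν : Measure ℝ) {ρ : ℝ} (hρ : 0 < ρ) (x : ℝ) :
    ∫⁻ s, (μ.restrict (Ioi x)) (Iio s) ^ ρ ∂ν = Thf μ ν ρ x := by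
  unfold Thf
  rw [← lintegral_indicator measurableSet_Ioi]
  congr 1; ext s
  rw [Measure.restrict_apply measurableSet_Iio, inter_comm, Ioi_inter_Iio]
  by_cases h : s ∈ Ioi x
  · simp [h]
  · have : Ioo x s = ∅ := Ioo_eq_empty (by simpa using h)
    simp [h, this, hρ]

lemma Mj_le_Thf (μ ν : Measure ℝ) [NullSingletonClass ν] [IsFiniteMeasure ν] {ρ : ℝ} (hρ : 0 < ρ)
    {j : ℤ} {x : ℝ} (hx : x ∈ blkG ν j) : Mj μ ν ρ (j + 1) ≤ 4 * Thf μ ν ρ x := by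
  rw [← Thf_eq μ ν hρ]
  refine le_trans ?_ (disc_ge hρ ν _)
  refine ENNReal.tsum_le_tsum fun l => ?_
  split_ifs with h
  · unfold mj
    rw [Measure.restrict_apply (measurableSet_blkG ν l), inter_eq_left.2]
    exact fun y hy => blkG_lt hx hy (by omega)
  · simp

lemma Mj_split (μ ν : Measure ℝ) (ρ : ℝ) (j : ℤ) :
    Mj μ ν ρ j ≤ mj μ ν ρ j + Mj μ ν ρ (j + 1) := by
  have h1 : mj μ ν ρ j = ∑' l : ℤ, if l = j then mj μ ν ρ l else 0 := by simp
  rw [h1]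
  unfold Mj
  rw [← ENNReal.tsum_add]
  refine ENNReal.tsum_le_tsum fun l => ?_
  by_cases hl : l = j
  · simp [hl]
  · by_cases h : j ≤ l
    · have : j + 1 ≤ l := by omega
      simp [this, h]
    · simp [h]

lemma mj_vj_le {q r α β ρ γ : ℝ} (e : Exps q r α β ρ γ) (μ ν : Measure ℝ)
    {V : ℝ → ℝ≥0∞} (j : ℤ) :
    mj μ ν ρ j ^ (1 + α) * vj ν V α j ≤
      p2 (1 + β) ^ γ * gs α * (p2 (-(j * (1 + α))) * Bj μ ν V β j ^ γ) := by
  set z := (vj ν V α j) ^ (1 / γ)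
  have hγ := e.γ0
  have hα := e.α0
  have hβ := e.β0
  have h1 : μ (blkG ν j) ^ (1 + β) * z ≤ p2 (1 + β) * (gs α ^ (1 / γ) * Bj μ ν V β j) := by
    calc μ (blkG ν j) ^ (1 + β) * z
        ≤ (p2 (1 + β) * ∫⁻ s in blkG ν j, μ (blkG ν j ∩ Ici s) ^ β ∂μ) * z := by
          gcongr; exact tail_real μ _ hβ
      _ ≤ p2 (1 + β) * ∫⁻ s in blkG ν j, μ (blkG ν j ∩ Ici s) ^ β * z ∂μ := by
          rw [mul_assoc]
          exact mul_le_mul_right (lintegral_mul_const_le _ _) _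
      _ ≤ p2 (1 + β) * ∫⁻ s in blkG ν j,
            gs α ^ (1 / γ) * (μ (blkG ν j ∩ Ici s) ^ β * V s ^ β) ∂μ := by
          refine mul_le_mul_right ?_ _
          refine setLIntegral_mono' (measurableSet_blkG ν j) fun s hs => ?_
          calc μ (blkG ν j ∩ Ici s) ^ β * z
              ≤ μ (blkG ν j ∩ Ici s) ^ β * (gs α * V s ^ α) ^ (1 / γ) := by
                exact mul_le_mul_right (ENNReal.rpow_le_rpow (vj_le hα hs) (by positivity)) _
            _ = _ := by
                rw [ENNReal.mul_rpow_of_nonneg _ _ (by positivity), ← ENNReal.rpow_mul, ← e.hγ]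
                have : γ * β * (1 / γ) = β := by field_simp
                rw [this]; ring
      _ = _ := by
          rw [lintegral_const_mul' _ _ (ENNReal.rpow_ne_top_of_nonneg (by positivity)
            (gs_ne_top hα))]; rfl
  calc mj μ ν ρ j ^ (1 + α) * vj ν V α j
      = p2 (-(j * (1 + α))) * (μ (blkG ν j) ^ (1 + β) * z) ^ γ := by
        unfold mj
        rw [ENNReal.mul_rpow_of_nonneg _ _ (by positivity), p2_rpow,
          ENNReal.mul_rpow_of_nonneg _ _ hγ.le, ← ENNReal.rpow_mul, ← ENNReal.rpow_mul, e.rho_mul,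
          rpow_cancel _ (by field_simp), mul_assoc, mul_comm γ]
        congr 2; ring
    _ ≤ p2 (-(j * (1 + α))) * (p2 (1 + β) * (gs α ^ (1 / γ) * Bj μ ν V β j)) ^ γ := by gcongr
    _ = _ := by
        rw [ENNReal.mul_rpow_of_nonneg _ _ hγ.le, ENNReal.mul_rpow_of_nonneg _ _ hγ.le,
          rpow_cancel _ (by field_simp)]
        ring

lemma mul_rpow_le_add {α : ℝ} (hα : 0 < α) (x y : ℝ≥0∞) :
    x * y ^ α ≤ x ^ (1 + α) + y ^ (1 + α) := by
  rcases le_total x y with h | h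
  · calc x * y ^ α ≤ y * y ^ α := by gcongr
      _ = y ^ (1 + α) := (rpow_one_add y hα.le).symm
      _ ≤ _ := le_add_self
  · calc x * y ^ α ≤ x * x ^ α := by gcongr
      _ = x ^ (1 + α) := (rpow_one_add x hα.le).symm
      _ ≤ _ := le_self_add

lemma mj_ne_zero {μ ν : Measure ℝ} {ρ : ℝ} (hρ : 0 < ρ) {j : ℤ} (h : mj μ ν ρ j ≠ 0) :
    (blkG ν j).Nonempty := by
  by_contra h'
  rw [not_nonempty_iff_eq_empty] at h'
  simp [mj, h', hρ] at h

lemma sum_far_le {q r α β ρ γ : ℝ} (e : Exps q r α β ρ γ) (μ ν : Measure ℝ)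
    [NullSingletonClass μ] [NullSingletonClass ν] [IsFiniteMeasure μ] [IsFiniteMeasure ν]
    {V : ℝ → ℝ≥0∞} :
    ∑' j : ℤ, mj μ ν ρ j * Mj μ ν ρ (j + 2) ^ α * vj ν V α j ≤
      4 * (4 ^ α * (p2 ρ * gs α)) * E3f μ ν V α ρ := by
  have hρ := e.ρ0
  have hα := e.α0
  have hc : 4 ^ α * (p2 ρ * gs α) ≠ ⊤ := ENNReal.mul_ne_top
    (ENNReal.rpow_ne_top_of_nonneg hα.le (by simp))
    (ENNReal.mul_ne_top (p2_ne_top _) (gs_ne_top hα))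
  have := blkG_le_lintegral ν (F := fun x => (4 ^ α * (p2 ρ * gs α)) * (Thf μ ν ρ x ^ α *
      essSup (fun t => μ (Ioo t x) ^ ρ * V t ^ α) (μ.restrict (Iio x))))
    (a := fun j => Mj μ ν ρ (j + 2) ^ α * (μ (blkG ν j) ^ ρ * vj ν V α j)) ?_ ?_
  · rw [lintegral_const_mul' _ _ hc, ← mul_assoc] at this
    refine le_trans (le_of_eq ?_) this
    congr 1; ext j
    unfold mj; ring
  · intro j x hx
    have h1 : Mj μ ν ρ (j + 2) ^ α ≤ 4 ^ α * Thf μ ν ρ x ^ α := by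
      rw [← ENNReal.mul_rpow_of_nonneg _ _ hα.le]
      gcongr
      have := Mj_le_Thf μ ν hρ hx
      rwa [add_assoc] at this
    have h2 : μ (blkG ν j) ^ ρ * vj ν V α j ≤ (p2 ρ * gs α) *
        essSup (fun t => μ (Ioo t x) ^ ρ * V t ^ α) (μ.restrict (Iio x)) := by
      by_cases h0 : μ (blkG ν j) = 0
      · simp [h0, hρ]
      obtain ⟨A, hA, hpos, hhalf⟩ := exists_half_tail countablyCoinitial_real μ
        (measurableSet_blkG ν j) (fun _ => measurableSet_Ici) h0 (measure_ne_top _ _)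
      obtain ⟨t, htA, ht⟩ := exists_mem_le_essSup (fun t => μ (Ioo t x) ^ ρ * V t ^ α)
        (hA.trans (blkG_subset_Iio ν hx)) hpos
      calc μ (blkG ν j) ^ ρ * vj ν V α j
          ≤ (2 * μ (Ioo t x)) ^ ρ * (gs α * V t ^ α) := by
            gcongr
            · exact (hhalf t htA).trans (mul_le_mul_right (inter_Ici_le μ ν hx) _)
            · exact vj_le hα (hA htA)
        _ = p2 ρ * gs α * (μ (Ioo t x) ^ ρ * V t ^ α) := by
            rw [ENNReal.mul_rpow_of_nonneg _ _ hρ.le]; unfold p2; ring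
        _ ≤ _ := by gcongr
    calc _ ≤ (4 ^ α * Thf μ ν ρ x ^ α) * ((p2 ρ * gs α) *
          essSup (fun t => μ (Ioo t x) ^ ρ * V t ^ α) (μ.restrict (Iio x))) := mul_le_mul' h1 h2
      _ = _ := by ring
  · intro j hj
    refine mj_ne_zero (μ := μ) hρ fun h => hj ?_
    unfold mj at h
    rw [(mul_eq_zero.1 h).resolve_left (p2_ne_zero _)]; simp

lemma sum_near_le {q r α β ρ γ : ℝ} (e : Exps q r α β ρ γ) (μ ν : Measure ℝ)
    [NullSingletonClass μ] [NullSingletonClass ν] [IsFiniteMeasure ν] {V : ℝ → ℝ≥0∞} :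
    ∑' j : ℤ, mj μ ν ρ j ^ (1 + α) * vj ν V α j ≤
      p2 (1 + β) ^ γ * gs α * (4 * p2 (2 * α)) * E5f μ ν V α β γ := by
  calc _ ≤ ∑' j : ℤ, p2 (1 + β) ^ γ * gs α * (p2 (-(j * (1 + α))) * Bj μ ν V β j ^ γ) :=
        ENNReal.tsum_le_tsum (mj_vj_le e μ ν)
    _ ≤ p2 (1 + β) ^ γ * gs α * (4 * p2 (2 * α) * E5f μ ν V α β γ) := by
        rw [ENNReal.tsum_mul_left]; gcongr; exact sum_Bj_le μ ν e
    _ = _ := by ring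

lemma part_full {q r α β ρ γ : ℝ} (e : Exps q r α β ρ γ) : ∃ c : ℝ≥0∞, c ≠ ⊤ ∧
    ∀ (μ ν : Measure ℝ) [NullSingletonClass μ] [NullSingletonClass ν] [IsFiniteMeasure μ]
      [IsFiniteMeasure ν] (V : ℝ → ℝ≥0∞), Monotone V → ∀ h : ℤ → ℝ≥0∞,
    ∑' j : ℤ, mj μ ν ρ j *
        (∑' k : ℤ, open Classical in if blkG ν j ⊆ {t | p2 k < V t} then h k else 0) ^ r
      ≤ c * (E3f μ ν V α ρ + E5f μ ν V α β γ) ^ (1 - r) * (∑' k : ℤ, h k * p2 (-k)) ^ r := by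
  classical
  have hα := e.α0
  have hr1 : 0 ≤ 1 - r := by have := e.r1; linarith
  set c3 : ℝ≥0∞ := 4 * (4 ^ α * (p2 ρ * gs α))
  set c5 : ℝ≥0∞ := p2 (1 + β) ^ γ * gs α * (4 * p2 (2 * α))
  have hc3 : c3 ≠ ⊤ := ENNReal.mul_ne_top (by simp) (ENNReal.mul_ne_top
    (ENNReal.rpow_ne_top_of_nonneg hα.le (by simp))
    (ENNReal.mul_ne_top (p2_ne_top _) (gs_ne_top hα)))
  have hc5 : c5 ≠ ⊤ := ENNReal.mul_ne_top (ENNReal.mul_ne_top (ENNReal.rpow_ne_top_of_nonneg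
    e.γ0.le (p2_ne_top _)) (gs_ne_top hα)) (ENNReal.mul_ne_top (by simp) (p2_ne_top _))
  set K := p2 (1 + α) * (p2 α * (c5 + p2 α * (2 * c5 + c3)))
  have hK : K ≠ ⊤ := by
    refine ENNReal.mul_ne_top (p2_ne_top _) (ENNReal.mul_ne_top (p2_ne_top _) ?_)
    exact ENNReal.add_ne_top.2 ⟨hc5, ENNReal.mul_ne_top (p2_ne_top _)
      (ENNReal.add_ne_top.2 ⟨ENNReal.mul_ne_top (by simp) hc5, hc3⟩)⟩
  refine ⟨K ^ (1 - r), ENNReal.rpow_ne_top_of_nonneg hr1 hK, ?_⟩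
  intro μ ν _ _ _ _ V hV h
  set m := mj μ ν ρ with hm
  set M := Mj μ ν ρ with hM
  set v := vj ν V α with hv
  have hE : ∀ k : ℤ, (disc m) {j | blkG ν j ⊆ {t | p2 k < V t}} ^ (1 + α) ≤ p2 (1 + α) *
      ∑' j, (if blkG ν j ⊆ {t | p2 k < V t} then 1 else 0) * (m j * M j ^ α) := by
    intro k
    rw [disc_apply]
    refine (tail_disc m (fun j => blkG ν j ⊆ {t | p2 k < V t}) hα).trans ?_
    gcongr with j
    split_ifs with hj
    · rw [one_mul]
      refine mul_le_mul_right (ENNReal.rpow_le_rpow (ENNReal.tsum_le_tsum fun l => ?_) hα.le) _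
      by_cases hl : j ≤ l
      · simp only [hl, true_and, if_true]; split_ifs <;> first | exact le_rfl | exact zero_le
      · simp [hl]
    · simp
  have hN := sum_near_le e μ ν (V := V)
  have hF := sum_far_le e μ ν (V := V)
  have hmain : ∑' j, m j * M j ^ α * v j ≤
      p2 α * (c5 + p2 α * (2 * c5 + c3)) * (E3f μ ν V α ρ + E5f μ ν V α β γ) := by
    have hpt : ∀ j, m j * M j ^ α * v j ≤ p2 α * (m j ^ (1 + α) * v j + p2 α *
        ((m j ^ (1 + α) * v j + m (j + 1) ^ (1 + α) * v (j + 1)) + m j * M (j + 2) ^ α * v j)) := by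
      intro j
      by_cases hmj : m j = 0
      · simp [hmj]
      have hne := mj_ne_zero e.ρ0 hmj
      have h1 : M j ^ α ≤ p2 α * (m j ^ α + p2 α * (m (j + 1) ^ α + M (j + 2) ^ α)) := by
        calc M j ^ α ≤ (m j + (m (j + 1) + M (j + 2))) ^ α := by
              gcongr
              refine (Mj_split μ ν ρ j).trans ?_
              gcongr
              have := Mj_split μ ν ρ (j + 1)
              rwa [add_assoc] at this
          _ ≤ p2 α * (m j ^ α + (m (j + 1) + M (j + 2)) ^ α) := add_rpow_le' _ _ hα.le
          _ ≤ _ := by gcongr; exact add_rpow_le' _ _ hα.le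
      calc m j * M j ^ α * v j
          ≤ m j * (p2 α * (m j ^ α + p2 α * (m (j + 1) ^ α + M (j + 2) ^ α))) * v j := by gcongr
        _ = p2 α * (m j * m j ^ α * v j + p2 α *
            (m j * m (j + 1) ^ α * v j + m j * M (j + 2) ^ α * v j)) := by ring
        _ ≤ _ := by
            rw [← rpow_one_add _ hα.le]
            gcongr
            calc m j * m (j + 1) ^ α * v j ≤ (m j ^ (1 + α) + m (j + 1) ^ (1 + α)) * v j := by
                  gcongr; exact mul_rpow_le_add hα _ _
              _ ≤ _ := by rw [add_mul]; gcongr; exact vj_mono hV α hne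
    calc ∑' j, m j * M j ^ α * v j ≤ _ := ENNReal.tsum_le_tsum hpt
      _ = p2 α * (∑' j, m j ^ (1 + α) * v j + p2 α *
          ((∑' j, m j ^ (1 + α) * v j + ∑' j, m j ^ (1 + α) * v j)
            + ∑' j, m j * M (j + 2) ^ α * v j)) := by
          rw [ENNReal.tsum_mul_left, ENNReal.tsum_add, ENNReal.tsum_mul_left, ENNReal.tsum_add,
            ENNReal.tsum_add, tsum_shift fun j => m j ^ (1 + α) * v j]
      _ ≤ p2 α * (c5 * E5f μ ν V α β γ + p2 α * ((c5 * E5f μ ν V α β γ + c5 * E5f μ ν V α β γ)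
            + c3 * E3f μ ν V α ρ)) := by gcongr
      _ ≤ p2 α * (c5 * (E3f μ ν V α ρ + E5f μ ν V α β γ) + p2 α *
            ((c5 * (E3f μ ν V α ρ + E5f μ ν V α β γ) + c5 * (E3f μ ν V α ρ + E5f μ ν V α β γ))
            + c3 * (E3f μ ν V α ρ + E5f μ ν V α β γ))) := by
          gcongr <;> first | exact le_add_self | exact le_self_add
      _ = _ := by ring
  calc _ = ∫⁻ j, (∑' k : ℤ, if j ∈ {j | blkG ν j ⊆ {t | p2 k < V t}} then h k else 0) ^ r
          ∂(disc m) := by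
        rw [lintegral_disc]; rfl
    _ ≤ (∑' k : ℤ, p2 (k * α) * (disc m) {j | blkG ν j ⊆ {t | p2 k < V t}} ^ (1 + α)) ^ (1 - r) *
          (∑' k : ℤ, h k * p2 (-k)) ^ r :=
        holder_levels _ _ (fun _ => MeasurableSet.of_discrete) _ e.r0 e.r1 e.α0 e.hα
    _ ≤ (K * (E3f μ ν V α ρ + E5f μ ν V α β γ)) ^ (1 - r) * (∑' k : ℤ, h k * p2 (-k)) ^ r := by
        refine mul_le_mul_left (ENNReal.rpow_le_rpow ?_ hr1) _
        calc _ ≤ ∑' k : ℤ, p2 (k * α) * (p2 (1 + α) *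
              ∑' j, (if blkG ν j ⊆ {t | p2 k < V t} then 1 else 0) * (m j * M j ^ α)) := by
              gcongr with k; exact hE k
          _ = p2 (1 + α) * ∑' j, ∑' k : ℤ, (m j * M j ^ α) *
                (if blkG ν j ⊆ {t | p2 k < V t} then p2 (k * α) else 0) := by
              rw [ENNReal.tsum_comm, ← ENNReal.tsum_mul_left]
              congr 1; ext k
              rw [mul_left_comm, ← ENNReal.tsum_mul_left]
              congr 2; ext j
              split_ifs <;> ring
          _ = p2 (1 + α) * ∑' j, m j * M j ^ α * v j := by
              simp_rw [ENNReal.tsum_mul_left]; rfl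
          _ ≤ p2 (1 + α) * (p2 α * (c5 + p2 α * (2 * c5 + c3)) *
                (E3f μ ν V α ρ + E5f μ ν V α β γ)) := by gcongr
          _ = _ := by ring
    _ = _ := by rw [ENNReal.mul_rpow_of_nonneg _ _ hr1]

/-- Upper estimate for finite measures. -/
lemma core_upper {q r α β ρ γ : ℝ} (e : Exps q r α β ρ γ) : ∃ c : ℝ≥0∞, c ≠ ⊤ ∧
    ∀ (μ ν : Measure ℝ) [NullSingletonClass μ] [NullSingletonClass ν] [IsFiniteMeasure μ]
      [IsFiniteMeasure ν] (V : ℝ → ℝ≥0∞), Monotone V → ∀ h : ℤ → ℝ≥0∞,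
    Jf μ ν V q ρ h ≤
      c * (E3f μ ν V α ρ + E5f μ ν V α β γ) ^ (1 - r) * (∑' k : ℤ, h k * p2 (-k)) ^ r := by
  classical
  obtain ⟨c0, hc0, H0⟩ := disc_le e.ρ0
  obtain ⟨c1, hc1, H1⟩ := part_cut e
  obtain ⟨c2, hc2, H2⟩ := part_full e
  have hρ := e.ρ0
  have hq := e.q0
  have hr1 : 0 ≤ 1 - r := by have := e.r1; linarith
  refine ⟨c0 * (p2 ρ * (c2 + c1)), ENNReal.mul_ne_top hc0 (ENNReal.mul_ne_top (p2_ne_top _)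
    (ENNReal.add_ne_top.2 ⟨hc2, hc1⟩)), ?_⟩
  intro μ ν _ _ _ _ V hV h
  set A : ℤ → ℝ≥0∞ := fun j => ∑' k : ℤ, if blkG ν j ⊆ {t | p2 k < V t} then h k else 0 with hA
  set R : ℤ → ℝ → ℝ≥0∞ := fun j t => ∑' k : ℤ, if p2 k < V t then
      (if blkG ν j ⊆ {t | p2 k < V t} then 0 else h k) else 0 with hR
  have hsplit : ∀ j, ∀ t ∈ blkG ν j, Hf V h t ≤ A j + R j t := by
    intro j t ht
    rw [hA, hR]; dsimp only
    rw [← ENNReal.tsum_add]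
    refine ENNReal.tsum_le_tsum fun k => ?_
    by_cases h1 : p2 k < V t
    · by_cases h2 : blkG ν j ⊆ {t | p2 k < V t}
      · simp [h1, h2]
      · simp [h1, h2]
    · simp [h1]
  have hbl : ∀ j, ∫⁻ t in blkG ν j, Hf V h t ^ q ∂μ ≤
      A j ^ q * μ (blkG ν j) + ∫⁻ t in blkG ν j, R j t ^ q ∂μ := by
    intro j
    calc _ ≤ ∫⁻ t in blkG ν j, (A j ^ q + R j t ^ q) ∂μ := by
          refine setLIntegral_mono' (measurableSet_blkG ν j) fun t ht => ?_
          refine (ENNReal.rpow_le_rpow (hsplit j t ht) hq.le).trans ?_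
          exact ENNReal.rpow_add_le_add_rpow _ _ hq.le e.q1.le
      _ = _ := by rw [lintegral_add_left measurable_const, setLIntegral_const]
  have hJ : Jf μ ν V q ρ h ≤ c0 * ∑' j : ℤ, p2 (-j) *
      (∫⁻ t in blkG ν j, Hf V h t ^ q ∂μ) ^ ρ := by
    have := H0 ν (μ.withDensity fun t => Hf V h t ^ q)
    simpa only [Jf, withDensity_apply _ measurableSet_Iio,
      withDensity_apply _ (measurableSet_blkG ν _)] using this
  calc Jf μ ν V q ρ h ≤ _ := hJ
    _ ≤ c0 * ∑' j : ℤ, p2 ρ * (mj μ ν ρ j * A j ^ r +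
          p2 (-j) * (∫⁻ t in blkG ν j, R j t ^ q ∂μ) ^ ρ) := by
        refine mul_le_mul_right (ENNReal.tsum_le_tsum fun j => ?_) _
        calc p2 (-j) * (∫⁻ t in blkG ν j, Hf V h t ^ q ∂μ) ^ ρ
            ≤ p2 (-j) * (p2 ρ * ((A j ^ q * μ (blkG ν j)) ^ ρ +
                (∫⁻ t in blkG ν j, R j t ^ q ∂μ) ^ ρ)) := by
              refine mul_le_mul_right ?_ _
              exact (ENNReal.rpow_le_rpow (hbl j) hρ.le).trans (add_rpow_le' _ _ hρ.le)
          _ = _ := by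
              rw [ENNReal.mul_rpow_of_nonneg _ _ hρ.le, ← ENNReal.rpow_mul, mul_comm q, e.hρ]
              unfold mj; ring
    _ = c0 * (p2 ρ * (∑' j : ℤ, mj μ ν ρ j * A j ^ r +
          ∑' j : ℤ, p2 (-j) * (∫⁻ t in blkG ν j, R j t ^ q ∂μ) ^ ρ)) := by
        rw [ENNReal.tsum_mul_left, ENNReal.tsum_add]
    _ ≤ c0 * (p2 ρ * (c2 * (E3f μ ν V α ρ + E5f μ ν V α β γ) ^ (1 - r) *
          (∑' k : ℤ, h k * p2 (-k)) ^ r + c1 * (E3f μ ν V α ρ + E5f μ ν V α β γ) ^ (1 - r) *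
          (∑' k : ℤ, h k * p2 (-k)) ^ r)) := by
        gcongr
        · exact H2 μ ν V hV h
        · refine (H1 μ ν V hV h).trans ?_
          gcongr
          exact le_add_self
    _ = _ := by ring

lemma absorb {X K : ℝ≥0∞} {r : ℝ} (h1 : r < 1) (hX : X ≠ ⊤) (h : X ≤ K * X ^ r) :
    X ^ (1 - r) ≤ K := by
  by_cases h0 : X = 0
  · subst h0; rw [ENNReal.zero_rpow_of_pos (by linarith)]; exact zero_le
  · have h3 : X ^ r ≠ 0 := by simp [ENNReal.rpow_eq_zero_iff, h0, hX]
    have h4 : X ^ r ≠ ⊤ := by simp [ENNReal.rpow_eq_top_iff, h0, hX]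
    have h5 : X ^ (1 - r) * X ^ r = X := by
      rw [← ENNReal.rpow_add _ _ h0 hX]; simp
    rw [← h5] at h
    nth_rewrite 2 [h5] at h
    exact (ENNReal.mul_le_mul_iff_left h3 h4).1 h

lemma Bf_mono (μ : Measure ℝ) (V : ℝ → ℝ≥0∞) {β : ℝ} (hβ : 0 ≤ β) : Monotone (Bf μ V β) := by
  intro x y h
  refine (lintegral_mono_set (Iio_subset_Iio h)).trans (lintegral_mono fun t => ?_)
  exact mul_le_mul_left (ENNReal.rpow_le_rpow (measure_mono (Ioo_subset_Ioo_right h)) hβ) _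

lemma Bf_le (μ : Measure ℝ) {V : ℝ → ℝ≥0∞} {β : ℝ} (hβ : 0 ≤ β) {Vb : ℝ≥0∞}
    (hVb : ∀ x, V x ≤ Vb) (x : ℝ) : Bf μ V β x ≤ μ univ ^ β * Vb ^ β * μ univ := by
  calc Bf μ V β x ≤ ∫⁻ t, μ univ ^ β * Vb ^ β ∂μ := by
        refine (setLIntegral_le_lintegral _ _).trans (lintegral_mono fun t => ?_)
        exact mul_le_mul' (ENNReal.rpow_le_rpow (measure_mono (subset_univ _)) hβ)
          (ENNReal.rpow_le_rpow (hVb t) hβ)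
    _ = _ := lintegral_const _

lemma E5f_ne_top (μ ν : Measure ℝ) [IsFiniteMeasure μ] [IsFiniteMeasure ν] {V : ℝ → ℝ≥0∞}
    {α β γ : ℝ} (hα : 0 ≤ α) (hβ : 0 ≤ β) (hγ : 0 ≤ γ) {Vb : ℝ≥0∞} (hb : Vb ≠ ⊤)
    (hVb : ∀ x, V x ≤ Vb) : E5f μ ν V α β γ ≠ ⊤ := by
  have h : E5f μ ν V α β γ ≤ ∫⁻ _, ν univ ^ α * (μ univ ^ β * Vb ^ β * μ univ) ^ γ ∂ν :=
    lintegral_mono fun x => mul_le_mul' (ENNReal.rpow_le_rpow (measure_mono (subset_univ _)) hα)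
      (ENNReal.rpow_le_rpow (Bf_le μ hβ hVb x) hγ)
  refine ne_top_of_le_ne_top ?_ h
  rw [lintegral_const]
  refine ENNReal.mul_ne_top (ENNReal.mul_ne_top
    (ENNReal.rpow_ne_top_of_nonneg hα (measure_ne_top _ _)) (ENNReal.rpow_ne_top_of_nonneg hγ
      (ENNReal.mul_ne_top (ENNReal.mul_ne_top
        (ENNReal.rpow_ne_top_of_nonneg hβ (measure_ne_top _ _))
        (ENNReal.rpow_ne_top_of_nonneg hβ hb)) (measure_ne_top _ _)))) (measure_ne_top _ _)

/-- Tail integrals over the points `y j` below which `B` is at least `2 ^ j`. -/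
lemma sum_tail_le (ν : Measure ℝ) [NullSingletonClass ν] {α γ : ℝ} (hα : 0 < α) (hγ : 0 < γ)
    {B : ℝ → ℝ≥0∞} (hB : Monotone B) (P : ℤ → Prop) [DecidablePred P] (y : ℤ → ℝ)
    (hy : ∀ j, P j → p2 j < B (y j)) :
    ∑' j : ℤ, (if P j then ν (Ioi (y j)) ^ (1 + α) * p2 (j * γ) else 0)
      ≤ p2 (1 + α) * gs γ * ∫⁻ x, ν (Ioi x) ^ α * B x ^ γ ∂ν := by
  have hm : Measurable fun x => ν (Ioi x) ^ α := (measurable_tail ν).pow_const _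
  calc _ ≤ ∑' j : ℤ, p2 (1 + α) * ∫⁻ x, ν (Ioi x) ^ α *
          (if p2 j < B x then p2 (j * γ) else 0) ∂ν := by
        refine ENNReal.tsum_le_tsum fun j => ?_
        split_ifs with h
        · calc _ ≤ (p2 (1 + α) * ∫⁻ s in Ioi (y j), ν (Ioi (y j) ∩ Ici s) ^ α ∂ν) * p2 (j * γ) :=
                mul_le_mul_left (tail_real ν _ hα) _
            _ = p2 (1 + α) * ∫⁻ s in Ioi (y j), ν (Ioi (y j) ∩ Ici s) ^ α * p2 (j * γ) ∂ν := by
                rw [lintegral_mul_const' _ _ (p2_ne_top _), mul_assoc]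
            _ ≤ p2 (1 + α) * ∫⁻ x in Ioi (y j), ν (Ioi x) ^ α *
                  (if p2 j < B x then p2 (j * γ) else 0) ∂ν := by
                refine mul_le_mul_right (setLIntegral_mono' measurableSet_Ioi fun s hs => ?_) _
                rw [if_pos ((hy j h).trans_le (hB (le_of_lt hs)))]
                refine mul_le_mul_left (ENNReal.rpow_le_rpow ?_ hα.le) _
                rw [measure_congr (Ioi_ae_eq_Ici (a := s))]
                exact measure_mono inter_subset_right
            _ ≤ _ := mul_le_mul_right (setLIntegral_le_lintegral _ _) _
        · exact zero_le
    _ = p2 (1 + α) * ∫⁻ x, ν (Ioi x) ^ α *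
          ∑' j : ℤ, (if p2 j < B x then p2 (j * γ) else 0) ∂ν := by
        rw [ENNReal.tsum_mul_left, ← lintegral_tsum]
        · simp_rw [ENNReal.tsum_mul_left]
        · intro j
          exact (hm.mul (Measurable.ite (measurableSet_level hB j) measurable_const
            measurable_const)).aemeasurable
    _ ≤ p2 (1 + α) * ∫⁻ x, gs γ * (ν (Ioi x) ^ α * B x ^ γ) ∂ν := by
        refine mul_le_mul_right (lintegral_mono fun x => ?_) _
        calc _ ≤ ν (Ioi x) ^ α * (gs γ * B x ^ γ) := mul_le_mul_right (tsum_level_le _ hγ) _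
          _ = _ := by ring
    _ = _ := by rw [lintegral_const_mul' _ _ (gs_ne_top hγ), mul_assoc]

lemma Hf_ge {V : ℝ → ℝ≥0∞} {h : ℤ → ℝ≥0∞} {t : ℝ} {a : ℝ} (ha : 0 < a) (hV : V t ≠ ⊤) {K : ℝ≥0∞}
    (hK : ∀ k : ℤ, p2 k < V t → p2 (k * a) * K ≤ h k) : K * V t ^ a ≤ p2 a * Hf V h t := by
  calc K * V t ^ a ≤ K * (p2 a * ∑' k : ℤ, (if p2 k < V t then p2 (k * a) else 0)) :=
        mul_le_mul_right (le_tsum_level hV ha) _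
    _ = p2 a * ∑' k : ℤ, K * (if p2 k < V t then p2 (k * a) else 0) := by
        rw [ENNReal.tsum_mul_left]; ring
    _ ≤ _ := by
        refine mul_le_mul_right (ENNReal.tsum_le_tsum fun k => ?_) _
        split_ifs with h
        · rw [mul_comm]; exact hK k h
        · simp

lemma E5f_le_sum (μ ν : Measure ℝ) [IsFiniteMeasure μ] {V : ℝ → ℝ≥0∞} {α β γ : ℝ} (hβ : 0 ≤ β)
    (hγ : 0 < γ) {Vb : ℝ≥0∞} (hb : Vb ≠ ⊤) (hVb : ∀ x, V x ≤ Vb) :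
    E5f μ ν V α β γ ≤ ∑' j : ℤ, p2 ((j + 1) * γ) * (ν.withDensity fun x => ν (Ioi x) ^ α)
      {x | p2 j < Bf μ V β x ∧ Bf μ V β x ≤ p2 (j + 1)} := by
  have hBm := (Bf_mono μ V hβ).measurable
  have hm : ∀ j : ℤ, MeasurableSet {x | p2 j < Bf μ V β x ∧ Bf μ V β x ≤ p2 (j + 1)} := fun j =>
    (measurableSet_lt measurable_const hBm).inter (measurableSet_le hBm measurable_const)
  have hBtop : ∀ x, Bf μ V β x ≠ ⊤ := fun x => ne_top_of_le_ne_top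
    (ENNReal.mul_ne_top (ENNReal.mul_ne_top (ENNReal.rpow_ne_top_of_nonneg hβ (measure_ne_top _ _))
        (ENNReal.rpow_ne_top_of_nonneg hβ hb)) (measure_ne_top _ _)) (Bf_le μ hβ hVb x)
  have hpt : ∀ x, ν (Ioi x) ^ α * Bf μ V β x ^ γ ≤ ∑' j : ℤ,
      {x | p2 j < Bf μ V β x ∧ Bf μ V β x ≤ p2 (j + 1)}.indicator
        (fun x => p2 ((j + 1) * γ) * ν (Ioi x) ^ α) x := by
    intro x
    by_cases h0 : Bf μ V β x = 0
    · simp [h0, hγ]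
    · obtain ⟨j, hj⟩ := exists_p2_block h0 (hBtop x)
      refine le_trans ?_ (ENNReal.le_tsum j)
      rw [indicator_of_mem (show x ∈ {x | p2 j < Bf μ V β x ∧ Bf μ V β x ≤ p2 (j + 1)} from hj),
        mul_comm, ← p2_rpow]
      exact mul_le_mul_left (ENNReal.rpow_le_rpow hj.2 hγ.le) _
  refine (lintegral_mono hpt).trans (le_of_eq ?_)
  have hW := (measurable_tail ν).pow_const α
  rw [lintegral_tsum fun j : ℤ => ((hW.const_mul (p2 ((j + 1) * γ))).indicator (hm j)).aemeasurable]
  congr 1; ext j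
  rw [lintegral_indicator (hm j), lintegral_const_mul' _ _ (p2_ne_top _), withDensity_apply _ (hm j)]

lemma lower_E5 {q r α β ρ γ : ℝ} (e : Exps q r α β ρ γ) : ∃ c : ℝ≥0∞, c ≠ ⊤ ∧
    ∀ (μ ν : Measure ℝ) [IsFiniteMeasure μ] [IsFiniteMeasure ν] [NullSingletonClass μ]
      [NullSingletonClass ν] (V : ℝ → ℝ≥0∞), Monotone V → ∀ Vb ≠ ⊤, (∀ x, V x ≤ Vb) →
      ∀ D : ℝ≥0∞, (∀ h : ℤ → ℝ≥0∞, Jf μ ν V q ρ h ≤ D * (∑' k : ℤ, h k * p2 (-k)) ^ r) →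
      E5f μ ν V α β γ ^ (1 - r) ≤ c * D := by
  classical
  have hα := e.α0
  have hβ := e.β0
  have hγ := e.γ0
  have hρ := e.ρ0
  have hq := e.q0
  set K1 : ℝ≥0∞ := p2 (1 + β) * gs β * 2 * (p2 (1 + α) * gs γ) with hK1
  have hK1t : K1 ≠ ⊤ := ENNReal.mul_ne_top (ENNReal.mul_ne_top (ENNReal.mul_ne_top (p2_ne_top _)
    (gs_ne_top hβ)) (by simp)) (ENNReal.mul_ne_top (p2_ne_top _) (gs_ne_top hγ))
  refine ⟨p2 γ * 2 * p2 (β * ρ) * K1 ^ r, ENNReal.mul_ne_top (ENNReal.mul_ne_top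
    (ENNReal.mul_ne_top (p2_ne_top _) (by simp)) (p2_ne_top _))
    (ENNReal.rpow_ne_top_of_nonneg e.r0.le hK1t), ?_⟩
  intro μ ν _ _ _ _ V hV Vb hb hVb D hD
  have hE := E5f_ne_top μ ν (V := V) hα.le hβ.le hγ.le hb hVb
  refine absorb e.r1 hE ?_
  set B := Bf μ V β with hB
  have hBm : Monotone B := Bf_mono μ V hβ.le
  set blk : ℤ → Set ℝ := fun j => {x | p2 j < B x ∧ B x ≤ p2 (j + 1)} with hblk
  have hblkm : ∀ j : ℤ, MeasurableSet (blk j) := fun j =>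
    (measurableSet_lt measurable_const hBm.measurable).inter
      (measurableSet_le hBm.measurable measurable_const)
  set μ' := ν.withDensity fun x => ν (Ioi x) ^ α with hμ'
  have hμ't : ∀ A, μ' A ≠ ⊤ := by
    intro A
    refine ne_top_of_le_ne_top ?_ (measure_mono (subset_univ A))
    rw [hμ', withDensity_apply _ MeasurableSet.univ, Measure.restrict_univ]
    have h1 : ∫⁻ x, ν (Ioi x) ^ α ∂ν ≤ ∫⁻ _, ν univ ^ α ∂ν :=
      lintegral_mono fun x => ENNReal.rpow_le_rpow (measure_mono (subset_univ _)) hα.le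
    refine ne_top_of_le_ne_top ?_ h1
    rw [lintegral_const]
    exact ENNReal.mul_ne_top (ENNReal.rpow_ne_top_of_nonneg hα.le (measure_ne_top _ _))
      (measure_ne_top _ _)
  set P : ℤ → Prop := fun j => μ' (blk j) ≠ 0 with hP
  have hy : ∀ j, ∃ y, P j → y ∈ blk j ∧ μ' (blk j) ≤ 2 * μ' (blk j ∩ Ici y) := by
    intro j
    by_cases hj : P j
    · obtain ⟨A', hA', h1, h2⟩ := exists_half_tail countablyCoinitial_real μ' (hblkm j)
        (fun s => measurableSet_Ici) hj (hμ't _)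
      obtain ⟨y, hy⟩ := nonempty_of_measure_ne_zero h1.ne'
      exact ⟨y, fun _ => ⟨hA' hy, h2 y hy⟩⟩
    · exact ⟨0, fun h => absurd h hj⟩
  choose y hy using hy
  set c : ℤ → ℝ≥0∞ := fun j => if P j then ν (Ioi (y j)) ^ (1 + α) * p2 (j * (γ - 1)) else 0 with hc
  set h : ℤ → ℝ≥0∞ := fun k => ∑' j, c j * (p2 (k * (1 + β)) *
    μ (Iio (y j) ∩ {t | p2 k < V t}) ^ (1 + β)) with hh
  have hcost : ∑' k : ℤ, h k * p2 (-k) ≤ K1 * E5f μ ν V α β γ := by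
    calc ∑' k : ℤ, h k * p2 (-k) = ∑' j, c j * ∑' k : ℤ, p2 (k * β) *
          μ (Iio (y j) ∩ {t | p2 k < V t}) ^ (1 + β) := by
          simp_rw [hh, ← ENNReal.tsum_mul_right, ← ENNReal.tsum_mul_left]
          rw [ENNReal.tsum_comm]
          congr 1; ext j; congr 1; ext k
          rw [show (k : ℝ) * (1 + β) = k + k * β by ring, p2_add]
          calc _ = c j * (p2 (k * β) * μ (Iio (y j) ∩ {t | p2 k < V t}) ^ (1 + β)) *
                (p2 k * p2 (-k)) := by ring
            _ = _ := by rw [p2_mul_neg, mul_one]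
      _ ≤ ∑' j : ℤ, p2 (1 + β) * gs β * 2 *
            (if P j then ν (Ioi (y j)) ^ (1 + α) * p2 (j * γ) else 0) := by
          refine ENNReal.tsum_le_tsum fun j => ?_
          by_cases hj : P j
          · have h1 := sum_level_tail hβ μ hV (measurableSet_Iio (a := y j))
            have h2 : ∫⁻ s in Iio (y j), μ (Iio (y j) ∩ Ici s) ^ β * V s ^ β ∂μ = B (y j) := by
              rw [hB, Bf]
              refine lintegral_congr fun s => ?_
              rw [measure_congr Ioo_ae_eq_Ico]
              congr 3; ext z; simp [and_comm]
            rw [h2] at h1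
            have h3 := (hy j hj).1.2
            simp only [hc, if_pos hj]
            calc _ ≤ ν (Ioi (y j)) ^ (1 + α) * p2 (j * (γ - 1)) *
                  (p2 (1 + β) * gs β * p2 (j + 1)) :=
                  mul_le_mul_right (h1.trans (mul_le_mul_right h3 _)) _
              _ = p2 (1 + β) * gs β * 2 * (ν (Ioi (y j)) ^ (1 + α) *
                  (p2 (j * (γ - 1)) * p2 j)) := by rw [p2_add j 1, p2_one]; ring
              _ = _ := by rw [← p2_add]; congr 4; ring
          · simp [hc, hj]
      _ ≤ _ := by
          rw [ENNReal.tsum_mul_left, hK1, mul_assoc _ (p2 (1 + α) * gs γ)]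
          exact mul_le_mul_right (sum_tail_le ν hα hγ hBm P y fun j hj => (hy j hj).1.1) _
  have hHlow : ∀ j, P j → ∀ x ∈ blk j ∩ Ici (y j), ν (Ioi x) ^ α * p2 (j * γ) ≤
      p2 (β * ρ) * (∫⁻ t in Iio x, Hf V h t ^ q ∂μ) ^ ρ := by
    intro j hj x hx
    have h1 : c j ^ q * B (y j) ≤ p2 β * ∫⁻ t in Iio x, Hf V h t ^ q ∂μ := by
      have hcq : c j ^ q ≠ ⊤ := by
        refine ENNReal.rpow_ne_top_of_nonneg hq.le ?_
        simp only [hc, if_pos hj]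
        exact ENNReal.mul_ne_top (ENNReal.rpow_ne_top_of_nonneg (by positivity) (measure_ne_top _ _))
          (p2_ne_top _)
      calc c j ^ q * B (y j) = ∫⁻ t in Iio (y j), c j ^ q * (μ (Ioo t (y j)) ^ β * V t ^ β) ∂μ := by
            rw [lintegral_const_mul' _ _ hcq]; rfl
        _ ≤ ∫⁻ t in Iio (y j), p2 β * Hf V h t ^ q ∂μ := by
            refine lintegral_mono fun t => ?_
            have h2 := Hf_ge (V := V) (h := h) (t := t) (a := 1 + β) (by positivity)
              (ne_top_of_le_ne_top hb (hVb t)) (K := c j * μ (Ioo t (y j)) ^ (1 + β)) ?_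
            · have h3 := ENNReal.rpow_le_rpow h2 hq.le
              have hbq : (1 + β) * q = β := by have := e.hβ; linarith
              rw [ENNReal.mul_rpow_of_nonneg _ _ hq.le, ENNReal.mul_rpow_of_nonneg _ _ hq.le,
                ENNReal.mul_rpow_of_nonneg _ _ hq.le, p2_rpow, ← ENNReal.rpow_mul,
                ← ENNReal.rpow_mul, hbq, mul_assoc] at h3
              exact h3
            · intro k hk
              refine le_trans ?_ (ENNReal.le_tsum j)
              rw [mul_left_comm]
              have hsub : Ioo t (y j) ⊆ Iio (y j) ∩ {t | p2 k < V t} :=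
                fun s hs => ⟨hs.2, hk.trans_le (hV hs.1.le)⟩
              exact mul_le_mul_right (mul_le_mul_right (ENNReal.rpow_le_rpow
                (measure_mono hsub) (by positivity)) _) _
        _ = p2 β * ∫⁻ t in Iio (y j), Hf V h t ^ q ∂μ := lintegral_const_mul' _ _ (p2_ne_top _)
        _ ≤ _ := mul_le_mul_right (lintegral_mono_set (Iio_subset_Iio hx.2)) _
    have h2 : c j ^ q * p2 j ≤ p2 β * ∫⁻ t in Iio x, Hf V h t ^ q ∂μ :=
      (mul_le_mul_right (hy j hj).1.1.le _).trans h1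
    have h3 := ENNReal.rpow_le_rpow h2 hρ.le
    rw [ENNReal.mul_rpow_of_nonneg _ _ hρ.le, ENNReal.mul_rpow_of_nonneg _ _ hρ.le, p2_rpow,
      p2_rpow, ← ENNReal.rpow_mul, mul_comm q, e.hρ] at h3
    refine le_trans ?_ h3
    simp only [hc, if_pos hj]
    rw [ENNReal.mul_rpow_of_nonneg _ _ e.r0.le, p2_rpow, ← ENNReal.rpow_mul, mul_assoc, ← p2_add,
      show (1 + α) * r = α by have := e.hα; linarith,
      show (j : ℝ) * (γ - 1) * r + j * ρ = j * γ by
        linear_combination (-(j:ℝ)) * e.gamma_mul + (j:ℝ) * e.hρ]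
    exact mul_le_mul_left (ENNReal.rpow_le_rpow (antitone_tail ν hx.2) hα.le) _
  have hgain : ∑' j : ℤ, p2 (j * γ) * (if P j then μ' (blk j ∩ Ici (y j)) else 0)
      ≤ p2 (β * ρ) * Jf μ ν V q ρ h := by
    have hdis : Pairwise (Function.onFun Disjoint fun j => blk j ∩ Ici (y j)) := by
      intro i j hij
      rw [Function.onFun, Set.disjoint_left]
      rintro x ⟨hi, -⟩ ⟨hj, -⟩
      apply hij
      have h1 := hi.1.trans_le hj.2
      have h2 := hj.1.trans_le hi.2
      rw [p2_lt_iff] at h1 h2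
      norm_cast at h1 h2
      omega
    calc _ ≤ ∑' j : ℤ, ∫⁻ x in blk j ∩ Ici (y j),
          p2 (β * ρ) * (∫⁻ t in Iio x, Hf V h t ^ q ∂μ) ^ ρ ∂ν := by
          refine ENNReal.tsum_le_tsum fun j => ?_
          split_ifs with hj
          · have hms := (hblkm j).inter (measurableSet_Ici (a := y j))
            rw [hμ', withDensity_apply _ hms, ← lintegral_const_mul' _ _ (p2_ne_top _)]
            refine setLIntegral_mono' hms fun x hx => ?_
            rw [mul_comm]; exact hHlow j hj x hx
          · simp
      _ = ∫⁻ x in ⋃ j, blk j ∩ Ici (y j), p2 (β * ρ) * (∫⁻ t in Iio x, Hf V h t ^ q ∂μ) ^ ρ ∂ν :=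
          (lintegral_iUnion (fun j => (hblkm j).inter measurableSet_Ici) hdis _).symm
      _ ≤ ∫⁻ x, p2 (β * ρ) * (∫⁻ t in Iio x, Hf V h t ^ q ∂μ) ^ ρ ∂ν :=
          setLIntegral_le_lintegral _ _
      _ = _ := by rw [lintegral_const_mul' _ _ (p2_ne_top _)]; rfl
  calc E5f μ ν V α β γ ≤ ∑' j : ℤ, p2 ((j + 1) * γ) * μ' (blk j) :=
        E5f_le_sum μ ν hβ.le hγ hb hVb
    _ ≤ ∑' j : ℤ, p2 γ * 2 * (p2 (j * γ) * (if P j then μ' (blk j ∩ Ici (y j)) else 0)) := by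
        refine ENNReal.tsum_le_tsum fun j => ?_
        by_cases hj : P j
        · rw [if_pos hj]
          calc _ ≤ p2 ((j + 1) * γ) * (2 * μ' (blk j ∩ Ici (y j))) :=
                mul_le_mul_right (hy j hj).2 _
            _ = _ := by rw [add_mul, one_mul, p2_add]; ring
        · have : μ' (blk j) = 0 := not_not.1 hj
          simp [this]
    _ = p2 γ * 2 * ∑' j : ℤ, (p2 (j * γ) * (if P j then μ' (blk j ∩ Ici (y j)) else 0)) :=
        ENNReal.tsum_mul_left
    _ ≤ p2 γ * 2 * (p2 (β * ρ) * (D * (K1 * E5f μ ν V α β γ) ^ r)) :=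
        mul_le_mul_right (hgain.trans (mul_le_mul_right ((hD h).trans
          (mul_le_mul_right (ENNReal.rpow_le_rpow hcost e.r0.le) _)) _)) _
    _ = _ := by rw [ENNReal.mul_rpow_of_nonneg _ _ e.r0.le]; ring

/-- The variant of `E3f` with a supremum in place of the essential supremum. -/
def E3s (μ ν : Measure ℝ) (V : ℝ → ℝ≥0∞) (α ρ : ℝ) : ℝ≥0∞ :=
  ∫⁻ x, Thf μ ν ρ x ^ α * ⨆ t : Iio x, μ (Ioo t.1 x) ^ ρ * V t ^ α ∂ν

lemma Hf_mono {V : ℝ → ℝ≥0∞} (hV : Monotone V) (h : ℤ → ℝ≥0∞) : Monotone (Hf V h) := by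
  intro s t hst
  refine ENNReal.tsum_le_tsum fun k => ?_
  by_cases h1 : p2 k < V s
  · simp [h1, h1.trans_le (hV hst)]
  · simp [h1]

lemma Thf_anti (μ ν : Measure ℝ) {ρ : ℝ} (hρ : 0 ≤ ρ) : Antitone (Thf μ ν ρ) := by
  intro x y h
  refine (lintegral_mono_set (Ioi_subset_Ioi h)).trans (lintegral_mono fun t => ?_)
  exact ENNReal.rpow_le_rpow (measure_mono (Ioo_subset_Ioo_left h)) hρ

/-- The block version of the supremum in `E3s`. -/
def tau (μ ν : Measure ℝ) (V : ℝ → ℝ≥0∞) (α ρ : ℝ) (j : ℤ) : ℝ≥0∞ :=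
  ⨆ t : blkG ν j, μ (blkG ν j ∩ Ioi t.1) ^ ρ * (Thf μ ν ρ t ^ α * V t ^ α)

lemma tau_ne_top (μ ν : Measure ℝ) [IsFiniteMeasure μ] [IsFiniteMeasure ν] {V : ℝ → ℝ≥0∞}
    {α ρ : ℝ} (hα : 0 ≤ α) (hρ : 0 ≤ ρ) {Vb : ℝ≥0∞} (hb : Vb ≠ ⊤) (hVb : ∀ x, V x ≤ Vb) (j : ℤ) :
    tau μ ν V α ρ j ≠ ⊤ := by
  have hTh : ∀ x, Thf μ ν ρ x ≤ μ univ ^ ρ * ν univ := fun x => by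
    calc Thf μ ν ρ x ≤ ∫⁻ _, μ univ ^ ρ ∂ν :=
          (setLIntegral_le_lintegral _ _).trans (lintegral_mono fun t =>
            ENNReal.rpow_le_rpow (measure_mono (subset_univ _)) hρ)
      _ = _ := lintegral_const _
  have h : tau μ ν V α ρ j ≤ μ univ ^ ρ * ((μ univ ^ ρ * ν univ) ^ α * Vb ^ α) :=
    iSup_le fun t => mul_le_mul' (ENNReal.rpow_le_rpow (measure_mono (subset_univ _)) hρ)
      (mul_le_mul' (ENNReal.rpow_le_rpow (hTh _) hα) (ENNReal.rpow_le_rpow (hVb _) hα))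
  refine ne_top_of_le_ne_top ?_ h
  have hm := ENNReal.rpow_ne_top_of_nonneg hρ (measure_ne_top μ univ)
  exact ENNReal.mul_ne_top hm (ENNReal.mul_ne_top (ENNReal.rpow_ne_top_of_nonneg hα
    (ENNReal.mul_ne_top hm (measure_ne_top _ _))) (ENNReal.rpow_ne_top_of_nonneg hα hb))

lemma E3s_le_sum_tau {ρ : ℝ} (hρ : 0 < ρ) {α : ℝ} (hα : 0 < α) : ∃ c : ℝ≥0∞, c ≠ ⊤ ∧
    ∀ (μ ν : Measure ℝ) [IsFiniteMeasure μ] [IsFiniteMeasure ν] [NullSingletonClass μ]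
      [NullSingletonClass ν] (V : ℝ → ℝ≥0∞), Monotone V →
      E3s μ ν V α ρ ≤ c * ∑' j : ℤ, p2 (-j) * tau μ ν V α ρ j := by
  obtain ⟨c, hc, H⟩ := sum_hardy' hρ
  refine ⟨c * p2 ρ, ENNReal.mul_ne_top hc (p2_ne_top _), ?_⟩
  intro μ ν _ _ _ _ V hV
  set a : ℤ → ℝ≥0∞ := fun l => (p2 ρ * tau μ ν V α ρ l) ^ (1 / ρ) with ha
  have hρ1 : 1 / ρ * ρ = 1 := by field_simp
  have hρ2 : ρ * (1 / ρ) = 1 := by field_simp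
  have key : ∀ j, ∀ x ∈ blkG ν j, Thf μ ν ρ x ^ α * ⨆ t : Iio x, μ (Ioo t.1 x) ^ ρ * V t ^ α
      ≤ (∑' l : ℤ, if l ≤ j then a l else 0) ^ ρ := by
    intro j x hx
    rw [ENNReal.mul_iSup]
    refine iSup_le fun ⟨t, ht⟩ => ?_
    simp only
    set K := Thf μ ν ρ x ^ α * V t ^ α with hK
    have h1 : ∀ l, μ (blkG ν l ∩ Ioo t x) ^ ρ * K ≤ p2 ρ * tau μ ν V α ρ l := by
      intro l
      by_cases h0 : μ (blkG ν l ∩ Ioo t x) = 0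
      · rw [h0, ENNReal.zero_rpow_of_pos hρ, zero_mul]; exact zero_le
      obtain ⟨A', hA', h2, h3⟩ := exists_half_tail countablyCoinitial_real μ
        ((measurableSet_blkG ν l).inter (measurableSet_Ioo (a := t) (b := x)))
        (fun s => measurableSet_Ici) h0 (measure_ne_top _ _)
      obtain ⟨s, hs⟩ := nonempty_of_measure_ne_zero h2.ne'
      have hs' := hA' hs
      have h4 : μ (blkG ν l ∩ Ioo t x) ≤ 2 * μ (blkG ν l ∩ Ioi s) := by
        refine (h3 s hs).trans (mul_le_mul_right ?_ _)
        rw [measure_congr (Filter.EventuallyEq.inter (Filter.EventuallyEq.refl _ (blkG ν l))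
          (Ioi_ae_eq_Ici (a := s)))]
        exact measure_mono (inter_subset_inter_left _ inter_subset_left)
      calc _ ≤ (2 * μ (blkG ν l ∩ Ioi s)) ^ ρ * (Thf μ ν ρ s ^ α * V s ^ α) :=
            mul_le_mul' (ENNReal.rpow_le_rpow h4 hρ.le) (mul_le_mul'
              (ENNReal.rpow_le_rpow (Thf_anti μ ν hρ.le hs'.2.2.le) hα.le)
              (ENNReal.rpow_le_rpow (hV hs'.2.1.le) hα.le))
        _ = p2 ρ * (μ (blkG ν l ∩ Ioi s) ^ ρ * (Thf μ ν ρ s ^ α * V s ^ α)) := by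
            rw [ENNReal.mul_rpow_of_nonneg _ _ hρ.le, mul_assoc]; rfl
        _ ≤ _ := mul_le_mul_right (le_iSup (fun s : blkG ν l => μ (blkG ν l ∩ Ioi s.1) ^ ρ *
            (Thf μ ν ρ s ^ α * V s ^ α)) ⟨s, hs'.1⟩) _
    have h2 : ∀ l, μ (blkG ν l ∩ Ioo t x) * K ^ (1 / ρ) ≤ a l := by
      intro l
      have := ENNReal.rpow_le_rpow (h1 l) (show 0 ≤ 1 / ρ by positivity)
      rwa [ENNReal.mul_rpow_of_nonneg _ _ (by positivity), rpow_cancel _ hρ2] at this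
    have h3 : μ (Ioo t x) ≤ ∑' l : ℤ, if l ≤ j then μ (blkG ν l ∩ Ioo t x) else 0 := by
      have := measure_Iio_le_blkG ν (μ.restrict (Ioo t x)) hx
      simp only [Measure.restrict_apply measurableSet_Iio,
        Measure.restrict_apply (measurableSet_blkG ν _)] at this
      have hsub : Ioo t x ⊆ Iio x ∩ Ioo t x := fun s hs => ⟨hs.2, hs⟩
      exact (measure_mono hsub).trans this
    calc _ = (μ (Ioo t x) * K ^ (1 / ρ)) ^ ρ := by
          rw [ENNReal.mul_rpow_of_nonneg _ _ hρ.le, rpow_cancel _ hρ1, hK]; ring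
      _ ≤ _ := by
          refine ENNReal.rpow_le_rpow ?_ hρ.le
          refine (mul_le_mul_left h3 _).trans ?_
          rw [← ENNReal.tsum_mul_right]
          refine ENNReal.tsum_le_tsum fun l => ?_
          split_ifs
          · exact h2 l
          · simp
  refine (lintegral_le_blkG ν key).trans ((H a).trans (le_of_eq ?_))
  rw [mul_assoc, ← ENNReal.tsum_mul_left (a := p2 ρ)]
  congr 2; ext j
  rw [ha]; dsimp only
  rw [rpow_cancel _ hρ1]; ring

lemma lower_E3 {q r α β ρ γ : ℝ} (e : Exps q r α β ρ γ) : ∃ c : ℝ≥0∞, c ≠ ⊤ ∧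
    ∀ (μ ν : Measure ℝ) [IsFiniteMeasure μ] [IsFiniteMeasure ν] [NullSingletonClass μ]
      [NullSingletonClass ν] (V : ℝ → ℝ≥0∞), Monotone V → ∀ Vb ≠ ⊤, (∀ x, V x ≤ Vb) →
      ∀ D : ℝ≥0∞, (∀ h : ℤ → ℝ≥0∞, Jf μ ν V q ρ h ≤ D * (∑' k : ℤ, h k * p2 (-k)) ^ r) →
      E3s μ ν V α ρ ^ (1 - r) ≤ c * D := by
  classical
  have hα := e.α0
  have hρ := e.ρ0
  have hq := e.q0
  have hr1 : 0 ≤ 1 - r := by have := e.r1; linarith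
  obtain ⟨c1, hc1, H1⟩ := E3s_le_sum_tau hρ hα
  obtain ⟨c0, hc0, H0⟩ := disc_le hρ
  set K1 : ℝ≥0∞ := p2 (1 + α) * gs α with hK1
  have hK1t : K1 ≠ ⊤ := ENNReal.mul_ne_top (p2_ne_top _) (gs_ne_top hα)
  refine ⟨(c1 * (2 * c0 ^ α)) ^ (1 - r) * (p2 α * 8 * K1 ^ r), ENNReal.mul_ne_top
    (ENNReal.rpow_ne_top_of_nonneg hr1 (ENNReal.mul_ne_top hc1 (ENNReal.mul_ne_top (by simp)
      (ENNReal.rpow_ne_top_of_nonneg hα.le hc0)))) (ENNReal.mul_ne_top (ENNReal.mul_ne_top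
    (p2_ne_top _) (by simp)) (ENNReal.rpow_ne_top_of_nonneg e.r0.le hK1t)), ?_⟩
  intro μ ν _ _ _ _ V hV Vb hb hVb D hD
  set P : ℤ → Prop := fun j => (blkG ν j).Nonempty with hP
  have hPmono : ∀ j l : ℤ, j ≤ l → P j → P l := by
    intro j l hjl hj
    induction l, hjl using Int.leInduction with
    | base => exact hj
    | succ l _ ih =>
      exact nonempty_of_measure_ne_zero (lt_of_lt_of_le (p2_pos _) (le_measure_blkG ν ih)).ne'
  have ht : ∀ j, ∃ t, P j → t ∈ blkG ν j ∧ tau μ ν V α ρ j ≤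
      2 * (μ (blkG ν j ∩ Ioi t) ^ ρ * (Thf μ ν ρ t ^ α * V t ^ α)) := by
    intro j
    by_cases hj : P j
    · by_cases h0 : tau μ ν V α ρ j = 0
      · obtain ⟨t, ht⟩ := hj
        exact ⟨t, fun _ => ⟨ht, by rw [h0]; exact zero_le⟩⟩
      · have h1 : tau μ ν V α ρ j / 2 < tau μ ν V α ρ j :=
          ENNReal.half_lt_self h0 (tau_ne_top μ ν hα.le hρ.le hb hVb j)
        obtain ⟨⟨t, ht⟩, h2⟩ := lt_iSup_iff.1 (lt_of_lt_of_eq h1 rfl)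
        refine ⟨t, fun _ => ⟨ht, ?_⟩⟩
        have h3 := mul_le_mul_right h2.le 2
        rwa [ENNReal.mul_div_cancel (by simp) (by simp)] at h3
    · exact ⟨0, fun h => absurd h hj⟩
  choose t ht using ht
  set n : ℤ → ℝ≥0∞ := fun j => p2 (-j) * μ (blkG ν j ∩ Ioi (t j)) ^ ρ with hn
  set N : ℤ → ℝ≥0∞ := fun j => if P j then n j + mj μ ν ρ (j + 1) else 0 with hN
  set M : ℤ → ℝ≥0∞ := fun j => ∑' l, if j ≤ l then N l else 0 with hM
  set L : ℝ≥0∞ := ∑' j, N j * M j ^ α * V (t j) ^ α with hL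
  have hsumN : ∑' j, N j ≠ ⊤ := by
    have h1 : ∀ j, N j ≤ mj μ ν ρ j + mj μ ν ρ (j + 1) := by
      intro j
      simp only [hN]
      split_ifs
      · refine add_le_add (mul_le_mul_right (ENNReal.rpow_le_rpow (measure_mono inter_subset_left)
          hρ.le) _) le_rfl
      · exact zero_le
    have h2 : ∑' j, mj μ ν ρ j ≠ ⊤ := by
      refine ne_top_of_le_ne_top ?_ (disc_ge hρ ν μ)
      refine ENNReal.mul_ne_top (by simp) (ne_top_of_le_ne_top ?_ (lintegral_mono (g := fun _ =>
        μ univ ^ ρ) fun x => ENNReal.rpow_le_rpow (measure_mono (subset_univ _)) hρ.le))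
      rw [lintegral_const]
      exact ENNReal.mul_ne_top (ENNReal.rpow_ne_top_of_nonneg hρ.le (measure_ne_top _ _))
        (measure_ne_top _ _)
    refine ne_top_of_le_ne_top ?_ (ENNReal.tsum_le_tsum h1)
    rw [ENNReal.tsum_add, tsum_shift]
    exact ENNReal.add_ne_top.2 ⟨h2, h2⟩
  have hLt : L ≠ ⊤ := by
    have h1 : L ≤ ∑' j, N j * (∑' j, N j) ^ α * Vb ^ α := by
      refine ENNReal.tsum_le_tsum fun j => mul_le_mul' (mul_le_mul_right
        (ENNReal.rpow_le_rpow (ENNReal.tsum_le_tsum fun l => ?_) hα.le) _)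
        (ENNReal.rpow_le_rpow (hVb _) hα.le)
      split_ifs
      · exact le_rfl
      · exact zero_le
    refine ne_top_of_le_ne_top ?_ h1
    rw [ENNReal.tsum_mul_right, ENNReal.tsum_mul_right]
    exact ENNReal.mul_ne_top (ENNReal.mul_ne_top hsumN (ENNReal.rpow_ne_top_of_nonneg hα.le hsumN))
      (ENNReal.rpow_ne_top_of_nonneg hα.le hb)
  have hTh : ∀ j, P j → Thf μ ν ρ (t j) ≤ c0 * M j := by
    intro j hj
    rw [← Thf_eq μ ν hρ]
    refine (H0 ν (μ.restrict (Ioi (t j)))).trans (mul_le_mul_right ?_ _)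
    simp only [Measure.restrict_apply (measurableSet_blkG ν _)]
    calc _ ≤ ∑' l : ℤ, ((if j = l then n l else 0) + (if j + 1 ≤ l then mj μ ν ρ l else 0)) := by
          refine ENNReal.tsum_le_tsum fun l => ?_
          rcases lt_trichotomy l j with h | h | h
          · have : blkG ν l ∩ Ioi (t j) = ∅ := by
              ext s
              simp only [mem_inter_iff, mem_Ioi, mem_empty_iff_false, iff_false, not_and, not_lt]
              exact fun hs => (blkG_lt hs (ht j hj).1 h).le
            simp [this, hρ]
          · subst h; simp [hn]
          · rw [if_pos (show j + 1 ≤ l by omega)]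
            refine le_trans ?_ le_add_self
            exact mul_le_mul_right (ENNReal.rpow_le_rpow (measure_mono inter_subset_left) hρ.le) _
      _ = ∑' l : ℤ, ((if j = l then n l else 0) + (if j ≤ l then mj μ ν ρ (l + 1) else 0)) := by
          rw [ENNReal.tsum_add, ENNReal.tsum_add]
          congr 1
          rw [← tsum_shift]
          simp only [add_le_add_iff_right]
      _ ≤ M j := by
          refine ENNReal.tsum_le_tsum fun l => ?_
          by_cases hjl : j ≤ l
          · have hl : P l := hPmono j l hjl hj
            simp only [hN, if_pos hl, if_pos hjl]
            refine add_le_add ?_ le_rfl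
            split_ifs
            · exact le_rfl
            · exact zero_le
          · have : j ≠ l := fun h => hjl h.le
            simp [hjl, this]
  have hEL : E3s μ ν V α ρ ≤ c1 * (2 * c0 ^ α) * L := by
    refine (H1 μ ν V hV).trans ?_
    rw [mul_assoc c1, hL, ← ENNReal.tsum_mul_left (a := 2 * c0 ^ α)]
    refine mul_le_mul_right (ENNReal.tsum_le_tsum fun j => ?_) _
    by_cases hj : P j
    · calc p2 (-j) * tau μ ν V α ρ j ≤ p2 (-j) * (2 * (μ (blkG ν j ∩ Ioi (t j)) ^ ρ *
            (Thf μ ν ρ (t j) ^ α * V (t j) ^ α))) := mul_le_mul_right (ht j hj).2 _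
        _ = 2 * (n j * Thf μ ν ρ (t j) ^ α * V (t j) ^ α) := by rw [hn]; ring
        _ ≤ 2 * (N j * (c0 * M j) ^ α * V (t j) ^ α) := by
            refine mul_le_mul_right (mul_le_mul_left (mul_le_mul' ?_
              (ENNReal.rpow_le_rpow (hTh j hj) hα.le)) _) _
            simp only [hN, if_pos hj]; exact le_self_add
        _ = _ := by rw [ENNReal.mul_rpow_of_nonneg _ _ hα.le]; ring
    · have : IsEmpty (blkG ν j) := by
        rw [isEmpty_coe_sort, ← not_nonempty_iff_eq_empty]; exact hj
      have : tau μ ν V α ρ j = 0 := by rw [tau, iSup_of_empty]; rfl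
      rw [this, mul_zero]; exact zero_le
  set h : ℤ → ℝ≥0∞ := fun k => p2 (k * (1 + α)) *
    (∑' j, if p2 k < V (t j) then N j else 0) ^ (1 + α) with hh
  have hcost : ∑' k : ℤ, h k * p2 (-k) ≤ K1 * L := by
    calc _ ≤ ∑' k : ℤ, ∑' j : ℤ, p2 (1 + α) * (N j * M j ^ α *
          (if p2 k < V (t j) then p2 (k * α) else 0)) := by
          refine ENNReal.tsum_le_tsum fun k => ?_
          have h1 := tail_disc N (fun j => p2 k < V (t j)) hα
          calc h k * p2 (-k) = p2 (k * α) * (∑' j, if p2 k < V (t j) then N j else 0) ^ (1 + α) *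
                (p2 k * p2 (-k)) := by
                simp only [hh]
                rw [show (k : ℝ) * (1 + α) = k + k * α by ring, p2_add]; ring
            _ = p2 (k * α) * (∑' j, if p2 k < V (t j) then N j else 0) ^ (1 + α) := by
                rw [p2_mul_neg, mul_one]
            _ ≤ _ := mul_le_mul_right h1 _
            _ ≤ _ := by
                rw [← mul_assoc, ← ENNReal.tsum_mul_left]
                refine ENNReal.tsum_le_tsum fun j => ?_
                split_ifs with hj
                · calc _ = p2 (1 + α) * (N j *
                        (∑' l, if j ≤ l ∧ p2 k < V (t l) then N l else 0) ^ α * p2 (k * α)) := by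
                        ring
                    _ ≤ _ := by
                        refine mul_le_mul_right (mul_le_mul_left (mul_le_mul_right
                          (ENNReal.rpow_le_rpow (ENNReal.tsum_le_tsum fun l => ?_) hα.le) _) _) _
                        split_ifs with h1 h2 h2
                        · exact le_rfl
                        · exact absurd h1.1 h2
                        · exact zero_le
                        · exact zero_le
                · simp
      _ = p2 (1 + α) * ∑' j : ℤ, N j * M j ^ α *
            ∑' k : ℤ, (if p2 k < V (t j) then p2 (k * α) else 0) := by
          rw [ENNReal.tsum_comm]
          simp_rw [ENNReal.tsum_mul_left]
      _ ≤ p2 (1 + α) * ∑' j : ℤ, gs α * (N j * M j ^ α * V (t j) ^ α) := by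
          refine mul_le_mul_right (ENNReal.tsum_le_tsum fun j => ?_) _
          calc _ ≤ N j * M j ^ α * (gs α * V (t j) ^ α) := mul_le_mul_right (tsum_level_le _ hα) _
            _ = _ := by ring
      _ = _ := by rw [ENNReal.tsum_mul_left, hK1, mul_assoc]
  have hHlow : ∀ j, P j → M j ^ α * V (t j) ^ α ≤ p2 α * Hf V h (t j) ^ r := by
    intro j hj
    have h2 := Hf_ge (V := V) (h := h) (t := t j) (a := 1 + α) (by positivity)
      (ne_top_of_le_ne_top hb (hVb _)) (K := M j ^ (1 + α)) ?_
    · have h3 := ENNReal.rpow_le_rpow h2 e.r0.le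
      have hbq : (1 + α) * r = α := by have := e.hα; linarith
      rwa [ENNReal.mul_rpow_of_nonneg _ _ e.r0.le, ENNReal.mul_rpow_of_nonneg _ _ e.r0.le,
        p2_rpow, ← ENNReal.rpow_mul, ← ENNReal.rpow_mul, hbq] at h3
    · intro k hk
      refine mul_le_mul_right (ENNReal.rpow_le_rpow (ENNReal.tsum_le_tsum fun l => ?_)
        (by positivity)) _
      by_cases hjl : j ≤ l
      · have hl : P l := hPmono j l hjl hj
        have hle : t j ≤ t l := by
          rcases eq_or_lt_of_le hjl with h | h
          · rw [h]
          · exact (blkG_lt (ht j hj).1 (ht l hl).1 h).le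
        rw [if_pos hjl, if_pos (hk.trans_le (hV hle))]
      · rw [if_neg hjl]; exact zero_le
  have hgain : ∑' j, N j * (if P j then Hf V h (t j) ^ r else 0) ≤ 8 * Jf μ ν V q ρ h := by
    have hd := disc_ge hρ ν (μ.withDensity fun s => Hf V h s ^ q)
    simp only [withDensity_apply _ measurableSet_Iio,
      withDensity_apply _ (measurableSet_blkG ν _)] at hd
    have hlow : ∀ (A B : Set ℝ) (s : ℝ), MeasurableSet A → A ⊆ B → (∀ x ∈ A, s ≤ x) →
        μ A ^ ρ * Hf V h s ^ r ≤ (∫⁻ x in B, Hf V h x ^ q ∂μ) ^ ρ := by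
      intro A B s hA hAB hs
      rw [show r = q * ρ by rw [mul_comm, e.hρ], ENNReal.rpow_mul,
        ← ENNReal.mul_rpow_of_nonneg _ _ hρ.le]
      refine ENNReal.rpow_le_rpow ?_ hρ.le
      calc μ A * Hf V h s ^ q = ∫⁻ x in A, Hf V h s ^ q ∂μ := by
            rw [setLIntegral_const, mul_comm]
        _ ≤ ∫⁻ x in A, Hf V h x ^ q ∂μ := setLIntegral_mono' hA fun x hx =>
            ENNReal.rpow_le_rpow (Hf_mono hV h (hs x hx)) hq.le
        _ ≤ _ := lintegral_mono_set hAB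
    calc _ ≤ ∑' j : ℤ, (p2 (-j) * (∫⁻ x in blkG ν j, Hf V h x ^ q ∂μ) ^ ρ +
          p2 (-(j + 1 : ℤ)) * (∫⁻ x in blkG ν (j + 1), Hf V h x ^ q ∂μ) ^ ρ) := by
          refine ENNReal.tsum_le_tsum fun j => ?_
          by_cases hj : P j
          · simp only [hN, if_pos hj, add_mul]
            refine add_le_add ?_ ?_
            · rw [hn]; dsimp only; rw [mul_assoc]
              refine mul_le_mul_right (hlow _ _ _ ((measurableSet_blkG ν j).inter measurableSet_Ioi)
                inter_subset_left fun x hx => le_of_lt hx.2) _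
            · rw [mj, mul_assoc]
              refine mul_le_mul_right (hlow _ _ _ (measurableSet_blkG ν _)
                subset_rfl fun x hx => (blkG_lt (ht j hj).1 hx (by omega)).le) _
          · simp [hN, hj]
      _ = 2 * ∑' j : ℤ, p2 (-j) * (∫⁻ x in blkG ν j, Hf V h x ^ q ∂μ) ^ ρ := by
          rw [ENNReal.tsum_add, tsum_shift (fun j : ℤ => p2 (-j) *
            (∫⁻ x in blkG ν j, Hf V h x ^ q ∂μ) ^ ρ), two_mul]
      _ ≤ 2 * (4 * Jf μ ν V q ρ h) := mul_le_mul_right hd _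
      _ = _ := by rw [← mul_assoc]; norm_num
  have hLL : L ≤ p2 α * 8 * K1 ^ r * D * L ^ r := by
    calc L ≤ ∑' j, p2 α * (N j * (if P j then Hf V h (t j) ^ r else 0)) := by
          refine ENNReal.tsum_le_tsum fun j => ?_
          by_cases hj : P j
          · rw [if_pos hj, mul_assoc, mul_left_comm (p2 α)]
            exact mul_le_mul_right (hHlow j hj) _
          · simp [hN, hj]
      _ ≤ p2 α * (8 * (D * (K1 * L) ^ r)) := by
          rw [ENNReal.tsum_mul_left]
          exact mul_le_mul_right (hgain.trans (mul_le_mul_right ((hD h).trans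
            (mul_le_mul_right (ENNReal.rpow_le_rpow hcost e.r0.le) _)) _)) _
      _ = _ := by rw [ENNReal.mul_rpow_of_nonneg _ _ e.r0.le]; ring
  calc E3s μ ν V α ρ ^ (1 - r) ≤ (c1 * (2 * c0 ^ α) * L) ^ (1 - r) :=
        ENNReal.rpow_le_rpow hEL hr1
    _ = (c1 * (2 * c0 ^ α)) ^ (1 - r) * L ^ (1 - r) := ENNReal.mul_rpow_of_nonneg _ _ hr1
    _ ≤ (c1 * (2 * c0 ^ α)) ^ (1 - r) * (p2 α * 8 * K1 ^ r * D) :=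
        mul_le_mul_right (absorb e.r1 hLt hLL) _
    _ = _ := by ring

lemma iSup_mul_mono {f g : ℕ → ℝ≥0∞} (hf : Monotone f) (hg : Monotone g) :
    (⨆ n, f n) * (⨆ n, g n) = ⨆ n, f n * g n := by
  apply le_antisymm
  · rw [ENNReal.iSup_mul]
    refine iSup_le fun i => ?_
    rw [ENNReal.mul_iSup]
    exact iSup_le fun j => le_iSup_of_le (max i j)
      (mul_le_mul' (hf (le_max_left _ _)) (hg (le_max_right _ _)))
  · exact iSup_le fun n => mul_le_mul' (le_iSup f n) (le_iSup g n)

lemma rpow_iSup {ι : Sort*} (f : ι → ℝ≥0∞) {a : ℝ} (ha : 0 < a) : (⨆ n, f n) ^ a = ⨆ n, f n ^ a :=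
  (ENNReal.orderIsoRpow a ha).map_iSup f

lemma lintegral_iSup_restrict (μ : Measure ℝ) {A : ℕ → Set ℝ} (hA : ∀ n, MeasurableSet (A n))
    (hA1 : Monotone A) (hA2 : ⋃ n, A n = univ) {F : ℕ → ℝ → ℝ≥0∞} (hF : ∀ n, Measurable (F n))
    (hF1 : Monotone F) :
    ∫⁻ x, ⨆ n, F n x ∂μ = ⨆ n, ∫⁻ x, F n x ∂(μ.restrict (A n)) := by
  simp_rw [← lintegral_indicator (hA _)]
  rw [← lintegral_iSup (fun n => (hF n).indicator (hA n))]
  · refine lintegral_congr fun x => ?_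
    apply le_antisymm
    · refine iSup_le fun n => ?_
      have : x ∈ ⋃ n, A n := hA2 ▸ mem_univ x
      obtain ⟨m, hm⟩ := mem_iUnion.1 this
      refine le_iSup_of_le (max n m) ?_
      rw [indicator_of_mem (hA1 (le_max_right n m) hm)]
      exact hF1 (le_max_left n m) x
    · exact iSup_mono fun n => indicator_le_self _ _ _
  · intro m n hmn x
    show (A m).indicator (F m) x ≤ (A n).indicator (F n) x
    by_cases hx : x ∈ A m
    · rw [indicator_of_mem hx, indicator_of_mem (hA1 hmn hx)]
      exact hF1 hmn x
    · rw [indicator_of_notMem hx]; exact zero_le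

lemma measurable_Ioo_left (μ : Measure ℝ) (x : ℝ) : Measurable fun t => μ (Ioo t x) :=
  Antitone.measurable fun _ _ h => measure_mono (Ioo_subset_Ioo_left h)

lemma measurable_Ioo_right (μ : Measure ℝ) (x : ℝ) : Measurable fun t => μ (Ioo x t) :=
  Monotone.measurable fun _ _ h => measure_mono (Ioo_subset_Ioo_right h)

section Exhaust
variable (μ ν : Measure ℝ) [SigmaFinite μ] [SigmaFinite ν]

/-- Restriction to an exhausting sequence of sets of finite measure. -/
def exh (n : ℕ) : Measure ℝ := μ.restrict (spanningSets μ n)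

instance (n : ℕ) : IsFiniteMeasure (exh μ n) :=
  ⟨by rw [exh, Measure.restrict_apply_univ]; exact measure_spanningSets_lt_top μ n⟩

instance [NullSingletonClass μ] (n : ℕ) : NullSingletonClass (exh μ n) := by
  unfold exh; infer_instance

lemma exh_le (n : ℕ) : exh μ n ≤ μ := Measure.restrict_le_self

lemma exh_mono : Monotone (exh μ) := fun _ _ h =>
  Measure.restrict_mono (monotone_spanningSets μ h) le_rfl

lemma exh_iSup (s : Set ℝ) : ⨆ n, exh μ n s = μ s := Measure.iSup_restrict_spanningSets s

lemma lintegral_exh {F : ℕ → ℝ → ℝ≥0∞} (hF : ∀ n, Measurable (F n)) (hF1 : Monotone F) :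
    ∫⁻ x, ⨆ n, F n x ∂μ = ⨆ n, ∫⁻ x, F n x ∂(exh μ n) :=
  lintegral_iSup_restrict μ (measurableSet_spanningSets μ) (monotone_spanningSets μ)
    (iUnion_spanningSets μ) hF hF1

lemma setLIntegral_exh {S : Set ℝ} {F : ℕ → ℝ → ℝ≥0∞}
    (hF : ∀ n, Measurable (F n)) (hF1 : Monotone F) :
    ∫⁻ x in S, ⨆ n, F n x ∂μ = ⨆ n, ∫⁻ x in S, F n x ∂(exh μ n) := by
  rw [lintegral_iSup_restrict (μ.restrict S) (measurableSet_spanningSets μ)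
    (monotone_spanningSets μ) (iUnion_spanningSets μ) hF hF1]
  congr 1; ext n
  rw [Measure.restrict_comm (measurableSet_spanningSets μ n), exh]

variable {V : ℝ → ℝ≥0∞} (hV : Monotone V)

/-- Truncations of `V`. -/
def trV (V : ℝ → ℝ≥0∞) (n : ℕ) (t : ℝ) : ℝ≥0∞ := min (V t) n

lemma trV_le (V : ℝ → ℝ≥0∞) (n : ℕ) (t : ℝ) : trV V n t ≤ V t := min_le_left _ _

include hV in
lemma trV_mono_right (n : ℕ) : Monotone (trV V n) := fun _ _ h => min_le_min_right _ (hV h)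

lemma trV_mono (V : ℝ → ℝ≥0∞) (t : ℝ) : Monotone fun n => trV V n t := fun _ _ h =>
  min_le_min_left _ (by exact_mod_cast h)

lemma trV_iSup (V : ℝ → ℝ≥0∞) (t : ℝ) : ⨆ n, trV V n t = V t := by
  simp only [trV]
  have := inf_iSup_eq (V t) (fun n : ℕ => (n : ℝ≥0∞))
  rw [ENNReal.iSup_natCast, inf_top_eq] at this
  exact this.symm

lemma Bf_mono_exh {β : ℝ} (hβ : 0 < β) (x : ℝ) :
    Monotone fun n => Bf (exh μ n) (trV V n) β x := by
  intro m n h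
  refine lintegral_mono' (Measure.restrict_mono subset_rfl (exh_mono μ h)) fun t => ?_
  exact mul_le_mul' (ENNReal.rpow_le_rpow (exh_mono μ h _) hβ.le)
    (ENNReal.rpow_le_rpow (trV_mono V t h) hβ.le)

include hV in
lemma Bf_exh {β : ℝ} (hβ : 0 < β) (x : ℝ) :
    Bf μ V β x = ⨆ n, Bf (exh μ n) (trV V n) β x := by
  unfold Bf
  rw [← setLIntegral_exh μ]
  · refine lintegral_congr fun t => ?_
    rw [← iSup_mul_mono, ← rpow_iSup _ hβ, ← rpow_iSup _ hβ, exh_iSup, trV_iSup]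
    · exact fun m n h => ENNReal.rpow_le_rpow (exh_mono μ h _) hβ.le
    · exact fun m n h => ENNReal.rpow_le_rpow (trV_mono V t h) hβ.le
  · exact fun n => ((measurable_Ioo_left _ x).pow_const _).mul
      ((trV_mono_right hV n).measurable.pow_const _)
  · intro m n h t
    exact mul_le_mul' (ENNReal.rpow_le_rpow (exh_mono μ h _) hβ.le)
      (ENNReal.rpow_le_rpow (trV_mono V t h) hβ.le)

include hV in
lemma E5f_exh {α β γ : ℝ} (hα : 0 < α) (hβ : 0 < β) (hγ : 0 < γ) :
    E5f μ ν V α β γ = ⨆ n, E5f (exh μ n) (exh ν n) (trV V n) α β γ := by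
  unfold E5f
  rw [← lintegral_exh ν]
  · refine lintegral_congr fun x => ?_
    rw [← iSup_mul_mono, ← rpow_iSup _ hα, ← rpow_iSup _ hγ, exh_iSup, ← Bf_exh μ hV hβ]
    · exact fun m n h => ENNReal.rpow_le_rpow (exh_mono ν h _) hα.le
    · exact fun m n h => ENNReal.rpow_le_rpow (Bf_mono_exh μ hβ x h) hγ.le
  · exact fun n => ((measurable_tail _).pow_const _).mul
      ((Bf_mono _ _ hβ.le).measurable.pow_const _)
  · intro m n h x
    exact mul_le_mul' (ENNReal.rpow_le_rpow (exh_mono ν h _) hα.le)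
      (ENNReal.rpow_le_rpow (Bf_mono_exh μ hβ x h) hγ.le)

lemma Thf_mono {μ μ' ν ν' : Measure ℝ} (h1 : μ ≤ μ') (h2 : ν ≤ ν') {ρ : ℝ} (hρ : 0 ≤ ρ) (x : ℝ) :
    Thf μ ν ρ x ≤ Thf μ' ν' ρ x :=
  lintegral_mono' (Measure.restrict_mono subset_rfl h2) fun _ => ENNReal.rpow_le_rpow (h1 _) hρ

lemma Thf_exh {ρ : ℝ} (hρ : 0 < ρ) (x : ℝ) :
    Thf μ ν ρ x = ⨆ n, Thf (exh μ n) (exh ν n) ρ x := by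
  unfold Thf
  rw [← setLIntegral_exh ν]
  · refine lintegral_congr fun t => ?_
    rw [← rpow_iSup _ hρ, exh_iSup]
  · exact fun n => (measurable_Ioo_right _ x).pow_const _
  · exact fun m n h t => ENNReal.rpow_le_rpow (exh_mono μ h _) hρ.le

lemma sup_mono_exh {α ρ : ℝ} (hα : 0 < α) (hρ : 0 < ρ) (x : ℝ) :
    Monotone fun n => ⨆ t : Iio x, exh μ n (Ioo t.1 x) ^ ρ * trV V n t ^ α := by
  intro m n h
  refine iSup_mono fun t => ?_
  exact mul_le_mul' (ENNReal.rpow_le_rpow (exh_mono μ h _) hρ.le)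
      (ENNReal.rpow_le_rpow (trV_mono V t h) hα.le)

lemma measurable_sup (μ : Measure ℝ) (V : ℝ → ℝ≥0∞) (α : ℝ) {ρ : ℝ} (hρ : 0 ≤ ρ) :
    Measurable fun x => ⨆ t : Iio x, μ (Ioo t.1 x) ^ ρ * V t ^ α := by
  refine Monotone.measurable fun x y h => iSup_le fun t => ?_
  refine le_trans ?_ (le_iSup _ ⟨t.1, lt_of_lt_of_le t.2 h⟩)
  exact mul_le_mul_left (ENNReal.rpow_le_rpow (measure_mono (Ioo_subset_Ioo_right h)) hρ) _

lemma E3s_exh {α ρ : ℝ} (hα : 0 < α) (hρ : 0 < ρ) :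
    E3s μ ν V α ρ = ⨆ n, E3s (exh μ n) (exh ν n) (trV V n) α ρ := by
  unfold E3s
  rw [← lintegral_exh ν]
  · refine lintegral_congr fun x => ?_
    rw [← iSup_mul_mono, ← rpow_iSup _ hα, ← Thf_exh μ ν hρ, iSup_comm]
    · congr 2; ext t
      rw [← iSup_mul_mono, ← rpow_iSup _ hα, ← rpow_iSup _ hρ, exh_iSup, trV_iSup]
      · exact fun m n h => ENNReal.rpow_le_rpow (exh_mono μ h _) hρ.le
      · exact fun m n h => ENNReal.rpow_le_rpow (trV_mono V t h) hα.le
    · exact fun m n h => ENNReal.rpow_le_rpow (Thf_mono (exh_mono μ h) (exh_mono ν h) hρ.le x) hα.le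
    · exact sup_mono_exh μ hα hρ x
  · exact fun n => ((Thf_anti _ _ hρ.le).measurable.pow_const _).mul (measurable_sup _ _ _ hρ.le)
  · intro m n h x
    exact mul_le_mul' (ENNReal.rpow_le_rpow (Thf_mono (exh_mono μ h) (exh_mono ν h) hρ.le x) hα.le)
      (sup_mono_exh μ hα hρ x h)

include hV in
lemma Jf_exh {q ρ : ℝ} (hρ : 0 < ρ) (h : ℤ → ℝ≥0∞) :
    Jf μ ν V q ρ h = ⨆ n, Jf (exh μ n) (exh ν n) V q ρ h := by
  have hm := (measurable_Hf hV h).pow_const q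
  have hmono : ∀ x, Monotone fun n => ∫⁻ t in Iio x, Hf V h t ^ q ∂(exh μ n) := fun x m n hmn =>
    lintegral_mono' (Measure.restrict_mono subset_rfl (exh_mono μ hmn)) le_rfl
  unfold Jf
  rw [← lintegral_exh ν]
  · refine lintegral_congr fun x => ?_
    rw [← rpow_iSup _ hρ, ← setLIntegral_exh μ (fun _ => hm) fun _ _ _ => le_rfl]
    simp
  · exact fun n => (Monotone.measurable fun x y hxy =>
      lintegral_mono_set (Iio_subset_Iio hxy)).pow_const _
  · exact fun m n hmn x => ENNReal.rpow_le_rpow (hmono x hmn) hρ.le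

end Exhaust

lemma Jf_le {μ μ' ν ν' : Measure ℝ} (h1 : μ ≤ μ') (h2 : ν ≤ ν') {V V' : ℝ → ℝ≥0∞}
    (h3 : ∀ t, V t ≤ V' t) {q ρ : ℝ} (hq : 0 ≤ q) (hρ : 0 ≤ ρ) (h : ℤ → ℝ≥0∞) :
    Jf μ ν V q ρ h ≤ Jf μ' ν' V' q ρ h := by
  refine lintegral_mono' h2 fun x => ENNReal.rpow_le_rpow ?_ hρ
  refine lintegral_mono' (Measure.restrict_mono subset_rfl h1) fun t => ENNReal.rpow_le_rpow ?_ hq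
  refine ENNReal.tsum_le_tsum fun k => ?_
  by_cases hk : p2 k < V t
  · simp [hk, hk.trans_le (h3 t)]
  · simp [hk]

lemma upper_sigma {q r α β ρ γ : ℝ} (e : Exps q r α β ρ γ) : ∃ c : ℝ≥0∞, c ≠ ⊤ ∧
    ∀ (μ ν : Measure ℝ) [SigmaFinite μ] [SigmaFinite ν] [NullSingletonClass μ]
      [NullSingletonClass ν] (V : ℝ → ℝ≥0∞), Monotone V → ∀ h : ℤ → ℝ≥0∞,
    Jf μ ν V q ρ h ≤ c * (E3f μ ν V α ρ + E5f μ ν V α β γ) ^ (1 - r) *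
      (∑' k : ℤ, h k * p2 (-k)) ^ r := by
  obtain ⟨c, hc, H⟩ := core_upper e
  have hr1 : 0 ≤ 1 - r := by have := e.r1; linarith
  refine ⟨c, hc, ?_⟩
  intro μ ν _ _ _ _ V hV h
  rw [Jf_exh μ ν hV e.ρ0]
  refine iSup_le fun n => ?_
  refine (H (exh μ n) (exh ν n) V hV h).trans ?_
  refine mul_le_mul_left (mul_le_mul_right (ENNReal.rpow_le_rpow (add_le_add ?_ ?_) hr1) _) _
  · refine lintegral_mono' (exh_le ν n) fun x => mul_le_mul' (ENNReal.rpow_le_rpow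
      (Thf_mono (exh_le μ n) (exh_le ν n) e.ρ0.le x) e.α0.le) ?_
    refine (essSup_mono_measure' (Measure.restrict_mono subset_rfl (exh_le μ n))).trans ?_
    exact essSup_mono_ae (Filter.Eventually.of_forall fun t => mul_le_mul_left
      (ENNReal.rpow_le_rpow (exh_le μ n _) e.ρ0.le) _)
  · refine lintegral_mono' (exh_le ν n) fun x => mul_le_mul' (ENNReal.rpow_le_rpow
      (exh_le ν n _) e.α0.le) (ENNReal.rpow_le_rpow ?_ e.γ0.le)
    exact lintegral_mono' (Measure.restrict_mono subset_rfl (exh_le μ n)) fun t =>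
      mul_le_mul_left (ENNReal.rpow_le_rpow (exh_le μ n _) e.β0.le) _

lemma lower_sigma {q r α β ρ γ : ℝ} (e : Exps q r α β ρ γ) : ∃ c : ℝ≥0∞, c ≠ ⊤ ∧
    ∀ (μ ν : Measure ℝ) [SigmaFinite μ] [SigmaFinite ν] [NullSingletonClass μ]
      [NullSingletonClass ν] (V : ℝ → ℝ≥0∞), Monotone V →
      ∀ D : ℝ≥0∞, (∀ h : ℤ → ℝ≥0∞, Jf μ ν V q ρ h ≤ D * (∑' k : ℤ, h k * p2 (-k)) ^ r) →
      (E3s μ ν V α ρ) ^ (1 - r) ≤ c * D ∧ (E5f μ ν V α β γ) ^ (1 - r) ≤ c * D := by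
  obtain ⟨c3, hc3, H3⟩ := lower_E3 e
  obtain ⟨c5, hc5, H5⟩ := lower_E5 e
  have hr1 : 0 < 1 - r := by have := e.r1; linarith
  refine ⟨c3 + c5, ENNReal.add_ne_top.2 ⟨hc3, hc5⟩, ?_⟩
  intro μ ν _ _ _ _ V hV D hD
  have hD' : ∀ n, ∀ h : ℤ → ℝ≥0∞, Jf (exh μ n) (exh ν n) (trV V n) q ρ h ≤
      D * (∑' k : ℤ, h k * p2 (-k)) ^ r := fun n h =>
    (Jf_le (exh_le μ n) (exh_le ν n) (trV_le V n) e.q0.le e.ρ0.le h).trans (hD h)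
  rw [E3s_exh μ ν e.α0 e.ρ0, E5f_exh μ ν hV e.α0 e.β0 e.γ0, rpow_iSup _ hr1, rpow_iSup _ hr1]
  have hn : ∀ n : ℕ, (n : ℝ≥0∞) ≠ ⊤ := ENNReal.natCast_ne_top
  refine ⟨iSup_le fun n => ?_, iSup_le fun n => ?_⟩
  · refine (H3 (exh μ n) (exh ν n) (trV V n) (trV_mono_right hV n) n (hn n)
      (fun _ => min_le_right _ _) D (hD' n)).trans (mul_le_mul_left le_self_add _)
  · refine (H5 (exh μ n) (exh ν n) (trV V n) (trV_mono_right hV n) n (hn n)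
      (fun _ => min_le_right _ _) D (hD' n)).trans (mul_le_mul_left le_add_self _)

/-- The set function underlying `Vp`. -/
def Nv (p : ℝ) (v : ℝ → ℝ≥0∞) (S : Set ℝ) : ℝ≥0∞ :=
  if p = 1 then essSup (fun s => (v s)⁻¹) (volume.restrict S)
  else (∫⁻ s in S, v s ^ (-(1 / (p - 1)))) ^ ((p - 1) / p)

lemma Vp_eq (p : ℝ) (v : ℝ → ℝ≥0∞) (x y : EReal) : Vp p v x y = Nv p v (io x y) := rfl

lemma lt_essSup_iff (μ : Measure ℝ) (f : ℝ → ℝ≥0∞) (l : ℝ≥0∞) :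
    l < essSup f μ ↔ 0 < μ {x | l < f x} := by
  rw [← not_le, pos_iff_ne_zero, not_iff_not]
  constructor
  · intro h
    have : ∀ᵐ x ∂μ, ¬ l < f x := (ENNReal.ae_le_essSup f).mono fun x hx => not_lt.2 (hx.trans h)
    simpa [ae_iff] using this
  · intro h
    refine essSup_le_of_ae_le _ ?_
    have : ∀ᵐ x ∂μ, ¬ l < f x := by simpa [ae_iff] using h
    exact this.mono fun x hx => not_lt.1 hx

lemma measurableSet_lt_inv {v : ℝ → ℝ≥0∞} (hv : Measurable v) (l : ℝ≥0∞) :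
    MeasurableSet {x | l < (v x)⁻¹} := measurableSet_lt measurable_const hv.inv

lemma Nv_char {p : ℝ} (hp : 1 ≤ p) {v : ℝ → ℝ≥0∞} (hv : Measurable v) (l : ℝ≥0∞) :
    ∃ (m : Measure ℝ) (c : ℝ≥0∞), NullSingletonClass m ∧
      ∀ S, MeasurableSet S → (l < Nv p v S ↔ c < m S) := by
  by_cases h : p = 1
  · refine ⟨volume.restrict {x | l < (v x)⁻¹}, 0, inferInstance, fun S hS => ?_⟩
    rw [Nv, if_pos h, lt_essSup_iff, Measure.restrict_apply hS,
      Measure.restrict_apply (measurableSet_lt_inv hv l), inter_comm]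
  · have hp1 : 0 < p - 1 := by
      have := lt_of_le_of_ne hp (Ne.symm h); linarith
    have hp0 : 0 < p := by linarith
    have he : 0 < (p - 1) / p := by positivity
    have he' : (p - 1) / p * (p / (p - 1)) = 1 := by field_simp
    refine ⟨volume.withDensity fun s => v s ^ (-(1 / (p - 1))), l ^ (p / (p - 1)), inferInstance,
      fun S hS => ?_⟩
    rw [Nv, if_neg h, withDensity_apply _ hS]
    have h2 : 0 < p / (p - 1) := by positivity
    rw [← ENNReal.rpow_lt_rpow_iff h2, rpow_cancel _ he']

lemma Nv_mono {p : ℝ} (hp : 1 ≤ p) {v : ℝ → ℝ≥0∞} (hv : Measurable v) {S T : Set ℝ}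
    (hS : MeasurableSet S) (hT : MeasurableSet T) (h : S ⊆ T) : Nv p v S ≤ Nv p v T := by
  by_contra! hlt
  obtain ⟨m, c, -, H⟩ := Nv_char hp hv (Nv p v T)
  have := ((H S hS).1 hlt).trans_le (measure_mono h)
  exact lt_irrefl _ ((H T hT).2 this)

lemma Nv_iUnion {p : ℝ} (hp : 1 ≤ p) {v : ℝ → ℝ≥0∞} (hv : Measurable v) {S : ℕ → Set ℝ}
    (hS : ∀ n, MeasurableSet (S n)) (hmono : Monotone S) {l : ℝ≥0∞} (h : l < Nv p v (⋃ n, S n)) :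
    ∃ n, l < Nv p v (S n) := by
  obtain ⟨m, c, -, H⟩ := Nv_char hp hv l
  rw [H _ (MeasurableSet.iUnion hS), hmono.measure_iUnion, lt_iSup_iff] at h
  obtain ⟨n, hn⟩ := h
  exact ⟨n, (H _ (hS n)).2 hn⟩

lemma measurableSet_io (a b : EReal) : MeasurableSet (io a b) := by
  apply MeasurableSet.inter
  · exact measurableSet_lt measurable_const measurable_coe_real_ereal
  · exact measurableSet_lt measurable_coe_real_ereal measurable_const

lemma io_subset (a : EReal) {b c : EReal} (h : b ≤ c) : io a b ⊆ io a c :=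
  fun _ hx => ⟨hx.1, hx.2.trans_le h⟩

lemma Nv_le_of_tails {p : ℝ} (hp : 1 ≤ p) {v : ℝ → ℝ≥0∞} (hv : Measurable v) {a b : EReal}
    {S : Set ℝ} (hS : MeasurableSet S) (hSb : S ⊆ io a b) {l : ℝ≥0∞}
    (h : ∀ s ∈ S, Nv p v (io a s) ≤ l) : Nv p v S ≤ l := by
  by_contra! hlt
  obtain ⟨m, c, hm, H⟩ := Nv_char hp hv l
  rw [H S hS] at hlt
  refine absurd hlt (not_lt.2 ?_)
  have : (m.restrict S) S ≤ c := by
    refine measure_le_of_tails_left _ fun s hs => ?_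
    rw [Measure.restrict_apply measurableSet_Iic]
    have h1 : m (Iic s ∩ S) ≤ m (io a s) := by
      have hsub : Iic s ∩ S ⊆ io a s ∪ {s} := by
        rintro x ⟨hx1, hx2⟩
        rcases eq_or_lt_of_le (mem_Iic.1 hx1) with h | h
        · right; exact h
        · left; exact ⟨(hSb hx2).1, by exact_mod_cast h⟩
      refine (measure_mono hsub).trans ((measure_union_le _ _).trans ?_)
      rw [measure_singleton, add_zero]
    refine h1.trans (not_lt.1 fun h2 => ?_)
    exact absurd ((H _ (measurableSet_io _ _)).2 h2) (not_lt.2 (h s hs))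
  simpa using this

lemma lintegral_le_Nv {p : ℝ} (hp : 1 ≤ p) {v : ℝ → ℝ≥0∞} (hv : Measurable v) {S : Set ℝ}
    (hS : MeasurableSet S) (hvS : ∀ s ∈ S, 0 < v s ∧ v s < ⊤) {f : ℝ → ℝ≥0∞} (hf : Measurable f) :
    ∫⁻ s in S, f s ≤ Nv p v S * (∫⁻ s in S, f s ^ p * v s) ^ (1 / p) := by
  by_cases h : p = 1
  · subst h
    have h1 : ∀ᵐ s ∂(volume.restrict S), f s ≤ Nv 1 v S * (f s ^ (1 : ℝ) * v s) := by
      filter_upwards [ENNReal.ae_le_essSup (μ := volume.restrict S) (fun s => (v s)⁻¹),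
        ae_restrict_mem hS] with s hs hsS
      obtain ⟨hv0, hv1⟩ := hvS s hsS
      rw [Nv, if_pos rfl, ENNReal.rpow_one]
      calc f s = (v s)⁻¹ * (f s * v s) := by
            rw [mul_comm (f s), ← mul_assoc, ENNReal.inv_mul_cancel hv0.ne' hv1.ne, one_mul]
        _ ≤ _ := mul_le_mul_left hs _
    refine (lintegral_mono_ae h1).trans ?_
    rw [lintegral_const_mul _ (by fun_prop)]
    simp
  · have hp1 : 0 < p - 1 := by
      have := lt_of_le_of_ne hp (Ne.symm h); linarith
    have hp0 : 0 < p := by linarith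
    have hc : p.HolderConjugate (p / (p - 1)) := by
      rw [Real.holderConjugate_iff]; exact ⟨by linarith, by field_simp; ring⟩
    have H := ENNReal.lintegral_mul_le_Lp_mul_Lq (volume.restrict S) hc
      (f := fun s => f s * v s ^ (1 / p)) (g := fun s => v s ^ (-(1 / p)))
      (hf.mul (hv.pow_const _)).aemeasurable (hv.pow_const _).aemeasurable
    have e1 : ∫⁻ s in S, f s = ∫⁻ s in S,
        ((fun s => f s * v s ^ (1 / p)) * fun s => v s ^ (-(1 / p))) s := by
      refine setLIntegral_congr_fun hS fun s hs => ?_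
      obtain ⟨hv0, hv1⟩ := hvS s hs
      simp only [Pi.mul_apply]
      rw [mul_assoc, ← ENNReal.rpow_add _ _ hv0.ne' hv1.ne]
      simp
    rw [e1]
    refine H.trans (le_of_eq ?_)
    rw [mul_comm, Nv, if_neg h]
    congr 1
    · congr 1
      · refine lintegral_congr fun s => ?_
        rw [← ENNReal.rpow_mul]; congr 1; field_simp
      · field_simp
    · congr 1
      refine lintegral_congr fun s => ?_
      rw [ENNReal.mul_rpow_of_nonneg _ _ hp0.le, rpow_cancel _ (by field_simp)]

lemma exists_test {p : ℝ} (hp : 1 ≤ p) {v : ℝ → ℝ≥0∞} (hv : Measurable v) {S : Set ℝ}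
    (hS : MeasurableSet S) (hvS : ∀ s ∈ S, 0 < v s ∧ v s < ⊤) {l : ℝ≥0∞} (hl : l < Nv p v S) :
    ∃ f : ℝ → ℝ≥0∞, Measurable f ∧ ∫⁻ s, f s ^ p * v s ≤ 1 ∧ l ≤ ∫⁻ s in S, f s := by
  by_cases h : p = 1
  · subst h
    rw [Nv, if_pos rfl, lt_essSup_iff, Measure.restrict_apply
      (measurableSet_lt_inv hv l)] at hl
    obtain ⟨T, hT, hTS, hT0, hT1⟩ := Measure.exists_subset_measure_lt_top
      ((measurableSet_lt_inv hv l).inter hS) hl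
    refine ⟨T.indicator fun s => (volume T)⁻¹ * (v s)⁻¹, (measurable_const.mul hv.inv).indicator hT,
      ?_, ?_⟩
    · have : ∀ s, T.indicator (fun s => (volume T)⁻¹ * (v s)⁻¹) s ^ (1 : ℝ) * v s
          = T.indicator (fun _ => (volume T)⁻¹) s := by
        intro s
        by_cases hs : s ∈ T
        · obtain ⟨hv0, hv1⟩ := hvS s (hTS hs).2
          rw [ENNReal.rpow_one, indicator_of_mem hs, indicator_of_mem hs, mul_assoc,
            ENNReal.inv_mul_cancel hv0.ne' hv1.ne, mul_one]
        · simp [hs]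
      simp_rw [this]
      rw [lintegral_indicator hT, setLIntegral_const, ENNReal.inv_mul_cancel hT0.ne' hT1.ne]
    · rw [lintegral_indicator hT, Measure.restrict_restrict hT,
        inter_eq_left.2 fun s hs => (hTS hs).2]
      calc l = ∫⁻ s in T, (volume T)⁻¹ * l := by
            rw [setLIntegral_const, mul_right_comm, ENNReal.inv_mul_cancel hT0.ne' hT1.ne, one_mul]
        _ ≤ _ := setLIntegral_mono' hT fun s hs => mul_le_mul_right (hTS hs).1.le _
  · have hp1 : 0 < p - 1 := by
      have := lt_of_le_of_ne hp (Ne.symm h); linarith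
    have hp0 : 0 < p := by linarith
    set σ : ℝ → ℝ≥0∞ := fun s => v s ^ (-(1 / (p - 1))) with hσ
    have hσm : Measurable σ := hv.pow_const _
    have he : 0 < (p - 1) / p := by positivity
    have hσt : ∀ s ∈ S, σ s ≠ ⊤ := fun s hs =>
      ENNReal.rpow_ne_top_of_ne_zero (hvS s hs).1.ne' (hvS s hs).2.ne
    have : SigmaFinite ((volume.restrict S).withDensity σ) :=
      SigmaFinite.withDensity_of_ne_top ((ae_restrict_mem hS).mono hσt)
    have e' : (p - 1) / p * (p / (p - 1)) = 1 := by field_simp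
    have e'' : p / (p - 1) * ((p - 1) / p) = 1 := by field_simp
    have hl' : l ^ (p / (p - 1)) < ((volume.restrict S).withDensity σ) S := by
      rw [Nv, if_neg h, ← ENNReal.rpow_lt_rpow_iff (z := p / (p - 1)) (by positivity),
        rpow_cancel _ e'] at hl
      rw [withDensity_apply _ hS, Measure.restrict_restrict hS, inter_self]
      exact hl
    obtain ⟨T, hT, hTS, hT0, hT1⟩ := Measure.exists_subset_measure_lt_top hS hl'
    rw [withDensity_apply _ hT, Measure.restrict_restrict hT, inter_eq_left.2 hTS] at hT0 hT1
    set M := ∫⁻ s in T, σ s with hM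
    have hM0 : M ≠ 0 := (zero_le.trans_lt hT0).ne'
    refine ⟨T.indicator fun s => M ^ (-(1 / p)) * σ s, (measurable_const.mul hσm).indicator hT,
      ?_, ?_⟩
    · have : ∀ s, T.indicator (fun s => M ^ (-(1 / p)) * σ s) s ^ p * v s
          = T.indicator (fun s => M⁻¹ * σ s) s := by
        intro s
        by_cases hs : s ∈ T
        · obtain ⟨hv0, hv1⟩ := hvS s (hTS hs)
          rw [indicator_of_mem hs, indicator_of_mem hs, ENNReal.mul_rpow_of_nonneg _ _ hp0.le,
            ← ENNReal.rpow_mul, mul_assoc]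
          congr 1
          · rw [← ENNReal.rpow_neg_one]; congr 1; field_simp
          · simp only [hσ]
            rw [← ENNReal.rpow_mul]
            nth_rewrite 2 [← ENNReal.rpow_one (v s)]
            rw [← ENNReal.rpow_add _ _ hv0.ne' hv1.ne]
            congr 1; field_simp; ring
        · simp [hs, hp0]
      simp_rw [this]
      rw [lintegral_indicator hT, lintegral_const_mul _ hσm, ENNReal.inv_mul_cancel hM0 hT1.ne]
    · rw [lintegral_indicator hT, Measure.restrict_restrict hT, inter_eq_left.2 hTS,
        lintegral_const_mul _ hσm, ← hM]
      nth_rewrite 2 [← ENNReal.rpow_one M]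
      rw [← ENNReal.rpow_add _ _ hM0 hT1.ne]
      have : -(1 / p) + 1 = (p - 1) / p := by field_simp; ring
      rw [this, ← rpow_cancel l e'']
      exact ENNReal.rpow_le_rpow hT0.le he.le

/-- The `p`-th power of `V_p(a, ·)`, extended monotonically to the whole line. -/
def Vf (p : ℝ) (v : ℝ → ℝ≥0∞) (a b : EReal) (t : ℝ) : ℝ≥0∞ := Nv p v (io a (min (t : EReal) b)) ^ p

lemma Vf_mono {p : ℝ} (hp : 1 ≤ p) {v : ℝ → ℝ≥0∞} (hv : Measurable v) (a b : EReal) :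
    Monotone (Vf p v a b) := fun s t hst =>
  ENNReal.rpow_le_rpow (Nv_mono hp hv (measurableSet_io _ _) (measurableSet_io _ _)
    (io_subset a (min_le_min_right b (by exact_mod_cast hst)))) (by linarith)

lemma Vf_eq {p : ℝ} {v : ℝ → ℝ≥0∞} {a b : EReal} {t : ℝ} (ht : t ∈ io a b) :
    Vf p v a b t = Vp p v a t ^ p := by
  rw [Vf, min_eq_left ht.2.le, Vp_eq]

lemma Vf_left {p : ℝ} (hp : 1 ≤ p) {v : ℝ → ℝ≥0∞} (hv : Measurable v) (a b : EReal) {l : ℝ≥0∞}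
    {t : ℝ} (h : l < Vf p v a b t) : ∃ t' < t, l < Vf p v a b t' := by
  have hp0 : 0 < p := by linarith
  have e1 : 1 / p * p = 1 := by field_simp
  rw [Vf, ← rpow_cancel l e1, ENNReal.rpow_lt_rpow_iff hp0] at h
  have hU : io a (min (t : EReal) b)
      = ⋃ n : ℕ, io a (min ((t - 1 / ((n : ℝ) + 1) : ℝ) : EReal) b) := by
    ext s
    simp only [mem_iUnion, io, mem_ofPred_eq, lt_min_iff]
    constructor
    · rintro ⟨h1, h2, h3⟩
      have h2' : s < t := by exact_mod_cast h2
      obtain ⟨n, hn⟩ := exists_nat_one_div_lt (sub_pos.2 h2')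
      refine ⟨n, h1, ?_, h3⟩
      have : s < t - 1 / ((n : ℝ) + 1) := by linarith
      exact_mod_cast this
    · rintro ⟨n, h1, h2, h3⟩
      have h2' : s < t - 1 / ((n : ℝ) + 1) := by exact_mod_cast h2
      have h0 : 0 < 1 / ((n : ℝ) + 1) := by positivity
      have : s < t := by linarith
      exact ⟨h1, by exact_mod_cast this, h3⟩
  rw [hU] at h
  obtain ⟨n, hn⟩ := Nv_iUnion hp hv (fun n => measurableSet_io _ _) (by
    intro m n hmn
    refine io_subset a (min_le_min_right b ?_)
    have : t - 1 / ((m : ℝ) + 1) ≤ t - 1 / ((n : ℝ) + 1) := by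
      have := Nat.one_div_le_one_div (α := ℝ) hmn
      linarith
    exact_mod_cast this) h
  refine ⟨t - 1 / ((n : ℝ) + 1), ?_, ?_⟩
  · have h0 : 0 < 1 / ((n : ℝ) + 1) := by positivity
    linarith
  · rw [Vf, ← rpow_cancel l e1, ENNReal.rpow_lt_rpow_iff hp0]
    exact hn

lemma exists_levels {p : ℝ} (hp : 1 ≤ p) : ∃ c : ℝ≥0∞, c ≠ ⊤ ∧ ∀ (a b : EReal) (v : ℝ → ℝ≥0∞),
    IsWeight a b v → (∀ t ∈ io a b, Vf p v a b t ≠ ⊤) → ∀ f : ℝ → ℝ≥0∞, Measurable f →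
    ∃ h : ℤ → ℝ≥0∞, (∀ t ∈ io a b, (∫⁻ s in io a t, f s) ^ p ≤ Hf (Vf p v a b) h t) ∧
      ∑' k : ℤ, h k * p2 (-k) ≤ c * ∫⁻ x in io a b, f x ^ p * v x := by
  have hp0 : 0 < p := by linarith
  have e1 : 1 / p * p = 1 := by field_simp
  have e2 : p * (1 / p) = 1 := by field_simp
  obtain ⟨c, hc, H⟩ := sum_hardy' hp0
  refine ⟨c * 2, ENNReal.mul_ne_top hc (by simp), ?_⟩
  intro a b v hv hV f hf
  have hmono := Vf_mono hp hv.1 a b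
  set V := Vf p v a b with hVdef
  have hI := measurableSet_io a b
  set D : ℤ → Set ℝ := fun k => io a b ∩ ({s | p2 k < V s} ∩ {s | V s ≤ p2 (k + 1)}) with hD
  have hDm : ∀ k, MeasurableSet (D k) := fun k => hI.inter ((measurableSet_level hmono k).inter
    (measurableSet_le hmono.measurable measurable_const))
  have hpow : ∀ l s, s ∈ io a b → V s ≤ l → Nv p v (io a s) ≤ l ^ (1 / p) := by
    intro l s hs h
    rw [hVdef, Vf, min_eq_left hs.2.le] at h
    rw [← rpow_cancel (Nv p v (io a s)) e2]
    exact ENNReal.rpow_le_rpow h (by positivity)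
  set A : ℤ → ℝ≥0∞ := fun k => ∫⁻ s in D k, f s with hA
  have hAk : ∀ k, A k ^ p ≤ p2 (k + 1) * ∫⁻ s in D k, f s ^ p * v s := by
    intro k
    have h1 := lintegral_le_Nv hp hv.1 (hDm k) (fun s hs => hv.2 s hs.1) hf
    have h2 : Nv p v (D k) ≤ p2 (k + 1) ^ (1 / p) :=
      Nv_le_of_tails hp hv.1 (hDm k) inter_subset_left fun s hs => hpow _ s hs.1 hs.2.2
    calc A k ^ p ≤ (p2 (k + 1) ^ (1 / p) * (∫⁻ s in D k, f s ^ p * v s) ^ (1 / p)) ^ p :=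
          ENNReal.rpow_le_rpow (h1.trans (mul_le_mul_left h2 _)) hp0.le
      _ = _ := by rw [ENNReal.mul_rpow_of_nonneg _ _ hp0.le, rpow_cancel _ e1, rpow_cancel _ e1]
  set Z : Set ℝ := io a b ∩ {s | V s ≤ 0} with hZ
  have hZm : MeasurableSet Z := hI.inter (measurableSet_le hmono.measurable measurable_const)
  have hZ0 : ∫⁻ s in Z, f s = 0 := by
    have h1 := lintegral_le_Nv hp hv.1 hZm (fun s hs => hv.2 s hs.1) hf
    have h2 : Nv p v Z ≤ 0 ^ (1 / p) :=
      Nv_le_of_tails hp hv.1 hZm inter_subset_left fun s hs => hpow _ s hs.1 hs.2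
    rw [ENNReal.zero_rpow_of_pos (by positivity), nonpos_iff_eq_zero] at h2
    rw [h2, zero_mul] at h1
    exact nonpos_iff_eq_zero.1 h1
  refine ⟨fun k => (∑' i : ℤ, if i ≤ k then A i else 0) ^ p, ?_, ?_⟩
  · intro t ht
    have hsub : io a t ⊆ Z ∪ ⋃ i : {i : ℤ // p2 i < V t}, D i := by
      intro s hs
      have hst : s < t := by exact_mod_cast hs.2
      have hsI : s ∈ io a b := ⟨hs.1, hs.2.trans ht.2⟩
      by_cases h0 : V s = 0
      · left; exact ⟨hsI, h0.le⟩
      · right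
        obtain ⟨i, hi1, hi2⟩ := exists_p2_block h0 (hV s hsI)
        rw [mem_iUnion]
        exact ⟨⟨i, hi1.trans_le (hmono hst.le)⟩, hsI, hi1, hi2⟩
    have hF : ∫⁻ s in io a t, f s ≤ ∑' i : {i : ℤ // p2 i < V t}, A i := by
      refine (lintegral_mono_set hsub).trans ((lintegral_union_le _ _ _).trans ?_)
      rw [hZ0, zero_add]
      exact lintegral_iUnion_le _ _
    by_cases h0 : V t = 0
    · have : IsEmpty {i : ℤ // p2 i < V t} := ⟨fun i => by simpa [h0] using i.2⟩
      rw [tsum_empty] at hF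
      rw [nonpos_iff_eq_zero.1 hF, ENNReal.zero_rpow_of_pos hp0]
      exact zero_le
    · obtain ⟨K, hK1, hK2⟩ := exists_p2_block h0 (hV t ht)
      have h3 : ∑' i : {i : ℤ // p2 i < V t}, A i ≤ ∑' i : ℤ, if i ≤ K then A i else 0 := by
        refine (tsum_subtype {i : ℤ | p2 i < V t} A).trans_le ?_
        refine ENNReal.tsum_le_tsum fun i => ?_
        by_cases hi : p2 i < V t
        · have h4 := p2_lt_iff.1 (hi.trans_le hK2)
          have h5 : i ≤ K := by
            have : i < K + 1 := by exact_mod_cast h4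
            omega
          rw [if_pos h5]
          exact indicator_le_self _ _ _
        · rw [indicator_of_notMem (s := {i : ℤ | p2 i < V t}) hi]; exact zero_le
      refine (ENNReal.rpow_le_rpow (hF.trans h3) hp0.le).trans ?_
      unfold Hf
      refine le_trans ?_ (ENNReal.le_tsum K)
      rw [if_pos hK1]
  · simp_rw [mul_comm _ (p2 _)]
    refine (H A).trans ?_
    rw [mul_assoc]
    refine mul_le_mul_right ?_ _
    have hdisj : Pairwise (Function.onFun Disjoint D) := by
      intro i j hij
      refine Set.disjoint_left.2 fun s hi hj => hij ?_
      have h1 := p2_lt_iff.1 (hi.2.1.trans_le hj.2.2)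
      have h2 := p2_lt_iff.1 (hj.2.1.trans_le hi.2.2)
      have h1' : i < j + 1 := by exact_mod_cast h1
      have h2' : j < i + 1 := by exact_mod_cast h2
      omega
    calc ∑' j : ℤ, p2 (-j) * A j ^ p ≤ ∑' j : ℤ, 2 * ∫⁻ s in D j, f s ^ p * v s := by
          refine ENNReal.tsum_le_tsum fun j => (mul_le_mul_right (hAk j) _).trans (le_of_eq ?_)
          rw [p2_add, p2_one, ← mul_assoc, ← mul_assoc, p2_neg_mul, one_mul]
      _ = 2 * ∫⁻ s in ⋃ j, D j, f s ^ p * v s := by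
          rw [ENNReal.tsum_mul_left, lintegral_iUnion hDm hdisj]
      _ ≤ _ := mul_le_mul_right (lintegral_mono_set (iUnion_subset fun j => inter_subset_left)) _

lemma exists_coinitial_seq {E : Set ℝ} (h0 : E.Nonempty) (h : ∀ t ∈ E, ∃ t' < t, t' ∈ E) :
    ∃ u : ℕ → ℝ, Antitone u ∧ (∀ n, u n ∈ E) ∧ ∀ t ∈ E, ∃ n, u n < t := by
  obtain ⟨C, hCE, hC, hcov⟩ := countablyCoinitial_real E
  have hCne : C.Nonempty := by
    obtain ⟨s, hs⟩ := h0
    obtain ⟨c, hc, -⟩ := hcov s hs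
    exact ⟨c, hc⟩
  obtain ⟨g, hg⟩ := hC.exists_eq_range hCne
  refine ⟨fun n => (Finset.range (n + 1)).inf' Finset.nonempty_range_add_one g, ?_, ?_, ?_⟩
  · intro m n hmn
    exact Finset.inf'_mono _ (Finset.range_mono (by omega)) _
  · intro n
    obtain ⟨i, -, hi⟩ := Finset.exists_mem_eq_inf' (s := Finset.range (n + 1)) Finset.nonempty_range_add_one g
    show (Finset.range (n + 1)).inf' Finset.nonempty_range_add_one g ∈ E
    rw [hi]
    exact hCE (hg ▸ mem_range_self i)
  · intro t ht
    obtain ⟨t', ht', htE⟩ := h t ht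
    obtain ⟨c, hc, hct⟩ := hcov t' htE
    rw [hg] at hc
    obtain ⟨n, rfl⟩ := hc
    exact ⟨n, (Finset.inf'_le g (by simp)).trans_lt (hct.trans_lt ht')⟩

lemma exists_test_seq {p : ℝ} (hp : 1 ≤ p) : ∃ c : ℝ≥0∞, c ≠ ⊤ ∧ ∀ (a b : EReal) (v : ℝ → ℝ≥0∞),
    IsWeight a b v → ∀ h : ℤ → ℝ≥0∞, ∃ f G : ℕ → ℝ → ℝ≥0∞,
      (∀ n, Measurable (f n)) ∧ (∀ n, Measurable (G n)) ∧ Monotone G ∧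
      (∀ n, ∫⁻ x in io a b, f n x ^ p * v x ≤ c * ∑' k : ℤ, h k * p2 (-k)) ∧
      (∀ n, ∀ t ∈ io a b, G n t ≤ (∫⁻ s in io a t, f n s) ^ p) ∧
      ∀ t, Hf (Vf p v a b) h t ≤ ⨆ n, G n t := by
  classical
  have hp0 : 0 < p := by linarith
  have e1 : 1 / p * p = 1 := by field_simp
  obtain ⟨c, hc, H⟩ := sum_hardy' one_pos
  refine ⟨c, hc, ?_⟩
  intro a b v hv h
  set V := Vf p v a b with hVdef
  set E : ℤ → Set ℝ := fun k => {t | p2 k < V t} with hE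
  set h' : ℤ → ℝ≥0∞ := fun k => ∑' j : ℤ, if j ≤ k then h j else 0 with hh'
  have hseq : ∀ k : ℤ, ∃ u : ℕ → ℝ, (E k).Nonempty →
      Antitone u ∧ (∀ n, u n ∈ E k) ∧ ∀ t ∈ E k, ∃ n, u n < t := by
    intro k
    by_cases hk : (E k).Nonempty
    · obtain ⟨u, hu⟩ := exists_coinitial_seq hk fun t ht => Vf_left hp hv.1 a b ht
      exact ⟨u, fun _ => hu⟩
    · exact ⟨fun _ => 0, fun h => absurd h hk⟩
  choose u hu using hseq
  have hf : ∀ (k : ℤ) (n : ℕ), ∃ f : ℝ → ℝ≥0∞, Measurable f ∧ ∫⁻ s, f s ^ p * v s ≤ 1 ∧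
      ((E k).Nonempty → p2 k ^ (1 / p) ≤ ∫⁻ s in io a (min (u k n : EReal) b), f s) := by
    intro k n
    by_cases hk : (E k).Nonempty
    · have h1 : p2 k < V (u k n) := (hu k hk).2.1 n
      rw [hVdef, Vf, ← rpow_cancel (p2 k) e1, ENNReal.rpow_lt_rpow_iff hp0] at h1
      obtain ⟨f, hf1, hf2, hf3⟩ := exists_test hp hv.1 (measurableSet_io _ _)
        (fun s hs => hv.2 s (io_subset a (min_le_right _ _) hs)) h1
      exact ⟨f, hf1, hf2, fun _ => hf3⟩
    · exact ⟨0, measurable_const, by simp [hp0], fun h => absurd h hk⟩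
  choose φ hφ1 hφ2 hφ3 using hf
  set m : ℤ → ℝ≥0∞ := fun k => (h' k * p2 (-k)) ^ (1 / p) with hm
  refine ⟨fun n s => ⨆ k, m k * φ k n s,
    fun n t => ⨆ k, if (E k).Nonempty ∧ u k n < t then h' k else 0, ?_, ?_, ?_, ?_, ?_, ?_⟩
  · exact fun n => Measurable.iSup fun k => (hφ1 k n).const_mul _
  · refine fun n => Measurable.iSup fun k => Measurable.ite ?_ measurable_const measurable_const
    by_cases hk : (E k).Nonempty
    · simp only [hk, true_and]; exact measurableSet_Ioi
    · simp [hk]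
  · intro n n' hn t
    refine iSup_mono fun k => ?_
    by_cases hk : (E k).Nonempty ∧ u k n < t
    · rw [if_pos hk, if_pos ⟨hk.1, ((hu k hk.1).1 hn).trans_lt hk.2⟩]
    · rw [if_neg hk]; exact zero_le
  · intro n
    calc ∫⁻ x in io a b, (⨆ k, m k * φ k n x) ^ p * v x
        ≤ ∫⁻ x, (⨆ k, m k * φ k n x) ^ p * v x := setLIntegral_le_lintegral _ _
      _ ≤ ∫⁻ x, ∑' k, h' k * p2 (-k) * (φ k n x ^ p * v x) := by
          refine lintegral_mono fun x => ?_
          simp only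
          rw [rpow_iSup _ hp0, ENNReal.iSup_mul]
          refine iSup_le fun k => le_trans (le_of_eq ?_) (ENNReal.le_tsum k)
          rw [ENNReal.mul_rpow_of_nonneg _ _ hp0.le, hm, rpow_cancel _ e1, mul_assoc]
      _ = ∑' k, h' k * p2 (-k) * ∫⁻ x, φ k n x ^ p * v x := by
          have hmeas : ∀ k, Measurable fun x => φ k n x ^ p * v x :=
            fun k => ((hφ1 k n).pow_const _).mul hv.1
          rw [lintegral_tsum fun k => ((hmeas k).const_mul _).aemeasurable]
          congr 1; ext k
          rw [lintegral_const_mul _ (hmeas k)]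
      _ ≤ ∑' k : ℤ, p2 (-k) * h' k ^ (1 : ℝ) := by
          refine ENNReal.tsum_le_tsum fun k => (mul_le_mul_right (hφ2 k n) _).trans (le_of_eq ?_)
          rw [mul_one, ENNReal.rpow_one, mul_comm]
      _ ≤ c * ∑' k : ℤ, p2 (-k) * h k ^ (1 : ℝ) := H h
      _ = _ := by
          congr 2; ext k; rw [ENNReal.rpow_one, mul_comm]
  · intro n t ht
    refine iSup_le fun k => ?_
    by_cases hk : (E k).Nonempty ∧ u k n < t
    · rw [if_pos hk]
      have h1 : m k * p2 k ^ (1 / p) ≤ ∫⁻ s in io a t, ⨆ k, m k * φ k n s := by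
        calc m k * p2 k ^ (1 / p) ≤ m k * ∫⁻ s in io a (min (u k n : EReal) b), φ k n s :=
              mul_le_mul_right (hφ3 k n hk.1) _
          _ = ∫⁻ s in io a (min (u k n : EReal) b), m k * φ k n s :=
              (lintegral_const_mul _ (hφ1 k n)).symm
          _ ≤ ∫⁻ s in io a t, m k * φ k n s := lintegral_mono_set
              (io_subset a ((min_le_left _ _).trans (by exact_mod_cast hk.2.le)))
          _ ≤ _ := lintegral_mono fun s => le_iSup (fun k => m k * φ k n s) k
      refine le_trans (le_of_eq ?_) (ENNReal.rpow_le_rpow h1 hp0.le)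
      rw [hm, ENNReal.mul_rpow_of_nonneg _ _ hp0.le, rpow_cancel _ e1, rpow_cancel _ e1, mul_assoc,
        p2_neg_mul, mul_one]
    · rw [if_neg hk]; exact zero_le
  · intro t
    unfold Hf
    rw [ENNReal.tsum_eq_iSup_sum]
    refine iSup_le fun s => ?_
    rw [← Finset.sum_filter]
    rcases (s.filter fun k : ℤ => p2 k < V t).eq_empty_or_nonempty with hs | hs
    · rw [hs]; simp
    · set K := (s.filter fun k : ℤ => p2 k < V t).max' hs with hK
      have hKm := Finset.max'_mem _ hs
      have hKE : t ∈ E K := (Finset.mem_filter.1 hKm).2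
      obtain ⟨n, hn⟩ := (hu K ⟨t, hKE⟩).2.2 t hKE
      refine le_iSup_of_le n (le_iSup_of_le K ?_)
      rw [if_pos ⟨⟨t, hKE⟩, hn⟩]
      refine le_trans ?_ (ENNReal.sum_le_tsum (s.filter fun k : ℤ => p2 k < V t))
      refine Finset.sum_le_sum fun k hk => ?_
      rw [if_pos (Finset.le_max' _ k hk)]

/-- The measure on `(a, b)` with density `u`. -/
def wm (a b : EReal) (u : ℝ → ℝ≥0∞) : Measure ℝ := (volume.restrict (io a b)).withDensity u

instance (a b : EReal) (u : ℝ → ℝ≥0∞) : NullSingletonClass (wm a b u) := by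
  unfold wm; infer_instance

section Weight
variable {a b : EReal} {u : ℝ → ℝ≥0∞} (hu : IsWeight a b u)
include hu

lemma wm_sigmaFinite : SigmaFinite (wm a b u) :=
  SigmaFinite.withDensity_of_ne_top
    ((ae_restrict_mem (measurableSet_io a b)).mono fun x hx => (hu.2 x hx).2.ne)

lemma setLIntegral_wm {S : Set ℝ} (hS : MeasurableSet S) (F : ℝ → ℝ≥0∞) :
    ∫⁻ x in S, F x ∂(wm a b u) = ∫⁻ x in S ∩ io a b, F x * u x := by
  rw [wm, restrict_withDensity hS, Measure.restrict_restrict hS,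
    lintegral_withDensity_eq_lintegral_mul_non_measurable _ hu.1]
  · exact lintegral_congr fun x => mul_comm _ _
  · exact (ae_restrict_mem (hS.inter (measurableSet_io a b))).mono fun x hx => (hu.2 x hx.2).2

lemma lintegral_wm (F : ℝ → ℝ≥0∞) : ∫⁻ x, F x ∂(wm a b u) = ∫⁻ x in io a b, F x * u x := by
  have := setLIntegral_wm hu MeasurableSet.univ F
  rwa [Measure.restrict_univ, univ_inter] at this

lemma wm_pos {S : Set ℝ} (hS : MeasurableSet S) (hSI : S ⊆ io a b) (h : volume S ≠ 0) :
    wm a b u S ≠ 0 := by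
  intro h0
  rw [wm, withDensity_apply_eq_zero hu.1, Measure.restrict_apply] at h0
  · refine h (measure_mono_null (fun x hx => ?_) h0)
    exact ⟨⟨(hu.2 x (hSI hx)).1.ne', hx⟩, hSI hx⟩
  · exact (hu.1 (measurableSet_singleton 0).compl).inter hS

end Weight

lemma wm_apply {a b : EReal} (u : ℝ → ℝ≥0∞) {S : Set ℝ} (hS : MeasurableSet S) :
    wm a b u S = ∫⁻ x in S ∩ io a b, u x := by
  rw [wm, withDensity_apply _ hS, Measure.restrict_restrict hS]

lemma Iio_inter_io {a b : EReal} {x : ℝ} (hx : x ∈ io a b) : Iio x ∩ io a b = io a x := by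
  ext s
  constructor
  · rintro ⟨h1, h2⟩; exact ⟨h2.1, by exact_mod_cast mem_Iio.1 h1⟩
  · rintro ⟨h1, h2⟩; exact ⟨by exact_mod_cast h2, h1, h2.trans hx.2⟩

lemma Ioi_inter_io {a b : EReal} {x : ℝ} (hx : x ∈ io a b) : Ioi x ∩ io a b = io x b := by
  ext s
  constructor
  · rintro ⟨h1, h2⟩; exact ⟨by exact_mod_cast mem_Ioi.1 h1, h2.2⟩
  · rintro ⟨h1, h2⟩; exact ⟨by exact_mod_cast h1, hx.1.trans h1, h2⟩

lemma wm_Ioo {a b : EReal} (u : ℝ → ℝ≥0∞) {t x : ℝ} (ht : t ∈ io a b) (hx : x ∈ io a b) :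
    wm a b u (Ioo t x) = ∫⁻ s in io t x, u s := by
  rw [wm_apply u measurableSet_Ioo]
  congr 2
  ext s
  constructor
  · rintro ⟨h1, h2⟩; exact ⟨by exact_mod_cast h1.1, by exact_mod_cast h1.2⟩
  · rintro ⟨h1, h2⟩
    exact ⟨⟨by exact_mod_cast h1, by exact_mod_cast h2⟩, ht.1.trans h1, h2.trans hx.2⟩

lemma wm_Ioi {a b : EReal} (u : ℝ → ℝ≥0∞) {x : ℝ} (hx : x ∈ io a b) :
    wm a b u (Ioi x) = ∫⁻ s in io x b, u s := by
  rw [wm_apply u measurableSet_Ioi, Ioi_inter_io hx]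

lemma io_sub_left {a b : EReal} {x : ℝ} (hx : x ∈ io a b) : io a x ⊆ io a b :=
  io_subset a hx.2.le

lemma io_sub_right {a b : EReal} {x : ℝ} (hx : x ∈ io a b) : io x b ⊆ io a b :=
  fun _ hs => ⟨hx.1.trans hs.1, hs.2⟩

lemma lhs_eq {a b : EReal} {u w : ℝ → ℝ≥0∞} (hu : IsWeight a b u) (hw : IsWeight a b w)
    (q r : ℝ) (f : ℝ → ℝ≥0∞) :
    lhsIter a b q r u w f = (∫⁻ x, (∫⁻ t in Iio x, (∫⁻ s in io a t, f s) ^ q ∂(wm a b u)) ^ (r / q)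
      ∂(wm a b w)) ^ (1 / r) := by
  rw [lhsIter, lintegral_wm hw]
  congr 1
  refine setLIntegral_congr_fun (measurableSet_io a b) fun x hx => ?_
  rw [setLIntegral_wm hu measurableSet_Iio, Iio_inter_io hx]

lemma Vf_rpow {p : ℝ} {v : ℝ → ℝ≥0∞} {a b : EReal} {t : ℝ} (ht : t ∈ io a b) (y : ℝ) :
    Vf p v a b t ^ y = Vp p v a t ^ (p * y) := by
  rw [Vf_eq ht, ENNReal.rpow_mul]

lemma C5_eq {a b : EReal} {u w : ℝ → ℝ≥0∞} (hu : IsWeight a b u) (hw : IsWeight a b w)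
    (v : ℝ → ℝ≥0∞) (p q r : ℝ) :
    C5 a b p q r u v w = E5f (wm a b u) (wm a b w) (Vf p v a b) (r / (p - r)) (q / (p - q))
      (r * (p - q) / (q * (p - r))) ^ ((p - r) / (p * r)) := by
  rw [C5, E5f, lintegral_wm hw]
  congr 1
  refine setLIntegral_congr_fun (measurableSet_io a b) fun x hx => ?_
  rw [wm_Ioi w hx, mul_right_comm, Bf, setLIntegral_wm hu measurableSet_Iio, Iio_inter_io hx]
  congr 3
  refine setLIntegral_congr_fun (measurableSet_io a x) fun t ht => ?_
  have ht' := io_sub_left hx ht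
  rw [wm_Ioo u ht' hx, Vf_rpow ht', mul_right_comm, mul_div_assoc]

lemma Thf_wm {a b : EReal} {w : ℝ → ℝ≥0∞} (u : ℝ → ℝ≥0∞) (hw : IsWeight a b w) (ρ : ℝ) {x : ℝ}
    (hx : x ∈ io a b) : Thf (wm a b u) (wm a b w) ρ x
      = ∫⁻ s in io x b, w s * (∫⁻ σ in io x s, u σ) ^ ρ := by
  rw [Thf, setLIntegral_wm hw measurableSet_Ioi, Ioi_inter_io hx]
  refine setLIntegral_congr_fun (measurableSet_io x b) fun s hs => ?_
  rw [wm_Ioo u hx (io_sub_right hx hs), mul_comm]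

lemma E3f_le_C3 {a b : EReal} {u w : ℝ → ℝ≥0∞} (hw : IsWeight a b w)
    (v : ℝ → ℝ≥0∞) {p q r : ℝ} (he : 0 ≤ (p - r) / (p * r)) :
    E3f (wm a b u) (wm a b w) (Vf p v a b) (r / (p - r)) (r / q) ^ ((p - r) / (p * r))
      ≤ C3 a b p q r u v w := by
  rw [C3, E3f, lintegral_wm hw]
  refine ENNReal.rpow_le_rpow (setLIntegral_mono' (measurableSet_io a b) fun x hx => ?_) he
  rw [Thf_wm u hw _ hx, mul_right_comm]
  refine mul_le_mul_right ?_ _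
  have hac : (wm a b u).restrict (Iio x) ≪ volume.restrict (io a x) := by
    rw [wm, restrict_withDensity measurableSet_Iio, Measure.restrict_restrict measurableSet_Iio,
      Iio_inter_io hx]
    exact withDensity_absolutelyContinuous _ _
  refine (essSup_mono_measure hac).trans (le_of_eq (essSup_congr_ae ?_))
  filter_upwards [ae_restrict_mem (measurableSet_io a x)] with t ht
  have ht' := io_sub_left hx ht
  rw [wm_Ioo u ht' hx, Vf_rpow ht', mul_div_assoc]

lemma C3_le_E3s {a b : EReal} {u w : ℝ → ℝ≥0∞} (hw : IsWeight a b w)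
    (v : ℝ → ℝ≥0∞) {p q r : ℝ} (he : 0 ≤ (p - r) / (p * r)) :
    C3 a b p q r u v w ≤
      E3s (wm a b u) (wm a b w) (Vf p v a b) (r / (p - r)) (r / q) ^ ((p - r) / (p * r)) := by
  rw [C3, E3s, lintegral_wm hw]
  refine ENNReal.rpow_le_rpow (setLIntegral_mono' (measurableSet_io a b) fun x hx => ?_) he
  rw [Thf_wm u hw _ hx, mul_right_comm]
  refine mul_le_mul_left (mul_le_mul_right (essSup_le_of_ae_le _ ?_) _) _
  filter_upwards [ae_restrict_mem (measurableSet_io a x)] with t ht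
  have ht' := io_sub_left hx ht
  rw [mul_div_assoc, ← Vf_rpow ht', ← wm_Ioo u ht' hx]
  have htx : t ∈ Iio x := by
    have := ht.2
    exact_mod_cast this
  exact le_iSup (fun t : Iio x => wm a b u (Ioo t.1 x) ^ (r / q) * Vf p v a b t ^ (r / (p - r)))
    ⟨t, htx⟩

lemma Vf_ne_top {a b : EReal} {u v w : ℝ → ℝ≥0∞} (hu : IsWeight a b u) (hv : IsWeight a b v)
    (hw : IsWeight a b w) {p α β γ : ℝ} (hp : 1 ≤ p) (hα : 0 < α) (hβ : 0 < β) (hγ : 0 < γ)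
    (h : E5f (wm a b u) (wm a b w) (Vf p v a b) α β γ ≠ ⊤) :
    ∀ t ∈ io a b, Vf p v a b t ≠ ⊤ := by
  intro t ht hVt
  have hmono := Vf_mono hp hv.1 a b
  obtain ⟨y, hty, hyb⟩ := EReal.lt_iff_exists_real_btwn.1 ht.2
  have hty' : t < y := by exact_mod_cast hty
  have hsub : ∀ s, t ≤ s → s ≤ y → s ∈ io a b := fun s h1 h2 =>
    ⟨ht.1.trans_le (by exact_mod_cast h1), lt_of_le_of_lt (by exact_mod_cast h2) hyb⟩
  have hpos : ∀ {g : ℝ → ℝ≥0∞}, IsWeight a b g → ∀ s x, t ≤ s → s < x → x ≤ y →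
      wm a b g (Ioo s x) ≠ 0 := fun hg s x h1 h2 h3 =>
    wm_pos hg measurableSet_Ioo (fun z hz => hsub z (h1.trans hz.1.le) (hz.2.le.trans h3))
      (by rw [Real.volume_Ioo]; simpa using h2)
  have hB : ∀ x ∈ Ioo t y, Bf (wm a b u) (Vf p v a b) β x = ⊤ := by
    intro x hx
    refine top_unique ?_
    calc ⊤ = ∫⁻ _ in Ioo t x, ⊤ ∂(wm a b u) := by
          rw [setLIntegral_const, ENNReal.top_mul (hpos hu t x le_rfl hx.1 hx.2.le)]
      _ ≤ ∫⁻ s in Ioo t x, wm a b u (Ioo s x) ^ β * Vf p v a b s ^ β ∂(wm a b u) := by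
          refine setLIntegral_mono' measurableSet_Ioo fun s hs => ?_
          rw [top_unique (hVt.ge.trans (hmono hs.1.le)), ENNReal.top_rpow_of_pos hβ,
            ENNReal.mul_top]
          exact (ENNReal.rpow_pos_of_nonneg
            (pos_iff_ne_zero.2 (hpos hu s x hs.1.le hs.2 hx.2.le)) hβ.le).ne'
      _ ≤ _ := lintegral_mono_set fun s hs => hs.2
  refine h (top_unique ?_)
  calc ⊤ = ∫⁻ _ in Ioo t y, ⊤ ∂(wm a b w) := by
        rw [setLIntegral_const, ENNReal.top_mul (hpos hw t y le_rfl hty' le_rfl)]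
    _ ≤ ∫⁻ x in Ioo t y, wm a b w (Ioi x) ^ α * Bf (wm a b u) (Vf p v a b) β x ^ γ
          ∂(wm a b w) := by
        refine setLIntegral_mono' measurableSet_Ioo fun x hx => ?_
        rw [hB x hx, ENNReal.top_rpow_of_pos hγ, ENNReal.mul_top]
        refine (ENNReal.rpow_pos_of_nonneg (pos_iff_ne_zero.2 fun h0 => ?_) hα.le).ne'
        exact hpos hw x y hx.1.le hx.2 le_rfl (measure_mono_null (fun s hs => hs.1) h0)
    _ ≤ _ := setLIntegral_le_lintegral _ _

lemma exps_of {p q r : ℝ} (hq : 0 < q) (hr : 0 < r) (hrp : r < p) (hqp : q < p) :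
    Exps (q / p) (r / p) (r / (p - r)) (q / (p - q)) (r / q) (r * (p - q) / (q * (p - r))) := by
  have hp : 0 < p := hq.trans hqp
  have h1 : 0 < p - r := by linarith
  have h2 : 0 < p - q := by linarith
  refine ⟨by positivity, by rwa [div_lt_one hp], by positivity, by rwa [div_lt_one hp],
    by positivity, by positivity, by positivity, by positivity, ?_, ?_, ?_, ?_⟩ <;> field_simp

lemma upper_bound {p q r : ℝ} (hp : 1 ≤ p) (hq : 0 < q) (hr : 0 < r) (hrp : r < p) (hqp : q < p) :
    ∃ c : ℝ≥0∞, c ≠ ⊤ ∧ ∀ (a b : EReal) (u v w : ℝ → ℝ≥0∞),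
      IsWeight a b u → IsWeight a b v → IsWeight a b w → C5 a b p q r u v w ≠ ⊤ →
      ∀ f : ℝ → ℝ≥0∞, Measurable f → lhsIter a b q r u w f ≤
        c * (C3 a b p q r u v w + C5 a b p q r u v w) * rhsNorm a b p v f := by
  have e := exps_of hq hr hrp hqp
  have hp0 : 0 < p := by linarith
  have hpr : 0 < p - r := by linarith
  have he : 0 < (p - r) / (p * r) := by positivity
  obtain ⟨c, hc, H⟩ := upper_sigma e
  obtain ⟨c', hc', H'⟩ := exists_levels hp
  refine ⟨c ^ (1 / r) * p2 ((p - r) / (p * r)) * c' ^ (1 / p), ENNReal.mul_ne_top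
    (ENNReal.mul_ne_top (ENNReal.rpow_ne_top_of_nonneg (by positivity) hc) (p2_ne_top _))
    (ENNReal.rpow_ne_top_of_nonneg (by positivity) hc'), ?_⟩
  intro a b u v w hu hv hw h5 f hf
  have := wm_sigmaFinite hu
  have := wm_sigmaFinite hw
  have hmono := Vf_mono hp hv.1 a b
  rw [C5_eq hu hw] at h5
  have hE5 : E5f (wm a b u) (wm a b w) (Vf p v a b) (r / (p - r)) (q / (p - q))
      (r * (p - q) / (q * (p - r))) ≠ ⊤ := by
    intro h
    rw [h, ENNReal.top_rpow_of_pos he] at h5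
    exact h5 rfl
  obtain ⟨h, h1, h2⟩ := H' a b v hv (Vf_ne_top hu hv hw hp e.α0 e.β0 e.γ0 hE5) f hf
  set E3 := E3f (wm a b u) (wm a b w) (Vf p v a b) (r / (p - r)) (r / q) with hE3
  set E5 := E5f (wm a b u) (wm a b w) (Vf p v a b) (r / (p - r)) (q / (p - q))
      (r * (p - q) / (q * (p - r))) with hE5def
  set X := ∫⁻ x in io a b, f x ^ p * v x with hX
  have hJ : ∫⁻ x, (∫⁻ t in Iio x, (∫⁻ s in io a t, f s) ^ q ∂(wm a b u)) ^ (r / q) ∂(wm a b w) ≤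
      c * (E3 + E5) ^ (1 - r / p) * (c' * X) ^ (r / p) := by
    refine le_trans ?_ ((H (wm a b u) (wm a b w) (Vf p v a b) hmono h).trans
      (mul_le_mul_right (ENNReal.rpow_le_rpow h2 e.r0.le) _))
    refine lintegral_mono fun x => ENNReal.rpow_le_rpow ?_ e.ρ0.le
    rw [setLIntegral_wm hu measurableSet_Iio, setLIntegral_wm hu measurableSet_Iio]
    refine setLIntegral_mono' (measurableSet_Iio.inter (measurableSet_io a b)) fun t ht => ?_
    refine mul_le_mul_left ?_ _
    have h3 := ENNReal.rpow_le_rpow (h1 t ht.2) e.q0.le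
    rwa [← ENNReal.rpow_mul, mul_div_cancel₀ _ hp0.ne'] at h3
  rw [lhs_eq hu hw]
  refine (ENNReal.rpow_le_rpow hJ (by positivity)).trans ?_
  have hr' : 0 ≤ 1 / r := by positivity
  have hp' : 0 ≤ 1 / p := by positivity
  rw [ENNReal.mul_rpow_of_nonneg _ _ hr', ENNReal.mul_rpow_of_nonneg _ _ hr', ← ENNReal.rpow_mul,
    ← ENNReal.rpow_mul, (by field_simp : (1 - r / p) * (1 / r) = (p - r) / (p * r)),
    (by field_simp : r / p * (1 / r) = 1 / p), ENNReal.mul_rpow_of_nonneg _ _ hp', C5_eq hu hw,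
    rhsNorm, ← hX]
  have hE : (E3 + E5) ^ ((p - r) / (p * r)) ≤ p2 ((p - r) / (p * r)) *
      (C3 a b p q r u v w + E5 ^ ((p - r) / (p * r))) :=
    (add_rpow_le' _ _ he.le).trans (mul_le_mul_right (add_le_add_left (E3f_le_C3 hw v he.le) _) _)
  calc c ^ (1 / r) * (E3 + E5) ^ ((p - r) / (p * r)) * (c' ^ (1 / p) * X ^ (1 / p))
      ≤ c ^ (1 / r) * (p2 ((p - r) / (p * r)) * (C3 a b p q r u v w + E5 ^ ((p - r) / (p * r))))
        * (c' ^ (1 / p) * X ^ (1 / p)) := mul_le_mul_left (mul_le_mul_right hE _) _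
    _ = _ := by ring

lemma lower_bound {p q r : ℝ} (hp : 1 ≤ p) (hq : 0 < q) (hr : 0 < r) (hrp : r < p) (hqp : q < p) :
    ∃ c : ℝ≥0∞, c ≠ ⊤ ∧ ∀ (a b : EReal) (u v w : ℝ → ℝ≥0∞),
      IsWeight a b u → IsWeight a b v → IsWeight a b w → ∀ C : ℝ≥0∞,
      (∀ f : ℝ → ℝ≥0∞, Measurable f → lhsIter a b q r u w f ≤ C * rhsNorm a b p v f) →
      C3 a b p q r u v w + C5 a b p q r u v w ≤ c * C := by
  have e := exps_of hq hr hrp hqp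
  have hp0 : 0 < p := by linarith
  have hpr : 0 < p - r := by linarith
  have he : 0 < (p - r) / (p * r) := by positivity
  have hr' : 0 ≤ 1 / r := by positivity
  have hp' : 0 ≤ 1 / p := by positivity
  obtain ⟨c, hc, H⟩ := lower_sigma e
  obtain ⟨c', hc', H'⟩ := exists_test_seq hp
  refine ⟨2 * (c ^ (1 / r) * c' ^ (1 / p)), ENNReal.mul_ne_top (by simp) (ENNReal.mul_ne_top
    (ENNReal.rpow_ne_top_of_nonneg (by positivity) hc)
    (ENNReal.rpow_ne_top_of_nonneg (by positivity) hc')), ?_⟩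
  intro a b u v w hu hv hw C hC
  have := wm_sigmaFinite hu
  have := wm_sigmaFinite hw
  have hmono := Vf_mono hp hv.1 a b
  have hD : ∀ h : ℤ → ℝ≥0∞, Jf (wm a b u) (wm a b w) (Vf p v a b) (q / p) (r / q) h ≤
      C ^ r * c' ^ (r / p) * (∑' k : ℤ, h k * p2 (-k)) ^ (r / p) := by
    intro h
    obtain ⟨f, G, hf, hG, hGm, hfX, hGF, hHG⟩ := H' a b v hv h
    have hGq : ∀ n, Measurable fun t => G n t ^ (q / p) := fun n => (hG n).pow_const _
    have hinner : ∀ x, Monotone fun n => ∫⁻ t in Iio x, G n t ^ (q / p) ∂(wm a b u) :=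
      fun x m n hmn => lintegral_mono fun t => ENNReal.rpow_le_rpow (hGm hmn t) e.q0.le
    have h1 : Jf (wm a b u) (wm a b w) (Vf p v a b) (q / p) (r / q) h ≤
        ⨆ n, ∫⁻ x, (∫⁻ t in Iio x, G n t ^ (q / p) ∂(wm a b u)) ^ (r / q) ∂(wm a b w) := by
      rw [← lintegral_iSup]
      · refine lintegral_mono fun x => ?_
        simp only
        rw [← rpow_iSup _ e.ρ0, ← lintegral_iSup hGq
          fun m n hmn t => ENNReal.rpow_le_rpow (hGm hmn t) e.q0.le]
        refine ENNReal.rpow_le_rpow (lintegral_mono fun t => ?_) e.ρ0.le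
        simp only
        rw [← rpow_iSup _ e.q0]
        exact ENNReal.rpow_le_rpow (hHG t) e.q0.le
      · exact fun n => (Monotone.measurable fun x y hxy =>
          lintegral_mono_set (Iio_subset_Iio hxy)).pow_const _
      · exact fun m n hmn x => ENNReal.rpow_le_rpow (hinner x hmn) e.ρ0.le
    refine h1.trans (iSup_le fun n => ?_)
    have h2 : ∫⁻ x, (∫⁻ t in Iio x, G n t ^ (q / p) ∂(wm a b u)) ^ (r / q) ∂(wm a b w) ≤
        ∫⁻ x, (∫⁻ t in Iio x, (∫⁻ s in io a t, f n s) ^ q ∂(wm a b u)) ^ (r / q) ∂(wm a b w) := by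
      refine lintegral_mono fun x => ENNReal.rpow_le_rpow ?_ e.ρ0.le
      rw [setLIntegral_wm hu measurableSet_Iio, setLIntegral_wm hu measurableSet_Iio]
      refine setLIntegral_mono' (measurableSet_Iio.inter (measurableSet_io a b)) fun t ht => ?_
      refine mul_le_mul_left ?_ _
      have h3 := ENNReal.rpow_le_rpow (hGF n t ht.2) e.q0.le
      rwa [← ENNReal.rpow_mul, mul_div_cancel₀ _ hp0.ne'] at h3
    have h3 := hC (f n) (hf n)
    rw [lhs_eq hu hw] at h3
    have h4 := ENNReal.rpow_le_rpow h3 hr.le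
    rw [rpow_cancel _ (by field_simp : 1 / r * r = 1)] at h4
    refine (h2.trans h4).trans ?_
    rw [ENNReal.mul_rpow_of_nonneg _ _ hr.le, mul_assoc,
      ← ENNReal.mul_rpow_of_nonneg _ _ e.r0.le, rhsNorm, ← ENNReal.rpow_mul,
      (by field_simp : 1 / p * r = r / p)]
    exact mul_le_mul_right (ENNReal.rpow_le_rpow (hfX n) e.r0.le) _
  obtain ⟨g3, g5⟩ := H (wm a b u) (wm a b w) (Vf p v a b) hmono _ hD
  have key : ∀ E : ℝ≥0∞, E ^ (1 - r / p) ≤ c * (C ^ r * c' ^ (r / p)) →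
      E ^ ((p - r) / (p * r)) ≤ c ^ (1 / r) * c' ^ (1 / p) * C := by
    intro E hE
    have h1 := ENNReal.rpow_le_rpow hE hr'
    rw [ENNReal.mul_rpow_of_nonneg _ _ hr', ENNReal.mul_rpow_of_nonneg _ _ hr',
      ← ENNReal.rpow_mul, ← ENNReal.rpow_mul c', rpow_cancel _ (by field_simp : r * (1 / r) = 1),
      (by field_simp : (1 - r / p) * (1 / r) = (p - r) / (p * r)),
      (by field_simp : r / p * (1 / r) = 1 / p)] at h1
    exact h1.trans (le_of_eq (by ring))
  rw [C5_eq hu hw]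
  refine (add_le_add ((C3_le_E3s hw v he.le).trans (key _ g3)) (key _ g5)).trans (le_of_eq ?_)
  ring

theorem iterated_hardy_case_iv (p q r : ℝ) (hp : 1 ≤ p) (hq : 0 < q) (hr : 0 < r)
    (hrp : r < p) (hqp : q < p) :
    ∃ c₁ c₂ : ℝ≥0∞, 0 < c₁ ∧ c₂ < ⊤ ∧
      ∀ (a b : EReal), a < b → ∀ u v w : ℝ → ℝ≥0∞,
        IsWeight a b u → IsWeight a b v → IsWeight a b w →
        ((∃ C : ℝ≥0∞, 0 < C ∧ C < ⊤ ∧ ∀ f : ℝ → ℝ≥0∞, Measurable f →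
            lhsIter a b q r u w f ≤ C * rhsNorm a b p v f) ↔
          (C3 a b p q r u v w < ⊤ ∧ C5 a b p q r u v w < ⊤)) ∧
        c₁ * (C3 a b p q r u v w + C5 a b p q r u v w) ≤ bestIter a b p q r u v w ∧
        bestIter a b p q r u v w ≤ c₂ * (C3 a b p q r u v w + C5 a b p q r u v w) := by
  obtain ⟨k, hk, L⟩ := lower_bound hp hq hr hrp hqp
  obtain ⟨c, hc, U⟩ := upper_bound hp hq hr hrp hqp
  have hk1 : k + 1 ≠ ⊤ := ENNReal.add_ne_top.2 ⟨hk, by simp⟩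
  have hk0 : k + 1 ≠ 0 := by simp
  refine ⟨(k + 1)⁻¹, c + 1, ENNReal.inv_pos.2 hk1,
    (ENNReal.add_ne_top.2 ⟨hc, by simp⟩).lt_top, ?_⟩
  intro a b _ u v w hu hv hw
  refine ⟨⟨?_, ?_⟩, ?_, ?_⟩
  · rintro ⟨C, -, hC, H⟩
    have h := (L a b u v w hu hv hw C H).trans_lt (ENNReal.mul_lt_top hk.lt_top hC)
    exact ENNReal.add_lt_top.1 h
  · rintro ⟨h3, h5⟩
    have hE : c * (C3 a b p q r u v w + C5 a b p q r u v w) < ⊤ :=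
      ENNReal.mul_lt_top hc.lt_top (ENNReal.add_lt_top.2 ⟨h3, h5⟩)
    refine ⟨c * (C3 a b p q r u v w + C5 a b p q r u v w) + 1, by simp,
      ENNReal.add_lt_top.2 ⟨hE, by simp⟩, fun f hf => ?_⟩
    exact (U a b u v w hu hv hw h5.ne f hf).trans (mul_le_mul_left le_self_add _)
  · refine le_sInf fun C hC => ?_
    calc (k + 1)⁻¹ * (C3 a b p q r u v w + C5 a b p q r u v w)
        ≤ (k + 1)⁻¹ * ((k + 1) * C) := mul_le_mul_right
          ((L a b u v w hu hv hw C hC).trans (mul_le_mul_left le_self_add _)) _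
      _ = C := by rw [← mul_assoc, ENNReal.inv_mul_cancel hk0 hk1, one_mul]
  · by_cases h5 : C5 a b p q r u v w = ⊤
    · rw [h5, add_top, ENNReal.mul_top (by simp)]
      exact le_top
    · refine sInf_le fun f hf => (U a b u v w hu hv hw h5 f hf).trans ?_
      exact mul_le_mul_left (mul_le_mul_left le_self_add _) _
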